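/- arXiv:2304.02000 — 3 statements merged into one kernel-verified Lean document; each statement's English description precedes it below -/
import Mathlib

section
/- Let p, q ≥ 1 and consider the quiver Q_{3,3} with dimension vector [p,p,p,q,q,q]. Let a = [a_1,…,a_6] where a_1, a_2, a_3 are weakly decreasing real p-sequences and a_4, a_5, a_6 are weakly decreasing real q-sequences. Then there exists r ∈ H_{Q_{3,3}}(E) with μ_x(r) = −diag(a_x) for all x = 1,…,6 if and only if: Σ_{x=1}^{6} Σ_j a_x(j) = 0; a_1(p) ≥ 0; a_2(p) ≥ 0; a_5(1) ≤ 0; a_6(1) ≤ 0; and Σ_{x=1}^{6} Σ_{j∈K_x} a_x(j) ≤ 0 for every family K = [K_1,…,K_6] in Int(𝒜,p,q). -/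
open Matrix

noncomputable section

/-- The standard flag subspace `span(e_1, …, e_j)` of `ℂ^n` (with 0-indexed coordinates,
this is the space of vectors vanishing on all coordinates `≥ j`). -/
def stdFlag (n j : ℕ) : Submodule ℂ (Fin n → ℂ) where
  carrier := {f | ∀ i : Fin n, j ≤ (i : ℕ) → f i = 0}
  add_mem' := by
    intro a b ha hb i hi
    simp only [Pi.add_apply, ha i hi, hb i hi, add_zero]
  zero_mem' := by intro i _; rfl
  smul_mem' := by
    intro c f hf i hi
    simp only [Pi.smul_apply, hf i hi, smul_zero]

/-- A quiver given by source and target maps has no oriented cycles. -/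
def NoCycles {V A : Type} (src tgt : A → V) : Prop :=
  ∀ (k : ℕ) (f : Fin (k + 1) → A),
    (∀ i : Fin k, tgt (f i.castSucc) = src (f i.succ)) →
    tgt (f (Fin.last k)) ≠ src (f 0)

/-- `α ≤_Q n` : every representation of the quiver on the spaces `ℂ^{n_x}` has a
subrepresentation of dimension vector `α`. -/
def HasSubrepOfDim {V A : Type} (src tgt : A → V) (n : V → ℕ) (α : V → ℕ) : Prop :=
  ∀ r : ∀ a : A, (Fin (n (src a)) → ℂ) →ₗ[ℂ] (Fin (n (tgt a)) → ℂ),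
    ∃ S : ∀ x : V, Submodule ℂ (Fin (n x) → ℂ),
      (∀ x : V, Module.finrank ℂ (S x) = α x) ∧
      (∀ a : A, (S (src a)).map (r a) ≤ S (tgt a))

/-- A family `K = (K_x)` of subsets `K_x ⊆ {1,…,n_x}` is `Q`-intersecting for `n` if every
representation of the quiver on the `ℂ^{n_x}` admits a subrepresentation `S` lying in the
Schubert variety indexed by `K` (w.r.t. the standard flags). -/
def IsQIntersecting {V A : Type} (src tgt : A → V) (n : V → ℕ)
    (K : ∀ x : V, Finset (Fin (n x))) : Prop :=
  ∀ r : ∀ a : A, (Fin (n (src a)) → ℂ) →ₗ[ℂ] (Fin (n (tgt a)) → ℂ),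
    ∃ S : ∀ x : V, Submodule ℂ (Fin (n x) → ℂ),
      (∀ x : V, Module.finrank ℂ (S x) = (K x).card) ∧
      (∀ x : V, ∀ j : Fin (K x).card,
        (j : ℕ) + 1 ≤ Module.finrank ℂ
          ((S x ⊓ stdFlag (n x) ((((K x).orderIsoOfFin rfl j : Fin (n x)) : ℕ) + 1) :
            Submodule ℂ (Fin (n x) → ℂ)))) ∧
      (∀ a : A, (S (src a)).map (r a) ≤ S (tgt a))

/-- The expected dimension `edim_{Q,B}(K, n)`. -/
def edimQB {V A : Type} [Fintype V] [Fintype A] (src tgt : A → V) (n : V → ℕ)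
    (K : ∀ x : V, Finset (Fin (n x))) : ℤ :=
  (∑ x : V, ∑ j : Fin (K x).card,
      (((((K x).orderIsoOfFin rfl j : Fin (n x)) : ℕ) : ℤ) - ((j : ℕ) : ℤ))) -
  ∑ a : A, ((K (src a)).card : ℤ) * ((n (tgt a) : ℤ) - ((K (tgt a)).card : ℤ))

/-- Composition `K ∘ L` of a family of subsets with a family of subsets of the index sets. -/
def composeFam {V : Type} {n : V → ℕ} (K : ∀ x : V, Finset (Fin (n x)))
    (L : ∀ x : V, Finset (Fin (K x).card)) : ∀ x : V, Finset (Fin (n x)) :=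
  fun x => (L x).image (fun j => ((K x).orderIsoOfFin rfl j : Fin (n x)))

/-- The moment map for the action of `∏_x U(n_x)` on the representation space of the quiver,
`μ_x(r) = Σ_{b : y→x} r_b r_b^* − Σ_{a : x→y} r_a^* r_a`. -/
def momentMap {V A : Type} [Fintype A] [DecidableEq V] (src tgt : A → V) (n : V → ℕ)
    (r : ∀ a : A, Matrix (Fin (n (tgt a))) (Fin (n (src a))) ℂ) (x : V) :
    Matrix (Fin (n x)) (Fin (n x)) ℂ :=
  (∑ a : A, if h : tgt a = x then
      Matrix.reindex (finCongr (congrArg n h)) (finCongr (congrArg n h)) (r a * (r a)ᴴ)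
    else 0) -
  (∑ a : A, if h : src a = x then
      Matrix.reindex (finCongr (congrArg n h)) (finCongr (congrArg n h)) ((r a)ᴴ * r a)
    else 0)

/-! ### The quiver `Q_{3,3}` with vertices `1,…,6` and arrows `1→3, 2→3, 4→3, 4→5, 4→6`
(0-indexed: `0→2, 1→2, 3→2, 3→4, 3→5`). -/

def q33src : Fin 5 → Fin 6 := ![0, 1, 3, 3, 3]

def q33tgt : Fin 5 → Fin 6 := ![2, 2, 2, 4, 5]

/-- The dimension vector `[p,p,p,q,q,q]` for `Q_{3,3}`. -/
def n33 (p q : ℕ) : Fin 6 → ℕ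
  | ⟨0, _⟩ => p
  | ⟨1, _⟩ => p
  | ⟨2, _⟩ => p
  | ⟨3, _⟩ => q
  | ⟨4, _⟩ => q
  | ⟨5, _⟩ => q

/-- A family of subsets for `Q_{3,3}` built from three subsets of `{1,…,p}` (vertices 1,2,3)
and three subsets of `{1,…,q}` (vertices 4,5,6). -/
def fam6 (p q : ℕ) (K : Fin 3 → Finset (Fin p)) (L : Fin 3 → Finset (Fin q)) :
    ∀ x : Fin 6, Finset (Fin (n33 p q x))
  | ⟨0, _⟩ => K 0
  | ⟨1, _⟩ => K 1
  | ⟨2, _⟩ => K 2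
  | ⟨3, _⟩ => L 0
  | ⟨4, _⟩ => L 1
  | ⟨5, _⟩ => L 2

/-! ### The pseudo-unitary group `U(p,q)` -/

/-- The matrix `η = diag(I_p, −I_q)`. -/
def etaMat (p q : ℕ) : Matrix (Fin (p + q)) (Fin (p + q)) ℂ :=
  Matrix.diagonal fun i => if (i : ℕ) < p then 1 else -1

/-- Membership in `U(p,q) = {g : gᴴ η g = η}`. -/
def InUpq (p q : ℕ) (g : Matrix (Fin (p + q)) (Fin (p + q)) ℂ) : Prop :=
  gᴴ * etaMat p q * g = etaMat p q

/-- The central element `Z = diag(q I_p, −p I_q)`. -/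
def Zmat (p q : ℕ) : Matrix (Fin (p + q)) (Fin (p + q)) ℂ :=
  Matrix.diagonal fun i => if (i : ℕ) < p then (q : ℂ) else -(p : ℂ)

/-- The complex diagonal matrix with entries a real sequence. -/
def Dmat {n : ℕ} (A : Fin n → ℝ) : Matrix (Fin n) (Fin n) ℂ :=
  Matrix.diagonal fun i => (A i : ℂ)

/-- The block-diagonal matrix `u ⊕ v`. -/
def blockDiag {p q : ℕ} (u : Matrix (Fin p) (Fin p) ℂ) (v : Matrix (Fin q) (Fin q) ℂ) :
    Matrix (Fin (p + q)) (Fin (p + q)) ℂ :=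
  Matrix.reindex finSumFinEquiv finSumFinEquiv (Matrix.fromBlocks u 0 0 v)

end

open Cardinal in
theorem exists_ringEquiv_comp_algebraMap {R K L : Type} [CommRing R] [Field K] [Field L]
    [IsAlgClosed K] [IsAlgClosed L] [Algebra R K] [Algebra R L] [FaithfulSMul R K]
    [FaithfulSMul R L] (hR : #R ≤ ℵ₀) (hK : ℵ₀ < #K) (hKL : #K = #L) :
    ∃ σ : K ≃+* L, ∀ c : R, σ (algebraMap R K c) = algebraMap R L c := by
  have : Nontrivial R := RingHom.domain_nontrivial (algebraMap R K)
  obtain ⟨s, hs⟩ := exists_isTranscendenceBasis R K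
  obtain ⟨t, ht⟩ := exists_isTranscendenceBasis R L
  have hs' := IsAlgClosed.cardinal_eq_cardinal_transcendence_basis_of_aleph0_lt' _ hs hR hK
  have ht' := IsAlgClosed.cardinal_eq_cardinal_transcendence_basis_of_aleph0_lt' _ ht hR
    (hKL ▸ hK)
  obtain ⟨e⟩ : Nonempty (s ≃ t) := Cardinal.eq.1 (hs'.symm.trans (hKL.trans ht'))
  let := IsAlgClosed.isAlgClosure_of_transcendence_basis _ hs
  let := IsAlgClosed.isAlgClosure_of_transcendence_basis _ ht
  let f : Algebra.adjoin R (Set.range ((↑) : s → K)) ≃ₐ[R]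
      Algebra.adjoin R (Set.range ((↑) : t → L)) :=
    (hs.1.aevalEquiv.symm.trans (MvPolynomial.renameEquiv R e)).trans ht.1.aevalEquiv
  refine ⟨IsAlgClosure.equivOfEquiv K L f.toRingEquiv, fun c => ?_⟩
  have h := IsAlgClosure.equivOfEquiv_algebraMap K L f.toRingEquiv (algebraMap R _ c)
  rw [← IsScalarTower.algebraMap_apply] at h
  rw [h]
  have h2 : f.toRingEquiv (algebraMap R _ c) = algebraMap R _ c := f.commutes c
  rw [h2, ← IsScalarTower.algebraMap_apply]

open Cardinal in
/-- Two algebraically independent finite tuples of complex numbers are conjugate under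
`Aut(ℂ)`. -/
theorem exists_complex_ringEquiv_of_algebraicIndependent {I : Type} [Finite I] {x y : I → ℂ}
    (hx : AlgebraicIndependent ℚ x) (hy : AlgebraicIndependent ℚ y) :
    ∃ σ : ℂ ≃+* ℂ, ∀ i, σ (x i) = y i := by
  have hR : #(MvPolynomial I ℚ) ≤ ℵ₀ := by
    have := Fintype.ofFinite I
    refine MvPolynomial.cardinalMk_le_max_lift.trans ?_
    simp
  have key := @exists_ringEquiv_comp_algebraMap (MvPolynomial I ℚ) ℂ ℂ _ _ _ _ _
    (MvPolynomial.aeval x : MvPolynomial I ℚ →ₐ[ℚ] ℂ).toRingHom.toAlgebra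
    (MvPolynomial.aeval y : MvPolynomial I ℚ →ₐ[ℚ] ℂ).toRingHom.toAlgebra
    (by
      let := (MvPolynomial.aeval x : MvPolynomial I ℚ →ₐ[ℚ] ℂ).toRingHom.toAlgebra
      exact (faithfulSMul_iff_algebraMap_injective _ _).2 hx)
    (by
      let := (MvPolynomial.aeval y : MvPolynomial I ℚ →ₐ[ℚ] ℂ).toRingHom.toAlgebra
      exact (faithfulSMul_iff_algebraMap_injective _ _).2 hy)
    hR (by rw [Cardinal.mk_complex]; exact Cardinal.aleph0_lt_continuum) rfl
  obtain ⟨σ, hσ⟩ := key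
  refine ⟨σ, fun i => ?_⟩
  have h := hσ (MvPolynomial.X i)
  change σ (MvPolynomial.aeval x (MvPolynomial.X i)) = MvPolynomial.aeval y (MvPolynomial.X i) at h
  simpa using h

/-- Algebraically independent finite tuples of complex numbers are dense. -/
theorem dense_algebraicIndependent (I : Type) [Fintype I] :
    Dense {x : I → ℂ | AlgebraicIndependent ℚ x} := by
  have hset : {x : I → ℂ | AlgebraicIndependent ℚ x} =
      ⋂ f : {f : MvPolynomial I ℚ // f ≠ 0}, {x : I → ℂ | MvPolynomial.aeval x f.1 ≠ 0} := by
    ext x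
    simp only [Set.mem_ofPred_eq, Set.mem_iInter, algebraicIndependent_iff, Subtype.forall]
    exact forall_congr' fun f => by tauto
  have hcont : ∀ f : MvPolynomial I ℚ,
      Continuous fun x : I → ℂ => MvPolynomial.aeval x f := fun f => by
    simp only [MvPolynomial.aeval_def, MvPolynomial.eval₂_eq']
    fun_prop
  have : Countable (MvPolynomial I ℚ) := by
    refine Cardinal.mk_le_aleph0_iff.1 (MvPolynomial.cardinalMk_le_max_lift.trans ?_)
    simp
  rw [hset]
  refine dense_iInter_of_isOpen (fun f => isOpen_ne_fun (hcont f.1) continuous_const) ?_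
  rintro ⟨f, hf⟩
  rw [dense_iff_inter_open]
  rintro U hU ⟨x, hx⟩
  by_contra hne
  obtain ⟨ε, hε, hball⟩ := Metric.isOpen_iff.1 hU x hx
  apply hf
  have h0 : MvPolynomial.map (algebraMap ℚ ℂ) f = 0 := by
    refine MvPolynomial.funext_set (fun i => Metric.ball (x i) ε) (fun i => ?_) fun y hy => ?_
    · exact infinite_of_mem_nhds (x i) (Metric.ball_mem_nhds _ hε)
    · have hyU : y ∈ U := hball (by
        rw [Metric.mem_ball, dist_pi_lt_iff hε]
        exact fun i => hy i (Set.mem_univ i))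
      by_contra hne'
      refine hne ⟨y, hyU, ?_⟩
      simpa [MvPolynomial.aeval_def, MvPolynomial.eval_map] using hne'
  exact MvPolynomial.map_injective _ (algebraMap ℚ ℂ).injective (by simpa using h0)

/-- A flag whose `j`-th step has dimension at least `j + 1` carries an adapted linearly independent
family. -/
theorem exists_linearIndependent_mem_of_lt_finrank {E : Type*} [AddCommGroup E] [Module ℂ E]
    [FiniteDimensional ℂ E] (W : ℕ → Submodule ℂ E) :
    ∀ k : ℕ, (∀ j < k, j + 1 ≤ Module.finrank ℂ (W j)) →
      ∃ v : Fin k → E, LinearIndependent ℂ v ∧ ∀ j : Fin k, v j ∈ W j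
  | 0, _ => ⟨fun j => j.elim0, linearIndependent_empty_type, fun j => j.elim0⟩
  | k + 1, h => by
    obtain ⟨v, hv, hvW⟩ := exists_linearIndependent_mem_of_lt_finrank W k fun j hj =>
      h j (by omega)
    have hnot : ¬ W k ≤ Submodule.span ℂ (Set.range v) := fun hle => by
      have h1 := Submodule.finrank_mono hle
      have h2 := h k (by omega)
      rw [finrank_span_eq_card hv, Fintype.card_fin] at h1
      omega
    obtain ⟨x, hxW, hx⟩ := SetLike.not_le_iff_exists.1 hnot
    refine ⟨Fin.snoc (α := fun _ => E) v x, hv.finSnoc hx, fun j => ?_⟩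
    refine Fin.lastCases ?_ (fun i => ?_) j
    · simpa using hxW
    · simpa using hvW i

/-- A subspace satisfying the Schubert conditions `dim (S ∩ F_{κ j}) ≥ j + 1` has an orthonormal
basis adapted to the flag. -/
theorem exists_orthonormal_frame {n k : ℕ} {S : Submodule ℂ (Fin n → ℂ)} {κ : Fin k → Fin n}
    (hκ : Monotone κ) (hS : Module.finrank ℂ S = k)
    (hdim : ∀ j : Fin k, (j : ℕ) + 1 ≤
      Module.finrank ℂ (S ⊓ stdFlag n (κ j + 1) : Submodule ℂ (Fin n → ℂ))) :
    ∃ T : Matrix (Fin n) (Fin k) ℂ, Tᴴ * T = 1 ∧ (∀ i j, κ j < i → T i j = 0) ∧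
      LinearMap.range T.mulVecLin = S := by
  let W : ℕ → Submodule ℂ (Fin n → ℂ) := fun j =>
    if h : j < k then S ⊓ stdFlag n (κ ⟨j, h⟩ + 1) else ⊤
  obtain ⟨v, hv, hvW⟩ := exists_linearIndependent_mem_of_lt_finrank W k (by
    intro j hj
    rw [show W j = S ⊓ stdFlag n (κ ⟨j, hj⟩ + 1) from dif_pos hj]
    exact hdim ⟨j, hj⟩)
  replace hvW : ∀ j : Fin k, v j ∈ S ⊓ stdFlag n (κ j + 1) := fun j => by
    have := hvW j
    simpa only [W, j.2, dite_true, Fin.eta] using this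
  let e := WithLp.linearEquiv 2 ℂ (Fin n → ℂ)
  let f : Fin k → EuclideanSpace ℂ (Fin n) := fun j => e.symm (v j)
  have hf : LinearIndependent ℂ f := hv.map' e.symm.toLinearMap e.symm.ker
  let g := InnerProductSpace.gramSchmidtNormed ℂ f
  have hg : Orthonormal ℂ g := InnerProductSpace.gramSchmidtNormed_orthonormal hf
  have hgW : ∀ j, e (g j) ∈ S ⊓ stdFlag n (κ j + 1) := fun j => by
    have h1 : g j ∈ Submodule.span ℂ (f '' Set.Iic j) := by
      refine Submodule.smul_mem _ _ (InnerProductSpace.gramSchmidt_mem_span ℂ f le_rfl)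
    have h2 : Submodule.span ℂ (f '' Set.Iic j) ≤
        (S ⊓ stdFlag n (κ j + 1)).comap e.toLinearMap := by
      rw [Submodule.span_le]
      rintro _ ⟨i, hi, rfl⟩
      have hi' : κ i ≤ κ j := hκ hi
      refine ⟨by simpa [f] using (hvW i).1, fun l hl => ?_⟩
      have hl' : (κ i : ℕ) + 1 ≤ l := le_trans (by simpa using hi') hl
      simpa [f] using (hvW i).2 l hl'
    exact h2 h1
  let T : Matrix (Fin n) (Fin k) ℂ := Matrix.of fun i j => g j i
  have hT : Tᴴ * T = 1 := by
    ext i j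
    have := orthonormal_iff_ite.1 hg i j
    rw [PiLp.inner_apply] at this
    rw [Matrix.mul_apply, Matrix.one_apply, ← this]
    refine Finset.sum_congr rfl fun l _ => ?_
    simp [T, mul_comm]
  refine ⟨T, hT, fun i j hij => (hgW j).2 i (by simpa using hij), ?_⟩
  refine Submodule.eq_of_le_of_finrank_eq ?_ ?_
  · rw [Matrix.range_mulVecLin, Submodule.span_le]
    rintro _ ⟨j, rfl⟩
    exact (hgW j).1
  · have hinj : Function.Injective T.mulVecLin := fun x y hxy => by
      have := congrArg (fun z => Tᴴ *ᵥ z) hxy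
      simpa [Matrix.mulVec_mulVec, hT] using this
    rw [LinearMap.finrank_range_of_inj hinj, hS]
    simp

/-- The span of the columns of a left-invertible matrix with prescribed column heights satisfies
the Schubert conditions. -/
theorem schubert_of_frame {n k : ℕ} {κ : Fin k → Fin n} (hκ : Monotone κ)
    {T : Matrix (Fin n) (Fin k) ℂ} {W : Matrix (Fin k) (Fin n) ℂ} (hW : W * T = 1)
    (hT : ∀ i j, κ j < i → T i j = 0) :
    Module.finrank ℂ (LinearMap.range T.mulVecLin) = k ∧ ∀ j : Fin k, (j : ℕ) + 1 ≤
      Module.finrank ℂ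
        (LinearMap.range T.mulVecLin ⊓ stdFlag n (κ j + 1) : Submodule ℂ (Fin n → ℂ)) := by
  have hinj : Function.Injective T.mulVecLin := fun x y hxy => by
    have := congrArg (fun z => W *ᵥ z) hxy
    simpa [Matrix.mulVec_mulVec, hW] using this
  refine ⟨by rw [LinearMap.finrank_range_of_inj hinj]; simp, fun j => ?_⟩
  have hli : LinearIndependent ℂ T.col := by
    have hcol : T.col = T.mulVecLin ∘ Pi.basisFun ℂ (Fin k) := by
      ext l i
      simp [Matrix.col]
    rw [hcol]
    exact (Pi.basisFun ℂ (Fin k)).linearIndependent.map' T.mulVecLin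
      (LinearMap.ker_eq_bot.2 hinj)
  let u : Fin (j + 1) → (Fin n → ℂ) := fun l => T.col ⟨l, by omega⟩
  have hu : LinearIndependent ℂ u := hli.comp (fun l : Fin (j + 1) => (⟨l, by omega⟩ : Fin k))
    fun a b hab => by simpa [Fin.ext_iff] using hab
  have hle : Submodule.span ℂ (Set.range u) ≤
      LinearMap.range T.mulVecLin ⊓ stdFlag n (κ j + 1) := by
    rw [Submodule.span_le]
    rintro _ ⟨l, rfl⟩
    refine ⟨?_, fun i hi => hT i _ ?_⟩
    · rw [Matrix.range_mulVecLin]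
      exact Submodule.subset_span ⟨_, rfl⟩
    · have : κ ⟨l, by omega⟩ ≤ κ j := hκ (by rw [Fin.le_def]; exact Nat.lt_succ_iff.1 l.2)
      rw [Fin.lt_def]
      rw [Fin.le_def] at this
      omega
  have := Submodule.finrank_mono hle
  rwa [finrank_span_eq_card hu, Fintype.card_fin] at this

section Intersecting

variable {V A : Type} {src tgt : A → V} {n : V → ℕ} {K : ∀ x : V, Finset (Fin (n x))}

theorem orderIsoOfFin_monotone {m : ℕ} (L : Finset (Fin m)) :
    Monotone fun j : Fin L.card => (L.orderIsoOfFin rfl j : Fin m) :=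
  fun _ _ h => (L.orderIsoOfFin rfl).monotone h

/-- Frame version of the existence of a subrepresentation in the Schubert variety of `K`. -/
def HasFrame (src tgt : A → V) (n : V → ℕ) (K : ∀ x : V, Finset (Fin (n x)))
    (R : ∀ a : A, Matrix (Fin (n (tgt a))) (Fin (n (src a))) ℂ) : Prop :=
  ∃ (T : ∀ x, Matrix (Fin (n x)) (Fin (K x).card) ℂ)
    (W : ∀ x, Matrix (Fin (K x).card) (Fin (n x)) ℂ),
    (∀ x, W x * T x = 1) ∧
    (∀ x i j, ((K x).orderIsoOfFin rfl j : Fin (n x)) < i → T x i j = 0) ∧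
    ∀ a, R a * T (src a) = T (tgt a) * (W (tgt a) * (R a * T (src a)))

theorem HasFrame.exists_submodule {R : ∀ a : A, Matrix (Fin (n (tgt a))) (Fin (n (src a))) ℂ}
    (h : HasFrame src tgt n K R) :
    ∃ S : ∀ x : V, Submodule ℂ (Fin (n x) → ℂ),
      (∀ x : V, Module.finrank ℂ (S x) = (K x).card) ∧
      (∀ x : V, ∀ j : Fin (K x).card,
        (j : ℕ) + 1 ≤ Module.finrank ℂ
          ((S x ⊓ stdFlag (n x) ((((K x).orderIsoOfFin rfl j : Fin (n x)) : ℕ) + 1) :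
            Submodule ℂ (Fin (n x) → ℂ)))) ∧
      (∀ a : A, (S (src a)).map (R a).mulVecLin ≤ S (tgt a)) := by
  obtain ⟨T, W, hW, hT, hR⟩ := h
  refine ⟨fun x => LinearMap.range (T x).mulVecLin,
    fun x => (schubert_of_frame (orderIsoOfFin_monotone (K x)) (hW x) (hT x)).1,
    fun x => (schubert_of_frame (orderIsoOfFin_monotone (K x)) (hW x) (hT x)).2, fun a => ?_⟩
  rintro _ ⟨_, ⟨z, rfl⟩, rfl⟩
  refine ⟨(W (tgt a) * (R a * T (src a))) *ᵥ z, ?_⟩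
  simp only [Matrix.mulVecLin_apply, Matrix.mulVec_mulVec]
  rw [← hR a]

theorem exists_orthonormal_frames {R : ∀ a : A, Matrix (Fin (n (tgt a))) (Fin (n (src a))) ℂ}
    (h : ∃ S : ∀ x : V, Submodule ℂ (Fin (n x) → ℂ),
      (∀ x : V, Module.finrank ℂ (S x) = (K x).card) ∧
      (∀ x : V, ∀ j : Fin (K x).card,
        (j : ℕ) + 1 ≤ Module.finrank ℂ
          ((S x ⊓ stdFlag (n x) ((((K x).orderIsoOfFin rfl j : Fin (n x)) : ℕ) + 1) :
            Submodule ℂ (Fin (n x) → ℂ)))) ∧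
      (∀ a : A, (S (src a)).map (R a).mulVecLin ≤ S (tgt a))) :
    ∃ T : ∀ x, Matrix (Fin (n x)) (Fin (K x).card) ℂ, (∀ x, (T x)ᴴ * T x = 1) ∧
      (∀ x i j, ((K x).orderIsoOfFin rfl j : Fin (n x)) < i → T x i j = 0) ∧
      ∀ a, R a * T (src a) = T (tgt a) * ((T (tgt a))ᴴ * (R a * T (src a))) := by
  obtain ⟨S, hdim, hsch, hR⟩ := h
  choose T hT1 hT2 hT3 using fun x =>
    exists_orthonormal_frame (orderIsoOfFin_monotone (K x)) (hdim x) (hsch x)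
  refine ⟨T, hT1, hT2, fun a => ?_⟩
  refine Matrix.ext_of_mulVec_single fun j => ?_
  have hmem : (R a).mulVecLin ((T (src a)).mulVecLin (Pi.single j 1)) ∈
      LinearMap.range (T (tgt a)).mulVecLin := by
    rw [hT3]
    refine hR a ⟨_, ?_, rfl⟩
    rw [← hT3 (src a)]
    exact ⟨_, rfl⟩
  obtain ⟨z, hz⟩ := hmem
  simp only [Matrix.mulVecLin_apply, Matrix.mulVec_mulVec] at hz
  simp only [← Matrix.mulVec_mulVec _ (T (tgt a)), ← Matrix.mulVec_mulVec _ (T (tgt a))ᴴ]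
  rw [← hz, Matrix.mulVec_mulVec z, hT1, Matrix.one_mulVec]

theorem isQIntersecting_of_forall_hasFrame (h : ∀ R, HasFrame src tgt n K R) :
    IsQIntersecting src tgt n K := fun r => by
  have := (h fun a => LinearMap.toMatrix' (r a)).exists_submodule
  simpa only [← Matrix.toLin'_apply', Matrix.toLin'_toMatrix'] using this

theorem HasFrame.map {R : ∀ a : A, Matrix (Fin (n (tgt a))) (Fin (n (src a))) ℂ}
    (h : HasFrame src tgt n K R) (σ : ℂ ≃+* ℂ) :
    HasFrame src tgt n K fun a => (R a).map σ := by
  obtain ⟨T, W, hW, hT, hR⟩ := h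
  refine ⟨fun x => (T x).map σ, fun x => (W x).map σ, fun x => ?_, fun x i j hij => ?_,
    fun a => ?_⟩
  · have := congrArg (fun M => M.map σ) (hW x)
    simpa [Matrix.map_mul] using this
  · simp [hT x i j hij]
  · have := congrArg (fun M => M.map σ) (hR a)
    simpa [Matrix.map_mul] using this

theorem isClosed_hasFrame : IsClosed {R | HasFrame src tgt n K R} := by
  let C : Set (∀ x, Matrix (Fin (n x)) (Fin (K x).card) ℂ) := {T | (∀ x, (T x)ᴴ * T x = 1) ∧
      (∀ x i j, ((K x).orderIsoOfFin rfl j : Fin (n x)) < i → T x i j = 0)}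
  have hent : ∀ x i j, Continuous fun T : ∀ x, Matrix (Fin (n x)) (Fin (K x).card) ℂ => T x i j :=
    fun x i j => (continuous_apply x).matrix_elem i j
  have hC : IsCompact C := by
    refine IsCompact.of_isClosed_subset
      (isCompact_univ_pi fun x => isCompact_univ_pi fun i => isCompact_univ_pi fun j =>
        isCompact_closedBall (0 : ℂ) 1) ?_ ?_
    · simp only [C, Set.ofPred_and, Set.ofPred_forall]
      refine IsClosed.inter (isClosed_iInter fun x => isClosed_eq ?_ continuous_const)
        (isClosed_iInter fun x => isClosed_iInter fun i => isClosed_iInter fun j =>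
          isClosed_iInter fun h => isClosed_eq (hent x i j) continuous_const)
      exact (continuous_apply x).matrix_conjTranspose.matrix_mul (continuous_apply x)
    · rintro T ⟨hT, -⟩ x - i - j -
      have h := congrFun (congrFun (hT x) j) j
      rw [Matrix.mul_apply, Matrix.one_apply_eq] at h
      have h' : ∑ l, ‖T x l j‖ ^ 2 = 1 := by
        have h2 := congrArg Complex.re h
        rw [Complex.re_sum, Complex.one_re] at h2
        rw [← h2]
        refine Finset.sum_congr rfl fun l _ => ?_
        rw [Matrix.conjTranspose_apply, ← starRingEnd_apply, ← Complex.normSq_eq_conj_mul_self,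
          Complex.ofReal_re, Complex.normSq_eq_norm_sq]
      have h3 : ‖T x i j‖ ^ 2 ≤ 1 := h' ▸ Finset.single_le_sum
        (f := fun l => ‖T x l j‖ ^ 2) (fun l _ => sq_nonneg _) (Finset.mem_univ i)
      rw [mem_closedBall_zero_iff]
      exact (sq_le_one_iff₀ (norm_nonneg _)).1 h3
  have : CompactSpace C := isCompact_iff_compactSpace.1 hC
  let D : Set ((∀ a : A, Matrix (Fin (n (tgt a))) (Fin (n (src a))) ℂ) × C) :=
    {z | ∀ a, z.1 a * z.2.1 (src a) =
      z.2.1 (tgt a) * ((z.2.1 (tgt a))ᴴ * (z.1 a * z.2.1 (src a)))}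
  have hT : ∀ x, Continuous fun z :
      (∀ a : A, Matrix (Fin (n (tgt a))) (Fin (n (src a))) ℂ) × C => z.2.1 x := fun x =>
    (continuous_apply x).comp (continuous_subtype_val.comp continuous_snd)
  have hRT : ∀ a, Continuous fun z :
      (∀ a : A, Matrix (Fin (n (tgt a))) (Fin (n (src a))) ℂ) × C => z.1 a * z.2.1 (src a) :=
    fun a => ((continuous_apply a).comp continuous_fst).matrix_mul (hT _)
  have hD : IsClosed D := by
    simp only [D, Set.ofPred_forall]
    exact isClosed_iInter fun a => isClosed_eq (hRT a)
      ((hT _).matrix_mul ((hT _).matrix_conjTranspose.matrix_mul (hRT a)))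
  have himg : {R | HasFrame src tgt n K R} = Prod.fst '' D := by
    ext R
    constructor
    · intro h
      obtain ⟨T, hT1, hT2, hT3⟩ := exists_orthonormal_frames h.exists_submodule
      exact ⟨(R, ⟨T, hT1, hT2⟩), hT3, rfl⟩
    · rintro ⟨⟨R', ⟨T, hT1, hT2⟩⟩, hT3, rfl⟩
      exact ⟨T, fun x => (T x)ᴴ, hT1, hT2, hT3⟩
  rw [himg]
  exact isClosedMap_fst_of_compactSpace _ hD

/-- Since generic representations are conjugate under `Aut(ℂ)`, it suffices to find
subrepresentations near a single representation. -/
theorem hasFrame_of_eventually [Finite A]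
    {R₀ : ∀ a : A, Matrix (Fin (n (tgt a))) (Fin (n (src a))) ℂ}
    (h : ∀ᶠ R in nhds R₀, HasFrame src tgt n K R)
    (R : ∀ a : A, Matrix (Fin (n (tgt a))) (Fin (n (src a))) ℂ) : HasFrame src tgt n K R := by
  have := Fintype.ofFinite A
  let I := Σ a : A, Fin (n (tgt a)) × Fin (n (src a))
  let φ : (I → ℂ) → ∀ a : A, Matrix (Fin (n (tgt a))) (Fin (n (src a))) ℂ :=
    fun z a => Matrix.of fun i j => z ⟨a, i, j⟩
  let ψ : (∀ a : A, Matrix (Fin (n (tgt a))) (Fin (n (src a))) ℂ) → I → ℂ :=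
    fun R m => R m.1 m.2.1 m.2.2
  have hφ : Continuous φ := continuous_pi fun a => continuous_matrix fun i j =>
    continuous_apply _
  have hφψ : ∀ R, φ (ψ R) = R := fun R => rfl
  have hdense := dense_algebraicIndependent I
  obtain ⟨U, hUsub, hUopen, hU₀⟩ := mem_nhds_iff.1 h
  obtain ⟨z₀, hz₀U, hz₀⟩ := hdense.inter_open_nonempty (φ ⁻¹' U) (hUopen.preimage hφ) ⟨ψ R₀, hU₀⟩
  have hgen : ∀ z, AlgebraicIndependent ℚ z → HasFrame src tgt n K (φ z) := fun z hz => by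
    obtain ⟨σ, hσ⟩ := exists_complex_ringEquiv_of_algebraicIndependent hz₀ hz
    have h1 : HasFrame src tgt n K (φ z₀) := hUsub hz₀U
    convert h1.map σ using 1
    ext a i j
    exact (hσ _).symm
  have hclosed : IsClosed {z | HasFrame src tgt n K (φ z)} := isClosed_hasFrame.preimage hφ
  have huniv : {z | HasFrame src tgt n K (φ z)} = Set.univ := by
    rw [← hclosed.closure_eq]
    exact (hdense.mono hgen).closure_eq
  exact (Set.eq_univ_iff_forall.1 huniv (ψ R) :)

end Intersecting

section Variation

open Topology ComplexOrder

variable {ι A V : Type} [Fintype ι] [DecidableEq ι] [Fintype A]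

/-- Squared Frobenius norm. -/
noncomputable def frob (X : Matrix ι ι ℂ) : ℝ := ∑ i, ∑ j, ‖X i j‖ ^ 2

omit [DecidableEq ι] in
theorem frob_nonneg (X : Matrix ι ι ℂ) : 0 ≤ frob X := by
  unfold frob; positivity

omit [DecidableEq ι] in
theorem trace_mul_conjTranspose_self (X : Matrix ι ι ℂ) : (X * Xᴴ).trace = (frob X : ℂ) := by
  simp only [Matrix.trace, Matrix.diag, Matrix.mul_apply, frob, Matrix.conjTranspose_apply]
  push_cast
  refine Finset.sum_congr rfl fun i _ => Finset.sum_congr rfl fun j _ => ?_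
  exact Complex.mul_conj' (X i j)

omit [DecidableEq ι] in
theorem trace_conjTranspose_mul_self (X : Matrix ι ι ℂ) : (Xᴴ * X).trace = (frob X : ℂ) := by
  rw [Matrix.trace_mul_comm, trace_mul_conjTranspose_self]

omit [DecidableEq ι] in
theorem eq_zero_of_frob_eq_zero {X : Matrix ι ι ℂ} (h : frob X = 0) : X = 0 := by
  rw [← Matrix.trace_mul_conjTranspose_self_eq_zero_iff, trace_mul_conjTranspose_self, h]
  simp

omit [DecidableEq ι] in
theorem continuous_frob : Continuous (frob : Matrix ι ι ℂ → ℝ) := by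
  unfold frob
  fun_prop

omit [DecidableEq ι] in
theorem frob_add_smul (M Y : Matrix ι ι ℂ) (c : ℝ) :
    frob (M + (c : ℂ) • Y) = frob M + 2 * c * (Mᴴ * Y).trace.re + c ^ 2 * frob Y := by
  have h : ∀ X : Matrix ι ι ℂ, frob X = (Xᴴ * X).trace.re := fun X => by
    rw [trace_conjTranspose_mul_self, Complex.ofReal_re]
  have h2 : (Yᴴ * M).trace.re = (Mᴴ * Y).trace.re := by
    have : (Yᴴ * M) = (Mᴴ * Y)ᴴ := by simp
    rw [this, Matrix.trace_conjTranspose]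
    simp
  rw [h, h M, h Y]
  simp only [Matrix.conjTranspose_add, Matrix.conjTranspose_smul, Matrix.add_mul, Matrix.mul_add,
    Matrix.smul_mul, Matrix.mul_smul, Matrix.trace_add, Matrix.trace_smul, Complex.add_re,
    smul_eq_mul, RCLike.star_def, Complex.conj_ofReal, Complex.re_ofReal_mul, h2]
  ring

omit [DecidableEq ι] in
/-- One-sided variation of the Frobenius norm. -/
theorem trace_re_nonneg_of_frob_le {M Y₀ : Matrix ι ι ℂ} {Y : ℝ → Matrix ι ι ℂ} {k : ℕ}
    (hk : k ≠ 0) (hY : Filter.Tendsto Y (𝓝[>] 0) (𝓝 Y₀))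
    (h : ∀ᶠ τ : ℝ in 𝓝[>] 0, frob M ≤ frob (M + ((τ ^ k : ℝ) : ℂ) • Y τ)) :
    0 ≤ (Mᴴ * Y₀).trace.re := by
  have htr : Continuous fun Z : Matrix ι ι ℂ => (Mᴴ * Z).trace.re :=
    Complex.continuous_re.comp (continuous_const.matrix_mul continuous_id).matrix_trace
  have hτ : Filter.Tendsto (fun τ : ℝ => τ ^ k) (𝓝[>] 0) (𝓝 0) := by
    have : Filter.Tendsto (fun τ : ℝ => τ ^ k) (𝓝 0) (𝓝 (0 ^ k)) := (continuous_pow k).tendsto 0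
    rw [zero_pow hk] at this
    exact this.mono_left nhdsWithin_le_nhds
  have hlim : Filter.Tendsto (fun τ => 2 * (Mᴴ * Y τ).trace.re + τ ^ k * frob (Y τ)) (𝓝[>] 0)
      (𝓝 (2 * (Mᴴ * Y₀).trace.re + 0 * frob Y₀)) :=
    (((htr.tendsto Y₀).comp hY).const_mul 2).add
      (hτ.mul ((continuous_frob.tendsto Y₀).comp hY))
  have hge := ge_of_tendsto hlim (b := 0) (by
    filter_upwards [h, self_mem_nhdsWithin] with τ h1 h2
    have hpos : 0 < τ ^ k := pow_pos h2 k
    rw [frob_add_smul] at h1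
    refine nonneg_of_mul_nonneg_right (a := τ ^ k) ?_ hpos
    nlinarith)
  linarith

/-- Support condition: `R a` maps the block of `s a` to the block of `t a`. -/
def IsRep (v : ι → V) (s t : A → V) (R : A → Matrix ι ι ℂ) : Prop :=
  ∀ a i j, R a i j ≠ 0 → v i = t a ∧ v j = s a

/-- The total moment map. -/
noncomputable def moment (R : A → Matrix ι ι ℂ) : Matrix ι ι ℂ := ∑ a, (R a * (R a)ᴴ - (R a)ᴴ * R a)

/-- The derivative of the moment map. -/
noncomputable def dmoment (R w : A → Matrix ι ι ℂ) : Matrix ι ι ℂ :=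
  ∑ a, (w a * (R a)ᴴ + R a * (w a)ᴴ - (R a)ᴴ * w a - (w a)ᴴ * R a)

omit [DecidableEq ι] in
theorem moment_add_smul (R w : A → Matrix ι ι ℂ) (c : ℝ) :
    moment (fun a => R a + (c : ℂ) • w a) =
      moment R + (c : ℂ) • (dmoment R w + (c : ℂ) • moment w) := by
  simp only [moment, dmoment, Finset.smul_sum, ← Finset.sum_add_distrib]
  refine Finset.sum_congr rfl fun a _ => ?_
  simp only [Matrix.conjTranspose_add, Matrix.conjTranspose_smul, RCLike.star_def,
    Complex.conj_ofReal, Matrix.mul_add, Matrix.add_mul, Matrix.smul_mul, Matrix.mul_smul,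
    smul_sub, smul_add]
  abel

omit [DecidableEq ι] [Fintype ι] [Fintype A] in
theorem IsRep.add_smul {v : ι → V} {s t : A → V} {R w : A → Matrix ι ι ℂ} (hR : IsRep v s t R)
    (hw : IsRep v s t w) (c : ℂ) : IsRep v s t fun a => R a + c • w a := by
  intro a i j h
  by_cases h1 : R a i j = 0
  · refine hw a i j fun h2 => h ?_
    simp [h1, h2]
  · exact hR a i j h1

omit [DecidableEq ι] in
theorem moment_isHermitian (R : A → Matrix ι ι ℂ) : (moment R)ᴴ = moment R := by
  simp [moment, Matrix.conjTranspose_sum]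

/-- Distance of the moment map to a diagonal target. -/
noncomputable def momentResidual (α : ι → ℝ) (R : A → Matrix ι ι ℂ) : Matrix ι ι ℂ :=
  moment R + Matrix.diagonal fun i => (α i : ℂ)

theorem momentResidual_isHermitian (α : ι → ℝ) (R : A → Matrix ι ι ℂ) :
    (momentResidual α R)ᴴ = momentResidual α R := by
  rw [momentResidual, Matrix.conjTranspose_add, moment_isHermitian, Matrix.diagonal_conjTranspose]
  congr 2
  ext i
  simp

/-- First-order condition at a minimizer. -/
theorem momentResidual_commute {v : ι → V} {s t : A → V} {R : A → Matrix ι ι ℂ} {α : ι → ℝ}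
    (hR : IsRep v s t R)
    (hblock : ∀ i j, momentResidual α R i j ≠ 0 → v i = v j)
    (hmin : ∀ R', IsRep v s t R' → frob (momentResidual α R) ≤ frob (momentResidual α R')) (a : A) :
    momentResidual α R * R a = R a * momentResidual α R := by
  set M := momentResidual α R with hM
  have hMH : Mᴴ = M := momentResidual_isHermitian α R
  let w : A → Matrix ι ι ℂ := fun a => R a * M - M * R a
  have hw : IsRep v s t w := by
    intro a i j h
    by_contra hcon
    apply h
    have h1 : (R a * M) i j = 0 := by
      rw [Matrix.mul_apply]
      refine Finset.sum_eq_zero fun k _ => ?_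
      by_contra hne
      obtain ⟨e1, e2⟩ := hR a i k (left_ne_zero_of_mul hne)
      exact hcon ⟨e1, (hblock k j (right_ne_zero_of_mul hne)).symm.trans e2⟩
    have h2 : (M * R a) i j = 0 := by
      rw [Matrix.mul_apply]
      refine Finset.sum_eq_zero fun k _ => ?_
      by_contra hne
      obtain ⟨e1, e2⟩ := hR a k j (right_ne_zero_of_mul hne)
      exact hcon ⟨(hblock i k (left_ne_zero_of_mul hne)).trans e1, e2⟩
    simp [w, h1, h2]
  have h := trace_re_nonneg_of_frob_le (M := M) (Y₀ := dmoment R w) (k := 1) one_ne_zero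
    (Y := fun τ => dmoment R w + (τ : ℂ) • moment w) (by
      have : Continuous fun τ : ℝ => dmoment R w + (τ : ℂ) • moment w := by fun_prop
      have h0 := this.tendsto 0
      simp only [Complex.ofReal_zero, zero_smul, add_zero] at h0
      exact h0.mono_left nhdsWithin_le_nhds) (by
      refine Filter.Eventually.of_forall fun τ => ?_
      refine (hmin _ (hR.add_smul hw (τ : ℂ))).trans_eq ?_
      rw [hM, momentResidual, momentResidual, moment_add_smul, pow_one]
      congr 1
      abel)
  have htr : (Mᴴ * dmoment R w).trace = -2 * ∑ a, (frob (w a) : ℂ) := by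
    rw [hMH, dmoment, Finset.mul_sum, Matrix.trace_sum, Finset.mul_sum]
    refine Finset.sum_congr rfl fun a _ => ?_
    rw [← trace_mul_conjTranspose_self]
    have hwH : (w a)ᴴ = M * (R a)ᴴ - (R a)ᴴ * M := by simp [w, hMH]
    have e1 : (M * (w a * (R a)ᴴ)).trace = (w a * ((R a)ᴴ * M)).trace := by
      rw [Matrix.trace_mul_comm, Matrix.mul_assoc]
    have e2 : (M * ((R a)ᴴ * w a)).trace = (w a * (M * (R a)ᴴ)).trace := by
      rw [← Matrix.mul_assoc, Matrix.trace_mul_comm]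
    have e3 : (M * ((w a)ᴴ * R a)).trace = (R a * M * (w a)ᴴ).trace := by
      rw [← Matrix.mul_assoc, Matrix.trace_mul_comm, Matrix.mul_assoc]
    have e4 : (w a * (w a)ᴴ).trace =
        (w a * (M * (R a)ᴴ)).trace - (w a * ((R a)ᴴ * M)).trace := by
      rw [hwH, Matrix.mul_sub, Matrix.trace_sub]
    have e5 : (w a * (w a)ᴴ).trace = (R a * M * (w a)ᴴ).trace - (M * (R a * (w a)ᴴ)).trace := by
      rw [← Matrix.mul_assoc M, ← Matrix.trace_sub, ← Matrix.sub_mul]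
    simp only [Matrix.mul_sub, Matrix.mul_add, Matrix.trace_sub, Matrix.trace_add, e1, e2, e3]
    linear_combination e4 + e5
  rw [htr] at h
  have hsum : ∑ a, frob (w a) = 0 := by
    refine le_antisymm ?_ (Finset.sum_nonneg fun a _ => frob_nonneg _)
    have : ((-2 : ℂ) * ∑ a, (frob (w a) : ℂ)).re = -2 * ∑ a, frob (w a) := by
      rw [← Complex.ofReal_sum]
      simp
    linarith
  have hw0 := eq_zero_of_frob_eq_zero
    ((Finset.sum_eq_zero_iff_of_nonneg fun a _ => frob_nonneg _).1 hsum a (Finset.mem_univ a))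
  exact (sub_eq_zero.1 hw0).symm

end Variation

section SecondOrder

open Topology

variable {ι A V : Type} [Fintype ι] [DecidableEq ι] [Fintype A]

theorem block_of_commute {v : ι → V} {B N : Matrix ι ι ℂ} (hB : ∀ i j, B i j ≠ 0 → v i = v j)
    (hBN : B * N = 1) (hNB : N * B = 1) {i j : ι} (h : N i j ≠ 0) : v i = v j := by
  classical
  let D : Matrix ι ι ℂ := Matrix.diagonal fun i => if v i = v j then 1 else 0
  have hcomm : B * D = D * B := by
    ext k l
    rw [Matrix.mul_diagonal, Matrix.diagonal_mul]
    by_cases h0 : B k l = 0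
    · simp [h0]
    · rw [hB k l h0, mul_comm]
  have hND : N * D = D * N := by
    calc N * D = N * D * (B * N) := by rw [hBN, Matrix.mul_one]
      _ = N * (D * B) * N := by simp only [Matrix.mul_assoc]
      _ = N * B * D * N := by rw [← hcomm]; simp only [Matrix.mul_assoc]
      _ = D * N := by rw [hNB, Matrix.one_mul]
  have hij := congrFun (congrFun hND i) j
  rw [Matrix.mul_diagonal, Matrix.diagonal_mul] at hij
  by_contra hne
  simp [hne] at hij
  exact h hij

omit [DecidableEq ι] in
theorem block_mul {v : ι → V} {B C : Matrix ι ι ℂ} (hB : ∀ i j, B i j ≠ 0 → v i = v j)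
    (hC : ∀ i j, C i j ≠ 0 → v i = v j) {i j : ι} (h : (B * C) i j ≠ 0) : v i = v j := by
  rw [Matrix.mul_apply] at h
  obtain ⟨k, -, hk⟩ := Finset.exists_ne_zero_of_sum_ne_zero h
  exact (hB i k (left_ne_zero_of_mul hk)).trans (hC k j (right_ne_zero_of_mul hk))

omit [Fintype ι] in
theorem block_one_add_smul {v : ι → V} {c : Matrix ι ι ℂ} (hc : ∀ i j, c i j ≠ 0 → v i = v j)
    (z : ℂ) {i j : ι} (h : (1 + z • c) i j ≠ 0) : v i = v j := by
  by_cases hij : i = j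
  · rw [hij]
  · refine hc i j fun h0 => h ?_
    simp [Matrix.one_apply_ne hij, h0]

theorem tendsto_inv_one_add_smul (c : Matrix ι ι ℂ) :
    Filter.Tendsto (fun τ : ℝ => (1 + (τ : ℂ) • c)⁻¹) (𝓝 0) (𝓝 1) := by
  have hcont : Continuous fun τ : ℝ => 1 + (τ : ℂ) • c := by fun_prop
  have hdet : Filter.Tendsto (fun τ : ℝ => ((1 + (τ : ℂ) • c).det)⁻¹) (𝓝 0) (𝓝 1) := by
    have h := hcont.matrix_det.tendsto 0
    simp only [Complex.ofReal_zero, zero_smul, add_zero, Matrix.det_one] at h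
    simpa using h.inv₀ one_ne_zero
  have hadj := hcont.matrix_adjugate.tendsto 0
  simp only [Complex.ofReal_zero, zero_smul, add_zero, Matrix.adjugate_one] at hadj
  have h := hdet.smul hadj
  simp only [one_smul] at h
  simpa only [Matrix.inv_def, Ring.inverse_eq_inv'] using h

theorem eventually_isUnit_det_one_add_smul (c : Matrix ι ι ℂ) :
    ∀ᶠ τ : ℝ in 𝓝 0, IsUnit (1 + (τ : ℂ) • c).det := by
  have hcont : Continuous fun τ : ℝ => (1 + (τ : ℂ) • c).det := by fun_prop
  have h := hcont.tendsto 0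
  simp only [Complex.ofReal_zero, zero_smul, add_zero, Matrix.det_one] at h
  filter_upwards [h.eventually_ne one_ne_zero] with τ hτ
  exact isUnit_iff_ne_zero.2 hτ

/-- Conjugation by the Cayley transform of a small skew-Hermitian matrix, to second order. -/
theorem exists_unitary_conj_expansion {v : ι → V} {c : Matrix ι ι ℂ}
    (hc : ∀ i j, c i j ≠ 0 → v i = v j) (hskew : cᴴ = -c) (D : Matrix ι ι ℂ) :
    ∃ Z : ℝ → Matrix ι ι ℂ,
      Filter.Tendsto Z (𝓝 0)
        (𝓝 (c * ((2 : ℂ) • (c * D - D * c)) - (2 : ℂ) • (c * D - D * c) * c)) ∧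
      ∀ᶠ τ : ℝ in 𝓝 0, ∃ U : Matrix ι ι ℂ, U * Uᴴ = 1 ∧ Uᴴ * U = 1 ∧
        (∀ i j, U i j ≠ 0 → v i = v j) ∧
        U * D * Uᴴ = D + (τ : ℂ) • ((2 : ℂ) • (c * D - D * c) + (τ : ℂ) • Z τ) := by
  set X := (2 : ℂ) • (c * D - D * c) with hX
  have hneg : ∀ τ : ℝ, 1 + (τ : ℂ) • -c = 1 - (τ : ℂ) • c := fun τ => by
    rw [smul_neg, sub_eq_add_neg]
  refine ⟨fun τ => (1 + (τ : ℂ) • -c)⁻¹ * (c * X - X * c + (τ : ℂ) • (c * X * c)) *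
    (1 + (τ : ℂ) • c)⁻¹, ?_, ?_⟩
  · have h : Filter.Tendsto (fun τ : ℝ => c * X - X * c + (τ : ℂ) • (c * X * c)) (𝓝 0)
        (𝓝 (c * X - X * c)) := by
      have hcont : Continuous fun τ : ℝ => c * X - X * c + (τ : ℂ) • (c * X * c) := by fun_prop
      simpa using hcont.tendsto 0
    simpa using ((tendsto_inv_one_add_smul (-c)).mul h).mul (tendsto_inv_one_add_smul c)
  · filter_upwards [eventually_isUnit_det_one_add_smul c, eventually_isUnit_det_one_add_smul (-c)]
      with τ h1 h2
    set B := 1 + (τ : ℂ) • c with hB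
    set B' := 1 + (τ : ℂ) • -c with hB'
    have hBH : Bᴴ = B' := by
      simp [hB, hB', hskew]
    have hBH' : B'ᴴ = B := by
      rw [← hBH, Matrix.conjTranspose_conjTranspose]
    have hcomm : B * B' = B' * B := by
      rw [hB, hB', hneg]
      simp only [Matrix.mul_sub, Matrix.add_mul, Matrix.sub_mul, Matrix.mul_add, Matrix.one_mul,
        Matrix.mul_one]
      abel
    have e1 : B * B⁻¹ = 1 := Matrix.mul_nonsing_inv _ h1
    have e2 : B⁻¹ * B = 1 := Matrix.nonsing_inv_mul _ h1
    have e3 : B' * B'⁻¹ = 1 := Matrix.mul_nonsing_inv _ h2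
    have e4 : B'⁻¹ * B' = 1 := Matrix.nonsing_inv_mul _ h2
    have hUH : (B'⁻¹ * B)ᴴ = B' * B⁻¹ := by
      rw [Matrix.conjTranspose_mul, Matrix.conjTranspose_nonsing_inv, hBH, hBH']
    refine ⟨B'⁻¹ * B, ?_, ?_, ?_, ?_⟩
    · rw [hUH]
      calc B'⁻¹ * B * (B' * B⁻¹) = B'⁻¹ * (B * B') * B⁻¹ := by simp only [Matrix.mul_assoc]
        _ = (B'⁻¹ * B') * (B * B⁻¹) := by rw [hcomm]; simp only [Matrix.mul_assoc]
        _ = 1 := by rw [e1, e4, Matrix.one_mul]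
    · rw [hUH]
      calc B' * B⁻¹ * (B'⁻¹ * B) = B' * (B⁻¹ * B'⁻¹) * B := by simp only [Matrix.mul_assoc]
        _ = B' * (B'⁻¹ * B⁻¹) * B := by
          rw [← Matrix.mul_inv_rev, ← Matrix.mul_inv_rev, hcomm]
        _ = (B' * B'⁻¹) * (B⁻¹ * B) := by simp only [Matrix.mul_assoc]
        _ = 1 := by rw [e2, e3, Matrix.one_mul]
    · intro i j h
      refine block_mul (v := v) (B := B'⁻¹) (C := B) (fun i j h => ?_)
        (fun i j h => block_one_add_smul hc _ h) h
      refine block_of_commute (B := B') (fun i j h => block_one_add_smul (c := -c) ?_ _ h) e3 e4 h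
      intro i j h
      exact hc i j fun h0 => h (by simp [h0])
    · have key : B * D * B' = B' * (D + (τ : ℂ) • X) * B +
          (τ : ℂ) • (τ : ℂ) • (c * X - X * c + (τ : ℂ) • (c * X * c)) := by
        rw [hB, hB', hneg, hX]
        simp only [Matrix.mul_sub, Matrix.add_mul, Matrix.sub_mul, Matrix.mul_add, Matrix.one_mul,
          Matrix.mul_one, Matrix.mul_smul, Matrix.smul_mul, smul_add, smul_sub, Matrix.mul_assoc]
        module
      rw [hUH]
      calc B'⁻¹ * B * D * (B' * B⁻¹) = B'⁻¹ * (B * D * B') * B⁻¹ := by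
            simp only [Matrix.mul_assoc]
        _ = (B'⁻¹ * B') * (D + (τ : ℂ) • X) * (B * B⁻¹) + (τ : ℂ) • (τ : ℂ) •
            (B'⁻¹ * (c * X - X * c + (τ : ℂ) • (c * X * c)) * B⁻¹) := by
          rw [key]
          simp only [Matrix.mul_add, Matrix.add_mul, Matrix.mul_smul, Matrix.smul_mul,
            Matrix.mul_assoc, smul_add]
        _ = _ := by
          rw [e1, e4, Matrix.one_mul, Matrix.mul_one, smul_add, add_assoc]

theorem frob_unitary_conj {U : Matrix ι ι ℂ} (hU : Uᴴ * U = 1)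
    (X : Matrix ι ι ℂ) : frob (U * X * Uᴴ) = frob X := by
  have h : ((frob (U * X * Uᴴ) : ℝ) : ℂ) = frob X := by
    rw [← trace_mul_conjTranspose_self, ← trace_mul_conjTranspose_self]
    have : U * X * Uᴴ * (U * X * Uᴴ)ᴴ = U * (X * Xᴴ * Uᴴ) := by
      simp only [Matrix.conjTranspose_mul, Matrix.conjTranspose_conjTranspose]
      calc U * X * Uᴴ * (U * (Xᴴ * Uᴴ)) = U * X * (Uᴴ * U) * (Xᴴ * Uᴴ) := by
            simp only [Matrix.mul_assoc]
        _ = _ := by rw [hU, Matrix.mul_one]; simp only [Matrix.mul_assoc]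
    rw [this, Matrix.trace_mul_comm, Matrix.mul_assoc, hU, Matrix.mul_one]
  exact_mod_cast h

theorem frob_le_unitary_conj {v : ι → V} {s t : A → V} {α : ι → ℝ} {m : ℝ}
    (hmin : ∀ R, IsRep v s t R → m ≤ frob (momentResidual α R)) {U : Matrix ι ι ℂ}
    (hU₁ : U * Uᴴ = 1) (hU₂ : Uᴴ * U = 1) (hU : ∀ i j, U i j ≠ 0 → v i = v j)
    {R : A → Matrix ι ι ℂ} (hR : IsRep v s t R) :
    m ≤ frob (moment R + U * Matrix.diagonal (fun i => (α i : ℂ)) * Uᴴ) := by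
  have hrep : IsRep v s t fun a => Uᴴ * R a * U := by
    intro a i j h
    change (Uᴴ * R a * U) i j ≠ 0 at h
    rw [Matrix.mul_apply] at h
    obtain ⟨k, -, hk⟩ := Finset.exists_ne_zero_of_sum_ne_zero h
    have hk1 := left_ne_zero_of_mul hk
    rw [Matrix.mul_apply] at hk1
    obtain ⟨l, -, hl⟩ := Finset.exists_ne_zero_of_sum_ne_zero hk1
    have hl1 : U l i ≠ 0 := fun h0 => left_ne_zero_of_mul hl (by simp [h0])
    obtain ⟨e1, e2⟩ := hR a l k (right_ne_zero_of_mul hl)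
    exact ⟨(hU l i hl1).symm.trans e1, (hU k j (right_ne_zero_of_mul hk)).symm.trans e2⟩
  refine (hmin _ hrep).trans_eq ?_
  rw [← frob_unitary_conj hU₂, momentResidual, Matrix.mul_add, Matrix.add_mul]
  congr 2
  simp only [moment, Finset.mul_sum, Finset.sum_mul]
  refine Finset.sum_congr rfl fun a _ => ?_
  simp only [Matrix.conjTranspose_mul, Matrix.conjTranspose_conjTranspose, Matrix.mul_sub,
    Matrix.sub_mul]
  have c1 : ∀ B C : Matrix ι ι ℂ, U * (Uᴴ * B * U * (Uᴴ * (C * U))) * Uᴴ = B * C := fun B C => by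
    calc U * (Uᴴ * B * U * (Uᴴ * (C * U))) * Uᴴ = (U * Uᴴ) * B * (U * Uᴴ) * C * (U * Uᴴ) := by
          simp only [Matrix.mul_assoc]
      _ = _ := by simp [hU₁]
  have c2 : ∀ B C : Matrix ι ι ℂ, U * (Uᴴ * (B * U) * (Uᴴ * C * U)) * Uᴴ = B * C := fun B C => by
    calc U * (Uᴴ * (B * U) * (Uᴴ * C * U)) * Uᴴ = (U * Uᴴ) * B * (U * Uᴴ) * C * (U * Uᴴ) := by
          simp only [Matrix.mul_assoc]
      _ = _ := by simp [hU₁]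
  rw [c1, c2]

theorem trace_diagonal_mul_mul (m : ι → ℂ) (B C : Matrix ι ι ℂ) :
    (Matrix.diagonal m * (B * C)).trace = ∑ i, ∑ j, m i * (B i j * C j i) := by
  rw [Matrix.trace]
  refine Finset.sum_congr rfl fun i _ => ?_
  rw [Matrix.diag_apply, Matrix.diagonal_mul, Matrix.mul_apply, Finset.mul_sum]

theorem trace_diagonal_mul_moment (m : ι → ℝ) (w : A → Matrix ι ι ℂ) :
    ((Matrix.diagonal fun i => (m i : ℂ)) * moment w).trace.re =
      ∑ a, ∑ i, ∑ j, (m i - m j) * ‖w a i j‖ ^ 2 := by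
  rw [moment, Finset.mul_sum, Matrix.trace_sum, Complex.re_sum]
  refine Finset.sum_congr rfl fun a _ => ?_
  have h1 : ((Matrix.diagonal fun i => (m i : ℂ)) * (w a * (w a)ᴴ)).trace =
      ((∑ i, ∑ j, m i * ‖w a i j‖ ^ 2 : ℝ) : ℂ) := by
    rw [trace_diagonal_mul_mul]
    push_cast
    refine Finset.sum_congr rfl fun i _ => Finset.sum_congr rfl fun j _ => ?_
    rw [← Complex.mul_conj']
    rfl
  have h2 : ((Matrix.diagonal fun i => (m i : ℂ)) * ((w a)ᴴ * w a)).trace =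
      ((∑ i, ∑ j, m j * ‖w a i j‖ ^ 2 : ℝ) : ℂ) := by
    rw [trace_diagonal_mul_mul]
    rw [Finset.sum_comm]
    push_cast
    refine Finset.sum_congr rfl fun i _ => Finset.sum_congr rfl fun j _ => ?_
    rw [← Complex.conj_mul']
    rfl
  rw [Matrix.mul_sub, Matrix.trace_sub, h1, h2, ← Complex.ofReal_sub, Complex.ofReal_re]
  simp only [← Finset.sum_sub_distrib, sub_mul]

theorem trace_diagonal_mul_commutator (m α : ι → ℝ) {c : Matrix ι ι ℂ} (hskew : cᴴ = -c)
    {D : Matrix ι ι ℂ} (hD : D = Matrix.diagonal fun i => (α i : ℂ)) :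
    ((Matrix.diagonal fun i => (m i : ℂ)) *
      (c * ((2 : ℂ) • (c * D - D * c)) - (2 : ℂ) • (c * D - D * c) * c)).trace.re =
      -2 * ∑ i, ∑ j, (m i - m j) * (α i - α j) * ‖c i j‖ ^ 2 := by
  have hX : ∀ i j, ((2 : ℂ) • (c * D - D * c)) j i = -2 * (α i - α j) * star (c i j) := by
    intro i j
    have hc : c j i = -star (c i j) := by
      have := congrFun (congrFun hskew j) i
      rw [Matrix.conjTranspose_apply, Matrix.neg_apply] at this
      rw [this, neg_neg]
    rw [Matrix.smul_apply, Matrix.sub_apply, hD, Matrix.mul_diagonal, Matrix.diagonal_mul, hc,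
      smul_eq_mul]
    ring
  have h1 : ((Matrix.diagonal fun i => (m i : ℂ)) * (c * ((2 : ℂ) • (c * D - D * c)))).trace =
      ((-2 * ∑ i, ∑ j, m i * (α i - α j) * ‖c i j‖ ^ 2 : ℝ) : ℂ) := by
    simp only [trace_diagonal_mul_mul, hX, Finset.mul_sum]
    push_cast
    refine Finset.sum_congr rfl fun i _ => Finset.sum_congr rfl fun j _ => ?_
    rw [← Complex.mul_conj', Complex.star_def]
    ring
  have h2 : ((Matrix.diagonal fun i => (m i : ℂ)) * ((2 : ℂ) • (c * D - D * c) * c)).trace =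
      ((-2 * ∑ i, ∑ j, m j * (α i - α j) * ‖c i j‖ ^ 2 : ℝ) : ℂ) := by
    simp only [trace_diagonal_mul_mul, hX, Finset.mul_sum]
    rw [Finset.sum_comm]
    push_cast
    refine Finset.sum_congr rfl fun i _ => Finset.sum_congr rfl fun j _ => ?_
    rw [← Complex.mul_conj', Complex.star_def]
    ring
  rw [Matrix.mul_sub, Matrix.trace_sub, h1, h2, ← Complex.ofReal_sub, Complex.ofReal_re,
    ← mul_sub]
  simp only [← Finset.sum_sub_distrib, sub_mul]

/-- Second-order condition at a minimizer. -/
theorem eq_zero_of_isMin {v : ι → V} {s t : A → V} {R w : A → Matrix ι ι ℂ} {α m : ι → ℝ}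
    (hR : IsRep v s t R) (hM : momentResidual α R = Matrix.diagonal fun i => (m i : ℂ))
    (hmin : ∀ R', IsRep v s t R' → frob (momentResidual α R) ≤ frob (momentResidual α R'))
    (hα : ∀ i j, v i = v j → α i = α j → i = j)
    (hRm : ∀ a i j, R a i j ≠ 0 → m i = m j) (hw : IsRep v s t w)
    (hwm : ∀ a i j, w a i j ≠ 0 → m i < m j)
    (hQ : ∀ i j, v i = v j → α j < α i → (∑ a, (w a * (R a)ᴴ - (R a)ᴴ * w a)) i j = 0)
    (a : A) : w a = 0 := by
  set Q := ∑ a, (w a * (R a)ᴴ - (R a)ᴴ * w a) with hQdef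
  have hQne : ∀ i j, Q i j ≠ 0 → v i = v j ∧ m i < m j ∧ α i < α j := by
    intro i j hij
    have h1 : v i = v j ∧ m i < m j := by
      rw [hQdef, Matrix.sum_apply] at hij
      obtain ⟨b, -, hb⟩ := Finset.exists_ne_zero_of_sum_ne_zero hij
      rw [Matrix.sub_apply] at hb
      by_cases hb1 : (w b * (R b)ᴴ) i j = 0
      · rw [hb1, zero_sub, neg_ne_zero, Matrix.mul_apply] at hb
        obtain ⟨k, -, hk⟩ := Finset.exists_ne_zero_of_sum_ne_zero hb
        have hk1 : R b k i ≠ 0 := fun h0 => left_ne_zero_of_mul hk (by simp [h0])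
        have hk2 := right_ne_zero_of_mul hk
        exact ⟨(hR b k i hk1).2.trans (hw b k j hk2).2.symm,
          (hRm b k i hk1).symm.trans_lt (hwm b k j hk2)⟩
      · rw [Matrix.mul_apply] at hb1
        obtain ⟨k, -, hk⟩ := Finset.exists_ne_zero_of_sum_ne_zero hb1
        have hk1 : R b j k ≠ 0 := fun h0 => right_ne_zero_of_mul hk (by simp [h0])
        have hk2 := left_ne_zero_of_mul hk
        exact ⟨(hw b i k hk2).1.trans (hR b j k hk1).1.symm,
          (hwm b i k hk2).trans_eq (hRm b j k hk1).symm⟩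
    refine ⟨h1.1, h1.2, lt_of_le_of_ne (not_lt.1 fun hlt => hij (hQ i j h1.1 hlt)) fun he => ?_⟩
    rw [hα i j h1.1 he] at h1
    exact lt_irrefl _ h1.2
  have hDv : dmoment R w = Q + Qᴴ := by
    simp only [dmoment, hQdef, Matrix.conjTranspose_sum, ← Finset.sum_add_distrib]
    refine Finset.sum_congr rfl fun b _ => ?_
    simp only [Matrix.conjTranspose_sub, Matrix.conjTranspose_mul,
      Matrix.conjTranspose_conjTranspose]
    abel
  have hDne : ∀ i j, dmoment R w i j ≠ 0 → v i = v j ∧ 0 < (m i - m j) * (α i - α j) := by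
    intro i j hij
    rw [hDv, Matrix.add_apply, Matrix.conjTranspose_apply] at hij
    by_cases h1 : Q i j = 0
    · have h2 : Q j i ≠ 0 := fun h0 => hij (by simp [h1, h0])
      obtain ⟨e1, e2, e3⟩ := hQne j i h2
      exact ⟨e1.symm, mul_pos (sub_pos.2 e2) (sub_pos.2 e3)⟩
    · obtain ⟨e1, e2, e3⟩ := hQne i j h1
      exact ⟨e1, mul_pos_of_neg_of_neg (sub_neg.2 e2) (sub_neg.2 e3)⟩
  set D : Matrix ι ι ℂ := Matrix.diagonal fun i => (α i : ℂ) with hD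
  let c : Matrix ι ι ℂ := fun i j => dmoment R w i j / (2 * (α i - α j))
  have hcapply : ∀ i j, c i j = dmoment R w i j / (2 * (α i - α j)) := fun _ _ => rfl
  have hcne : ∀ i j, c i j ≠ 0 → v i = v j ∧ 0 < (m i - m j) * (α i - α j) := by
    intro i j hij
    exact hDne i j fun h0 => hij (by rw [hcapply, h0, zero_div])
  have hDvH : ∀ i j, star (dmoment R w i j) = dmoment R w j i := by
    intro i j
    rw [hDv]
    simp [add_comm]
  have hskew : cᴴ = -c := by
    ext i j
    rw [Matrix.conjTranspose_apply, Matrix.neg_apply, hcapply, hcapply, ← hDvH j i]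
    simp only [star_div₀, star_mul', Complex.star_def, map_sub, Complex.conj_ofReal, map_ofNat]
    rw [← neg_sub (α i : ℂ), mul_neg, div_neg]
  have hcomm : (2 : ℂ) • (c * D - D * c) = -dmoment R w := by
    ext i j
    rw [Matrix.smul_apply, Matrix.sub_apply, hD, Matrix.mul_diagonal, Matrix.diagonal_mul,
      Matrix.neg_apply, smul_eq_mul, hcapply]
    by_cases h0 : dmoment R w i j = 0
    · simp [h0]
    · have h1 : (α i : ℂ) - α j ≠ 0 := by
        intro h2
        have h3 : α i - α j = 0 := by exact_mod_cast h2
        have h4 := (hDne i j h0).2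
        rw [h3, mul_zero] at h4
        exact lt_irrefl _ h4
      field_simp
      ring
  obtain ⟨Z, hZ, hev⟩ := exists_unitary_conj_expansion (fun i j h => (hcne i j h).1) hskew D
  have h := trace_re_nonneg_of_frob_le (M := momentResidual α R)
    (Y₀ := moment w + (c * ((2 : ℂ) • (c * D - D * c)) - (2 : ℂ) • (c * D - D * c) * c))
    (Y := fun τ => moment w + Z τ) (k := 2) two_ne_zero
    ((hZ.mono_left nhdsWithin_le_nhds).const_add _) (by
      filter_upwards [hev.filter_mono nhdsWithin_le_nhds] with τ hτ
      obtain ⟨U, hU₁, hU₂, hUb, hU⟩ := hτ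
      refine (frob_le_unitary_conj hmin hU₁ hU₂ hUb (hR.add_smul hw (τ : ℂ))).trans_eq ?_
      rw [← hD, hU, hcomm, moment_add_smul, momentResidual, ← hD]
      congr 1
      push_cast
      module)
  rw [momentResidual_isHermitian, hM, Matrix.mul_add, Matrix.trace_add, Complex.add_re,
    trace_diagonal_mul_moment, trace_diagonal_mul_commutator m α hskew hD] at h
  have hc0 : 0 ≤ ∑ i, ∑ j, (m i - m j) * (α i - α j) * ‖c i j‖ ^ 2 := by
    refine Finset.sum_nonneg fun i _ => Finset.sum_nonneg fun j _ => ?_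
    by_cases h0 : c i j = 0
    · simp [h0]
    · exact mul_nonneg (hcne i j h0).2.le (sq_nonneg _)
  have hw0 : ∀ b i j, 0 ≤ (m j - m i) * ‖w b i j‖ ^ 2 := by
    intro b i j
    by_cases h0 : w b i j = 0
    · simp [h0]
    · exact mul_nonneg (sub_pos.2 (hwm b i j h0)).le (sq_nonneg _)
  have hsum : ∑ b, ∑ i, ∑ j, (m j - m i) * ‖w b i j‖ ^ 2 ≤ 0 := by
    have : ∑ b, ∑ i, ∑ j, (m j - m i) * ‖w b i j‖ ^ 2 =
        -∑ b, ∑ i, ∑ j, (m i - m j) * ‖w b i j‖ ^ 2 := by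
      simp only [← Finset.sum_neg_distrib, ← neg_mul, neg_sub]
    linarith
  ext i j
  by_contra hne
  have hpos : 0 < (m j - m i) * ‖w a i j‖ ^ 2 :=
    mul_pos (sub_pos.2 (hwm a i j hne)) (pow_pos (norm_pos_iff.2 hne) 2)
  have h1 := Finset.single_le_sum (f := fun b => ∑ i, ∑ j, (m j - m i) * ‖w b i j‖ ^ 2)
    (fun b _ => Finset.sum_nonneg fun i _ => Finset.sum_nonneg fun j _ => hw0 b i j)
    (Finset.mem_univ a)
  have h2 := Finset.single_le_sum (f := fun i => ∑ j, (m j - m i) * ‖w a i j‖ ^ 2)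
    (fun i _ => Finset.sum_nonneg fun j _ => hw0 a i j) (Finset.mem_univ i)
  have h3 := Finset.single_le_sum (f := fun j => (m j - m i) * ‖w a i j‖ ^ 2)
    (fun j _ => hw0 a i j) (Finset.mem_univ j)
  linarith

end SecondOrder

section Minimizer

variable {ι A V : Type} [Fintype ι] [DecidableEq ι] [Fintype A]

omit [DecidableEq ι] in
theorem norm_apply_le_frob_add_one (X : Matrix ι ι ℂ) (i j : ι) : ‖X i j‖ ≤ frob X + 1 := by
  have h1 := Finset.single_le_sum (f := fun j => ‖X i j‖ ^ 2) (fun j _ => by positivity)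
    (Finset.mem_univ j)
  have h2 := Finset.single_le_sum (f := fun i => ∑ j, ‖X i j‖ ^ 2) (fun j _ => by positivity)
    (Finset.mem_univ i)
  have h3 : ‖X i j‖ ^ 2 ≤ frob X := h1.trans h2
  nlinarith [sq_nonneg (‖X i j‖ - 1)]

theorem sum_frob_eq {v : ι → V} {s t : A → V} {R : A → Matrix ι ι ℂ} (hR : IsRep v s t R)
    (α : ι → ℝ) (d : V → ℝ) (hd : ∀ a, d (t a) = d (s a) + 1) :
    ∑ a, frob (R a) = ∑ i, d (v i) * ((momentResidual α R i i).re - α i) := by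
  have h := trace_diagonal_mul_moment (fun i => d (v i)) R
  have h1 : ∀ a, ∑ i, ∑ j, (d (v i) - d (v j)) * ‖R a i j‖ ^ 2 = frob (R a) := fun a => by
    refine Finset.sum_congr rfl fun i _ => Finset.sum_congr rfl fun j _ => ?_
    by_cases h0 : R a i j = 0
    · simp [h0]
    · obtain ⟨e1, e2⟩ := hR a i j h0
      rw [e1, e2, hd]
      ring
  simp only [h1] at h
  rw [← h, Matrix.trace, Complex.re_sum]
  refine Finset.sum_congr rfl fun i _ => ?_
  rw [Matrix.diag_apply, Matrix.diagonal_mul, Complex.re_ofReal_mul, momentResidual,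
    Matrix.add_apply, Matrix.diagonal_apply_eq, Complex.add_re, Complex.ofReal_re,
    add_sub_cancel_right]

omit [DecidableEq ι] in
theorem continuous_moment : Continuous (moment : (A → Matrix ι ι ℂ) → Matrix ι ι ℂ) := by
  unfold moment
  fun_prop

theorem continuous_momentResidual (α : ι → ℝ) :
    Continuous (momentResidual α : (A → Matrix ι ι ℂ) → Matrix ι ι ℂ) :=
  continuous_moment.add continuous_const

omit [Fintype ι] [DecidableEq ι] [Fintype A] in
theorem isClosed_isRep (v : ι → V) (s t : A → V) : IsClosed {R | IsRep v s t R} := by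
  simp only [IsRep, Set.ofPred_forall]
  refine isClosed_iInter fun a => isClosed_iInter fun i => isClosed_iInter fun j => ?_
  by_cases h : v i = t a ∧ v j = s a
  · simp [h]
  · have : IsClosed {R : A → Matrix ι ι ℂ | R a i j = 0} :=
      isClosed_eq (by fun_prop) continuous_const
    convert this using 1
    ext R
    simp only [Set.mem_ofPred_eq]
    exact ⟨fun h1 => by_contra fun h2 => h (h1 h2), fun h1 h2 => absurd h1 h2⟩

/-- The distance of the moment map to a diagonal target is attained. -/
theorem exists_isMin (v : ι → V) (s t : A → V) (α : ι → ℝ) (d : V → ℝ)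
    (hd : ∀ a, d (t a) = d (s a) + 1) :
    ∃ R, IsRep v s t R ∧
      ∀ R', IsRep v s t R' → frob (momentResidual α R) ≤ frob (momentResidual α R') := by
  set c := frob (momentResidual α (0 : A → Matrix ι ι ℂ)) with hc
  set B := ∑ i, |d (v i)| * (c + 1 + |α i|) with hB
  let S : Set (A → Matrix ι ι ℂ) := {R | IsRep v s t R} ∩ {R | frob (momentResidual α R) ≤ c}
  have hclosed : IsClosed S := (isClosed_isRep v s t).inter
    (isClosed_le (continuous_frob.comp (continuous_momentResidual α)) continuous_const)
  have hcompact : IsCompact (Set.univ.pi fun _ : A => Set.univ.pi fun _ : ι => Set.univ.pi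
      fun _ : ι => Metric.closedBall (0 : ℂ) (B + 1)) :=
    isCompact_univ_pi fun _ => isCompact_univ_pi fun _ => isCompact_univ_pi fun _ =>
      isCompact_closedBall _ _
  have hsub : S ⊆ (Set.univ.pi fun _ : A => Set.univ.pi fun _ : ι => Set.univ.pi
      fun _ : ι => Metric.closedBall (0 : ℂ) (B + 1)) := by
    rintro R ⟨hR, hle⟩ a - i - j -
    rw [mem_closedBall_zero_iff]
    refine (norm_apply_le_frob_add_one (R a) i j).trans (add_le_add_left ?_ 1)
    refine (Finset.single_le_sum (f := fun a => frob (R a)) (fun a _ => frob_nonneg _)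
      (Finset.mem_univ a)).trans ?_
    rw [sum_frob_eq hR α d hd]
    refine Finset.sum_le_sum fun i _ => ?_
    have h1 : |(momentResidual α R i i).re| ≤ c + 1 :=
      (Complex.abs_re_le_norm _).trans ((norm_apply_le_frob_add_one _ i i).trans
        (add_le_add_left hle 1))
    calc _ ≤ |d (v i) * ((momentResidual α R i i).re - α i)| := le_abs_self _
      _ = |d (v i)| * |(momentResidual α R i i).re - α i| := abs_mul _ _
      _ ≤ _ := mul_le_mul_of_nonneg_left ((abs_sub _ _).trans (add_le_add_left h1 _))
        (abs_nonneg _)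
  have h0 : (0 : A → Matrix ι ι ℂ) ∈ S := ⟨fun a i j h => absurd rfl h, le_refl c⟩
  obtain ⟨R, hRS, hmin⟩ := (hcompact.of_isClosed_subset hclosed hsub).exists_isMinOn ⟨0, h0⟩
    (continuous_frob.comp (continuous_momentResidual α)).continuousOn
  refine ⟨R, hRS.1, fun R' hR' => ?_⟩
  by_cases h : frob (momentResidual α R') ≤ c
  · exact hmin ⟨hR', h⟩
  · exact hRS.2.trans (not_le.1 h).le

theorem momentResidual_block {v : ι → V} {s t : A → V} {R : A → Matrix ι ι ℂ}
    (hR : IsRep v s t R) (α : ι → ℝ) {i j : ι} (h : momentResidual α R i j ≠ 0) : v i = v j := by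
  by_cases hij : i = j
  · rw [hij]
  rw [momentResidual, Matrix.add_apply, Matrix.diagonal_apply_ne _ hij, add_zero, moment,
    Matrix.sum_apply] at h
  obtain ⟨b, -, hb⟩ := Finset.exists_ne_zero_of_sum_ne_zero h
  rw [Matrix.sub_apply] at hb
  by_cases hb1 : (R b * (R b)ᴴ) i j = 0
  · rw [hb1, zero_sub, neg_ne_zero, Matrix.mul_apply] at hb
    obtain ⟨k, -, hk⟩ := Finset.exists_ne_zero_of_sum_ne_zero hb
    have hk1 : R b k i ≠ 0 := fun h0 => left_ne_zero_of_mul hk (by simp [h0])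
    exact (hR b k i hk1).2.trans (hR b k j (right_ne_zero_of_mul hk)).2.symm
  · rw [Matrix.mul_apply] at hb1
    obtain ⟨k, -, hk⟩ := Finset.exists_ne_zero_of_sum_ne_zero hb1
    have hk1 : R b j k ≠ 0 := fun h0 => right_ne_zero_of_mul hk (by simp [h0])
    exact (hR b i k (left_ne_zero_of_mul hk)).1.trans (hR b j k hk1).1.symm

/-- At a minimizer the residual is diagonal, and constant along the nonzero entries. -/
theorem momentResidual_eq_diagonal {v : ι → V} {s t : A → V} {R : A → Matrix ι ι ℂ} {α : ι → ℝ}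
    (hR : IsRep v s t R)
    (hmin : ∀ R', IsRep v s t R' → frob (momentResidual α R) ≤ frob (momentResidual α R'))
    (hα : ∀ i j, v i = v j → α i = α j → i = j) :
    ∃ m : ι → ℝ, momentResidual α R = Matrix.diagonal (fun i => (m i : ℂ)) ∧
      ∀ a i j, R a i j ≠ 0 → m i = m j := by
  set M := momentResidual α R with hM
  have hMH : Mᴴ = M := momentResidual_isHermitian α R
  have hcomm : ∀ a, M * R a = R a * M :=
    momentResidual_commute hR (fun i j => momentResidual_block hR α) hmin
  have hcommH : ∀ a, M * (R a)ᴴ = (R a)ᴴ * M := fun a => by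
    have := congrArg Matrix.conjTranspose (hcomm a)
    rw [Matrix.conjTranspose_mul, Matrix.conjTranspose_mul, hMH] at this
    exact this.symm
  have hmom : M * moment R = moment R * M := by
    simp only [moment, Finset.mul_sum, Finset.sum_mul]
    refine Finset.sum_congr rfl fun a _ => ?_
    rw [Matrix.mul_sub, Matrix.sub_mul, ← Matrix.mul_assoc, hcomm, Matrix.mul_assoc, hcommH,
      ← Matrix.mul_assoc M, hcommH, Matrix.mul_assoc _ M, hcomm]
    simp only [Matrix.mul_assoc]
  have hdiag : M * Matrix.diagonal (fun i => (α i : ℂ)) =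
      Matrix.diagonal (fun i => (α i : ℂ)) * M := by
    have h : Matrix.diagonal (fun i => (α i : ℂ)) = M - moment R := by
      rw [hM, momentResidual, add_sub_cancel_left]
    rw [h, Matrix.mul_sub, Matrix.sub_mul, hmom]
  have hMd : M = Matrix.diagonal (fun i => (((M i i).re : ℝ) : ℂ)) := by
    ext i j
    by_cases hij : i = j
    · subst hij
      rw [Matrix.diagonal_apply_eq]
      have h := congrFun (congrFun hMH i) i
      rw [Matrix.conjTranspose_apply] at h
      exact (Complex.conj_eq_iff_re.1 h).symm
    · rw [Matrix.diagonal_apply_ne _ hij]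
      by_contra hne
      refine hij (hα i j (momentResidual_block hR α hne) ?_)
      have h := congrFun (congrFun hdiag i) j
      rw [Matrix.mul_diagonal, Matrix.diagonal_mul, mul_comm] at h
      exact_mod_cast (mul_right_cancel₀ hne h).symm
  refine ⟨fun i => (M i i).re, hMd, fun a i j hne => ?_⟩
  have h := congrFun (congrFun (hcomm a) i) j
  rw [hMd, Matrix.mul_diagonal, Matrix.diagonal_mul, mul_comm (R a i j)] at h
  exact_mod_cast mul_right_cancel₀ hne h

end Minimizer

section Deformation

open Topology

variable {ι A V : Type} [Fintype ι] [DecidableEq ι] [Fintype A]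

/-- Infinitesimal deformations along increasing directions fill the off-diagonal block. -/
theorem exists_commutator_eq {v : ι → V} {s t : A → V} {R : A → Matrix ι ι ℂ} {α m : ι → ℝ}
    (hR : IsRep v s t R) (hM : momentResidual α R = Matrix.diagonal fun i => (m i : ℂ))
    (hmin : ∀ R', IsRep v s t R' → frob (momentResidual α R) ≤ frob (momentResidual α R'))
    (hα : ∀ i j, v i = v j → α i = α j → i = j)
    (hRm : ∀ a i j, R a i j ≠ 0 → m i = m j) (Y : A → Matrix ι ι ℂ) :
    ∃ ξ : Matrix ι ι ℂ, (∀ i j, ξ i j ≠ 0 → v i = v j ∧ α j < α i ∧ m i ≤ 0 ∧ 0 < m j) ∧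
      ∀ a i j, v i = t a → v j = s a → m i ≤ 0 → 0 < m j →
        (ξ * R a - R a * ξ) i j = Y a i j := by
  classical
  let J := {x : A × ι × ι // v x.2.1 = t x.1 ∧ v x.2.2 = s x.1 ∧ m x.2.1 ≤ 0 ∧ 0 < m x.2.2}
  let N : Submodule ℂ (Matrix ι ι ℂ) :=
    { carrier := {ξ | ∀ i j, ξ i j ≠ 0 → v i = v j ∧ α j < α i ∧ m i ≤ 0 ∧ 0 < m j}
      add_mem' := by
        intro x y hx hy i j hij
        by_cases h : x i j = 0
        · exact hy i j fun h' => hij (by rw [Matrix.add_apply, h, h', add_zero])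
        · exact hx i j h
      zero_mem' := fun i j h => absurd rfl h
      smul_mem' := fun z x hx i j h => hx i j fun h' => h (by rw [Matrix.smul_apply, h', smul_zero]) }
  let res : (A → Matrix ι ι ℂ) →ₗ[ℂ] (J → ℂ) :=
    { toFun := fun Y x => Y x.1.1 x.1.2.1 x.1.2.2
      map_add' := fun _ _ => rfl
      map_smul' := fun _ _ => rfl }
  let comm : Matrix ι ι ℂ →ₗ[ℂ] (A → Matrix ι ι ℂ) :=
    { toFun := fun ξ a => ξ * R a - R a * ξ
      map_add' := fun x y => by
        ext1 a
        simp only [Matrix.add_mul, Matrix.mul_add, Pi.add_apply]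
        abel
      map_smul' := fun z x => by
        ext1 a
        simp [smul_sub] }
  suffices hsurj : N.map (res ∘ₗ comm) = ⊤ by
    obtain ⟨ξ, hξ, he⟩ : res Y ∈ N.map (res ∘ₗ comm) := hsurj ▸ Submodule.mem_top
    exact ⟨ξ, hξ, fun a i j h1 h2 h3 h4 => congrFun he ⟨(a, i, j), h1, h2, h3, h4⟩⟩
  by_contra hne
  obtain ⟨f, hf0, hf⟩ := Submodule.exists_le_ker_of_lt_top _ (lt_top_iff_ne_top.2 hne)
  let w : A → Matrix ι ι ℂ := fun a i j =>
    if h : v i = t a ∧ v j = s a ∧ m i ≤ 0 ∧ 0 < m j then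
      star (f (Pi.single (⟨(a, i, j), h⟩ : J) 1)) else 0
  have hwne : ∀ a i j, w a i j ≠ 0 → v i = t a ∧ v j = s a ∧ m i ≤ 0 ∧ 0 < m j := by
    intro a i j h
    by_contra hcon
    exact h (dif_neg hcon)
  have hwJ : ∀ x : J, f (Pi.single x 1) = star (w x.1.1 x.1.2.1 x.1.2.2) := by
    intro x
    have : w x.1.1 x.1.2.1 x.1.2.2 = star (f (Pi.single x 1)) := dif_pos x.2
    rw [this, star_star]
  have hfres : ∀ Y : A → Matrix ι ι ℂ, f (res Y) = ∑ a, (Y a * (w a)ᴴ).trace := by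
    intro Y
    have h1 : f (res Y) = ∑ x : J, res Y x * f (Pi.single x 1) := by
      conv_lhs => rw [← Finset.univ_sum_single (res Y)]
      rw [map_sum]
      refine Finset.sum_congr rfl fun x _ => ?_
      rw [← smul_eq_mul, ← map_smul]
      congr 1
      ext y
      simp [Pi.single_apply]
    have h2 : ∑ a, (Y a * (w a)ᴴ).trace =
        ∑ x : A × ι × ι, Y x.1 x.2.1 x.2.2 * star (w x.1 x.2.1 x.2.2) := by
      rw [Fintype.sum_prod_type]
      refine Finset.sum_congr rfl fun a _ => ?_
      rw [Fintype.sum_prod_type]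
      rfl
    have h3 := Finset.sum_filter_of_ne (s := Finset.univ)
      (f := fun x : A × ι × ι => Y x.1 x.2.1 x.2.2 * star (w x.1 x.2.1 x.2.2))
      (p := fun x => v x.2.1 = t x.1 ∧ v x.2.2 = s x.1 ∧ m x.2.1 ≤ 0 ∧ 0 < m x.2.2)
      fun x _ hx => hwne _ _ _ fun h0 => hx (by rw [h0, star_zero, mul_zero])
    rw [h1, h2, ← h3, Finset.sum_subtype (p := fun x : A × ι × ι =>
      v x.2.1 = t x.1 ∧ v x.2.2 = s x.1 ∧ m x.2.1 ≤ 0 ∧ 0 < m x.2.2) _ fun x => by simp]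
    exact Finset.sum_congr rfl fun x _ => by rw [hwJ]; rfl
  have hw0 : ∀ a, w a = 0 := by
    refine eq_zero_of_isMin hR hM hmin hα hRm
      (fun a i j h => ⟨(hwne a i j h).1, (hwne a i j h).2.1⟩)
      (fun a i j h => (hwne a i j h).2.2.1.trans_lt (hwne a i j h).2.2.2) fun i j hv hαij => ?_
    by_contra hQ
    have hK : m i ≤ 0 ∧ 0 < m j := by
      rw [Matrix.sum_apply] at hQ
      obtain ⟨b, -, hb⟩ := Finset.exists_ne_zero_of_sum_ne_zero hQ
      rw [Matrix.sub_apply] at hb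
      by_cases hb1 : (w b * (R b)ᴴ) i j = 0
      · rw [hb1, zero_sub, neg_ne_zero, Matrix.mul_apply] at hb
        obtain ⟨k, -, hk⟩ := Finset.exists_ne_zero_of_sum_ne_zero hb
        have hk1 : R b k i ≠ 0 := fun h0 => left_ne_zero_of_mul hk (by simp [h0])
        have hk2 := hwne b k j (right_ne_zero_of_mul hk)
        exact ⟨hRm b k i hk1 ▸ hk2.2.2.1, hk2.2.2.2⟩
      · rw [Matrix.mul_apply] at hb1
        obtain ⟨k, -, hk⟩ := Finset.exists_ne_zero_of_sum_ne_zero hb1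
        have hk1 : R b j k ≠ 0 := fun h0 => right_ne_zero_of_mul hk (by simp [h0])
        have hk2 := hwne b i k (left_ne_zero_of_mul hk)
        exact ⟨hk2.2.2.1, hRm b j k hk1 ▸ hk2.2.2.2⟩
    have hmem : Matrix.single i j (1 : ℂ) ∈ N := by
      intro k l hkl
      by_cases h : i = k ∧ j = l
      · obtain ⟨rfl, rfl⟩ := h
        exact ⟨hv, hαij, hK⟩
      · exact absurd (Matrix.single_apply_of_ne i j 1 k l h) hkl
    have h0 : f (res (comm (Matrix.single i j 1))) = 0 := hf ⟨_, hmem, rfl⟩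
    rw [hfres] at h0
    have h1 : ∑ a, (comm (Matrix.single i j 1) a * (w a)ᴴ).trace =
        (Matrix.single i j 1 * (∑ a, (w a * (R a)ᴴ - (R a)ᴴ * w a))ᴴ).trace := by
      rw [Matrix.conjTranspose_sum, Finset.mul_sum, Matrix.trace_sum]
      refine Finset.sum_congr rfl fun a _ => ?_
      change ((Matrix.single i j 1 * R a - R a * Matrix.single i j 1) * (w a)ᴴ).trace = _
      rw [Matrix.sub_mul, Matrix.trace_sub, Matrix.mul_assoc (R a), Matrix.trace_mul_comm (R a)]
      simp only [Matrix.conjTranspose_sub, Matrix.conjTranspose_mul,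
        Matrix.conjTranspose_conjTranspose, Matrix.mul_sub, Matrix.trace_sub, Matrix.mul_assoc]
    rw [h1, Matrix.trace_single_mul, Matrix.conjTranspose_apply, one_smul, star_eq_zero] at h0
    exact hQ h0
  apply hf0
  refine LinearMap.pi_ext' fun x => LinearMap.ext_ring ?_
  have := hwJ x
  rw [hw0] at this
  simpa using this

theorem conj_block_expand (R Y ξ ξ' : Matrix ι ι ℂ) (τ : ℂ) (h : ξ = τ • ξ') :
    (1 - ξ) * (R + τ • Y) * (1 + ξ) = R + τ • (Y + (R * ξ' - ξ' * R)) +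
      τ ^ 2 • (Y * ξ' - ξ' * Y - ξ' * R * ξ') + τ ^ 3 • (-(ξ' * Y * ξ')) := by
  rw [h]
  simp only [Matrix.mul_add, Matrix.sub_mul, Matrix.add_mul, Matrix.one_mul, Matrix.mul_one,
    Matrix.mul_smul, Matrix.smul_mul, smul_add, smul_sub]
  module

/-- Near a minimizer every representation can be conjugated, by a unipotent matrix, to one
preserving the coordinate subspaces of the positive part of the residual. -/
theorem eventually_exists_conj_block {v : ι → V} {s t : A → V} {R : A → Matrix ι ι ℂ}
    {α m : ι → ℝ}
    (hR : IsRep v s t R) (hM : momentResidual α R = Matrix.diagonal fun i => (m i : ℂ))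
    (hmin : ∀ R', IsRep v s t R' → frob (momentResidual α R) ≤ frob (momentResidual α R'))
    (hα : ∀ i j, v i = v j → α i = α j → i = j)
    (hRm : ∀ a i j, R a i j ≠ 0 → m i = m j) :
    ∀ᶠ R' in 𝓝 R, IsRep v s t R' →
      ∃ ξ : Matrix ι ι ℂ, (∀ i j, ξ i j ≠ 0 → v i = v j ∧ α j < α i ∧ m i ≤ 0 ∧ 0 < m j) ∧
        ∀ a i j, m i ≤ 0 → 0 < m j → ((1 - ξ) * R' a * (1 + ξ)) i j = 0 := by
  classical
  let J := {x : A × ι × ι // v x.2.1 = t x.1 ∧ v x.2.2 = s x.1 ∧ m x.2.1 ≤ 0 ∧ 0 < m x.2.2}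
  let mask : ι → ι → ℂ := fun i j => if v i = v j ∧ α j < α i ∧ m i ≤ 0 ∧ 0 < m j then 1 else 0
  let hat : (ι → ι → ℂ) → Matrix ι ι ℂ := fun ξ => Matrix.of fun i j => mask i j * ξ i j
  have hhat : ∀ ξ i j, hat ξ i j ≠ 0 → v i = v j ∧ α j < α i ∧ m i ≤ 0 ∧ 0 < m j := by
    intro ξ i j h
    by_contra hcon
    refine h ?_
    change mask i j * ξ i j = 0
    rw [show mask i j = 0 from if_neg hcon, zero_mul]
  let G : (A → ι → ι → ℂ) × (ι → ι → ℂ) → J → ℂ := fun x y =>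
    ((1 - hat x.2) * (Matrix.of (x.1 y.1.1)) * (1 + hat x.2)) y.1.2.1 y.1.2.2
  let F : (A → ι → ι → ℂ) × (ι → ι → ℂ) → (A → ι → ι → ℂ) × (J → ℂ) := fun x => (x.1, G x)
  have hGsmooth : ContDiff ℂ 1 G := by
    refine contDiff_pi.2 fun y => ?_
    simp only [G, hat, Matrix.mul_apply, Matrix.sub_apply, Matrix.add_apply, Matrix.of_apply]
    fun_prop
  let R₀ : A → ι → ι → ℂ := R
  have hG := (hGsmooth.contDiffAt (x := (R₀, 0))).hasStrictFDerivAt one_ne_zero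
  have hF : HasStrictFDerivAt F _ (R₀, 0) := hasStrictFDerivAt_fst.prodMk hG
  have hhat0 : hat 0 = 0 := by
    ext i j
    exact mul_zero _
  have hF0 : F (R₀, 0) = (R₀, 0) := by
    refine Prod.ext rfl ?_
    ext y
    change ((1 - hat 0) * R y.1.1 * (1 + hat 0)) y.1.2.1 y.1.2.2 = 0
    rw [hhat0, sub_zero, add_zero, Matrix.one_mul, Matrix.mul_one]
    by_contra hne
    have := hRm _ _ _ hne
    linarith [y.2.2.2.1, y.2.2.2.2]
  have hderiv : ∀ (Y : A → ι → ι → ℂ) (ξ : ι → ι → ℂ) (y : J), fderiv ℂ G (R₀, 0) (Y, ξ) y =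
      (Matrix.of (Y y.1.1) + (R y.1.1 * hat ξ - hat ξ * R y.1.1)) y.1.2.1 y.1.2.2 := by
    intro Y ξ y
    have h1 := hasDerivAt_pi.1 (hG.hasFDerivAt.hasLineDerivAt (Y, ξ)) y
    refine h1.unique ?_
    have h2 : ∀ c₀ c₁ c₂ c₃ : ℂ, HasDerivAt
        (fun τ : ℂ => c₀ + τ * c₁ + τ ^ 2 * c₂ + τ ^ 3 * c₃) c₁ 0 := by
      intro c₀ c₁ c₂ c₃
      have h := ((((hasDerivAt_id (0 : ℂ)).mul_const c₁).const_add c₀).fun_add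
        ((hasDerivAt_pow 2 (0 : ℂ)).mul_const c₂)).fun_add ((hasDerivAt_pow 3 (0 : ℂ)).mul_const c₃)
      simpa using h
    refine (h2 (R y.1.1 y.1.2.1 y.1.2.2) _
      ((Matrix.of (Y y.1.1) * hat ξ - hat ξ * Matrix.of (Y y.1.1) -
        hat ξ * R y.1.1 * hat ξ) y.1.2.1 y.1.2.2)
      ((-(hat ξ * Matrix.of (Y y.1.1) * hat ξ)) y.1.2.1 y.1.2.2)).congr_of_eventuallyEq
      (Filter.Eventually.of_forall fun τ => ?_)
    have h3 := conj_block_expand (R y.1.1) (Matrix.of (Y y.1.1)) (hat ((R₀, 0) + τ • (Y, ξ)).2)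
      (hat ξ) τ (by
        ext i j
        change mask i j * (0 + τ * ξ i j) = τ * (mask i j * ξ i j)
        ring)
    have h4 := congrFun (congrFun h3 y.1.2.1) y.1.2.2
    exact h4
  have hsurj : ((ContinuousLinearMap.fst ℂ (A → ι → ι → ℂ) (ι → ι → ℂ)).prod
      (fderiv ℂ G (R₀, 0))).range = ⊤ := by
    rw [LinearMap.range_eq_top]
    rintro ⟨Y, z⟩
    obtain ⟨ξ, hξ, he⟩ := exists_commutator_eq hR hM hmin hα hRm fun a => Matrix.of fun i j =>
      if h : v i = t a ∧ v j = s a ∧ m i ≤ 0 ∧ 0 < m j then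
        Y a i j - z ⟨(a, i, j), h⟩ else 0
    have hhatξ : hat ξ = ξ := by
      ext i j
      change mask i j * ξ i j = ξ i j
      by_cases h0 : ξ i j = 0
      · rw [h0, mul_zero]
      · rw [show mask i j = 1 from if_pos (hξ i j h0), one_mul]
    refine ⟨(Y, ξ), Prod.ext rfl ?_⟩
    ext y
    change fderiv ℂ G (R₀, 0) (Y, ξ) y = z y
    refine (hderiv Y ξ y).trans ?_
    rw [hhatξ, ← neg_sub, Matrix.add_apply, Matrix.neg_apply,
      he _ _ _ y.2.1 y.2.2.1 y.2.2.2.1 y.2.2.2.2]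
    change Y _ _ _ + -(dite _ _ _) = _
    rw [dif_pos y.2]
    ring
  have hmap := hF.map_nhds_eq_of_surj hsurj
  rw [hF0] at hmap
  have hcont : Filter.Tendsto (fun R' : A → ι → ι → ℂ => (R', (0 : J → ℂ))) (𝓝 R₀) (𝓝 (R₀, 0)) :=
    (Continuous.prodMk continuous_id continuous_const).tendsto R₀
  have hev : ∀ᶠ x in 𝓝 (R₀, (0 : J → ℂ)), ∃ x', F x' = x := by
    rw [← hmap, Filter.eventually_map]
    exact Filter.Eventually.of_forall fun x => ⟨x, rfl⟩
  filter_upwards [hcont.eventually hev] with R' hR' hrep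
  obtain ⟨⟨R'', ξ⟩, hx⟩ := hR'
  obtain rfl : R'' = R' := congrArg Prod.fst hx
  have hG : G (R'', ξ) = 0 := congrArg Prod.snd hx
  refine ⟨hat ξ, hhat ξ, fun a i j hi hj => ?_⟩
  by_cases hv : v i = t a ∧ v j = s a
  · exact congrFun hG ⟨(a, i, j), hv.1, hv.2, hi, hj⟩
  · by_contra hne
    refine hv ?_
    rw [Matrix.mul_apply] at hne
    obtain ⟨k, -, hk⟩ := Finset.exists_ne_zero_of_sum_ne_zero hne
    have hk1 : ∑ l, (1 - hat ξ) i l * R'' a l k ≠ 0 := left_ne_zero_of_mul hk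
    obtain ⟨l, -, hl⟩ := Finset.exists_ne_zero_of_sum_ne_zero hk1
    obtain ⟨e1, e2⟩ := hrep a l k (right_ne_zero_of_mul hl)
    have h1 : v k = v j := by
      have := block_one_add_smul (v := v) (c := hat ξ) (fun i j h => (hhat ξ i j h).1) 1 (i := k)
        (j := j)
      rw [one_smul] at this
      exact this (right_ne_zero_of_mul hk)
    have h2 : v i = v l := by
      have := block_one_add_smul (v := v) (c := hat ξ) (fun i j h => (hhat ξ i j h).1) (-1) (i := i)
        (j := l)
      rw [neg_one_smul, ← sub_eq_add_neg] at this
      exact this (left_ne_zero_of_mul hl)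
    exact ⟨h2.trans e1, h1.symm.trans e2⟩

end Deformation

section Estimates

variable {ι κ A V : Type} [Fintype ι] [DecidableEq ι] [Fintype A]

theorem sum_mul_eq_of_residual {R : A → Matrix ι ι ℂ} {α m f : ι → ℝ}
    (hM : momentResidual α R = Matrix.diagonal fun i => (m i : ℂ))
    (hf : ∀ a i j, R a i j ≠ 0 → f i = f j) : ∑ i, f i * α i = ∑ i, f i * m i := by
  have h1 : (Matrix.diagonal (fun i => (f i : ℂ)) * moment R).trace.re = 0 := by
    rw [trace_diagonal_mul_moment]
    refine Finset.sum_eq_zero fun a _ => Finset.sum_eq_zero fun i _ =>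
      Finset.sum_eq_zero fun j _ => ?_
    by_cases h : R a i j = 0
    · simp [h]
    · rw [hf a i j h, sub_self, zero_mul]
  have h2 : moment R = Matrix.diagonal fun i => ((m i - α i : ℝ) : ℂ) := by
    rw [← add_right_cancel_iff (a := Matrix.diagonal fun i => (α i : ℂ))]
    refine hM.trans ?_
    rw [Matrix.diagonal_add]
    simp
  rw [h2, Matrix.diagonal_mul_diagonal, Matrix.trace_diagonal, Complex.re_sum] at h1
  rw [← sub_eq_zero, ← Finset.sum_sub_distrib, ← neg_eq_zero, ← Finset.sum_neg_distrib, ← h1]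
  refine Finset.sum_congr rfl fun i _ => ?_
  rw [← Complex.ofReal_mul, Complex.ofReal_re]
  ring

omit [DecidableEq ι] in
theorem moment_apply_self_re (R : A → Matrix ι ι ℂ) (i : ι) :
    (moment R i i).re = ∑ a, (∑ j, ‖R a i j‖ ^ 2 - ∑ j, ‖R a j i‖ ^ 2) := by
  have h : ∀ z : ℂ, (z * star z).re = ‖z‖ ^ 2 := fun z => by
    rw [← Complex.normSq_eq_norm_sq, ← starRingEnd_apply, Complex.mul_conj, Complex.ofReal_re]
  rw [moment, Matrix.sum_apply, Complex.re_sum]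
  refine Finset.sum_congr rfl fun a _ => ?_
  rw [Matrix.sub_apply, Complex.sub_re, Matrix.mul_apply, Matrix.mul_apply, Complex.re_sum,
    Complex.re_sum]
  congr 1
  · exact Finset.sum_congr rfl fun j _ => h _
  · refine Finset.sum_congr rfl fun j _ => ?_
    rw [mul_comm]
    exact h _

theorem nonneg_of_source {v : ι → V} {s t : A → V} {R : A → Matrix ι ι ℂ} {α : ι → ℝ}
    (hR : IsRep v s t R) (h0 : momentResidual α R = 0) {i : ι} (hi : ∀ a, t a ≠ v i) :
    0 ≤ α i := by
  have h1 := congrArg Complex.re (congrFun (congrFun h0 i) i)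
  rw [momentResidual, Matrix.add_apply, Matrix.diagonal_apply_eq, Complex.add_re,
    moment_apply_self_re, Complex.ofReal_re] at h1
  have h2 : ∑ a, (∑ j, ‖R a i j‖ ^ 2 - ∑ j, ‖R a j i‖ ^ 2) ≤ 0 :=
    Finset.sum_nonpos fun a _ => by
      rw [Finset.sum_eq_zero fun j _ => ?_, zero_sub, neg_nonpos]
      · positivity
      · rw [sq_eq_zero_iff, norm_eq_zero]
        by_contra h
        exact hi a (hR a i j h).1.symm
  have h3 : ((0 : Matrix ι ι ℂ) i i).re = 0 := rfl
  linarith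

theorem nonpos_of_sink {v : ι → V} {s t : A → V} {R : A → Matrix ι ι ℂ} {α : ι → ℝ}
    (hR : IsRep v s t R) (h0 : momentResidual α R = 0) {i : ι} (hi : ∀ a, s a ≠ v i) :
    α i ≤ 0 := by
  have h1 := congrArg Complex.re (congrFun (congrFun h0 i) i)
  rw [momentResidual, Matrix.add_apply, Matrix.diagonal_apply_eq, Complex.add_re,
    moment_apply_self_re, Complex.ofReal_re] at h1
  have h2 : 0 ≤ ∑ a, (∑ j, ‖R a i j‖ ^ 2 - ∑ j, ‖R a j i‖ ^ 2) :=
    Finset.sum_nonneg fun a _ => by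
      rw [Finset.sum_eq_zero (f := fun j => ‖R a j i‖ ^ 2) fun j _ => ?_, sub_zero]
      · positivity
      · rw [sq_eq_zero_iff, norm_eq_zero]
        by_contra h
        exact hi a (hR a j i h).2.symm
  have h3 : ((0 : Matrix ι ι ℂ) i i).re = 0 := rfl
  linarith

open scoped ComplexOrder in
/-- The inequality attached to an orthonormal frame of a subrepresentation. -/
theorem sum_nonpos_of_frame [Fintype κ] [DecidableEq κ] {R : A → Matrix ι ι ℂ} {α : ι → ℝ}
    (h0 : momentResidual α R = 0) {U : Matrix ι κ ℂ} (hU : Uᴴ * U = 1)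
    (hR : ∀ a, R a * U = U * (Uᴴ * (R a * U))) {β : κ → ℝ}
    (hβ : ∀ i k, U i k ≠ 0 → β k ≤ α i) : ∑ k, β k ≤ 0 := by
  have h1 : 0 ≤ (Uᴴ * moment R * U).trace.re := by
    rw [moment, Matrix.mul_sum, Matrix.sum_mul, Matrix.trace_sum, Complex.re_sum]
    refine Finset.sum_nonneg fun a _ => ?_
    have e1 : (Uᴴ * (R a * (R a)ᴴ - (R a)ᴴ * R a) * U).trace =
        (((1 - U * Uᴴ) * ((R a)ᴴ * U))ᴴ * ((1 - U * Uᴴ) * ((R a)ᴴ * U))).trace := by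
      have hP : (1 - U * Uᴴ) * (1 - U * Uᴴ) = 1 - U * Uᴴ := by
        rw [Matrix.mul_sub, Matrix.mul_one, Matrix.sub_mul, Matrix.one_mul, Matrix.mul_assoc,
          ← Matrix.mul_assoc Uᴴ, hU, Matrix.one_mul, sub_self, sub_zero]
      have hPh : (1 - U * Uᴴ)ᴴ = 1 - U * Uᴴ := by
        simp
      have e2 : (Uᴴ * ((R a)ᴴ * (R a * U))).trace =
          (Uᴴ * (R a * (U * (Uᴴ * ((R a)ᴴ * U))))).trace := by
        rw [hR a, ← Matrix.mul_assoc (R a)ᴴ, ← Matrix.mul_assoc Uᴴ,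
          Matrix.trace_mul_comm]
        simp only [Matrix.mul_assoc]
      rw [Matrix.conjTranspose_mul, hPh, Matrix.mul_assoc ((R a)ᴴ * U)ᴴ,
        ← Matrix.mul_assoc (1 - U * Uᴴ), hP]
      simp only [Matrix.mul_sub, Matrix.sub_mul, Matrix.trace_sub, Matrix.conjTranspose_mul,
        Matrix.conjTranspose_conjTranspose, Matrix.mul_assoc, Matrix.one_mul, e2]
    rw [e1]
    exact (Complex.le_def.1 (Matrix.posSemidef_conjTranspose_mul_self _).trace_nonneg).1
  have h2 : moment R = - Matrix.diagonal fun i => (α i : ℂ) := eq_neg_of_add_eq_zero_left h0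
  have hsq : ∀ i k, (star (U i k) * (α i : ℂ) * U i k).re = α i * ‖U i k‖ ^ 2 := fun i k => by
    rw [← Complex.normSq_eq_norm_sq, mul_right_comm, ← starRingEnd_apply,
      ← Complex.normSq_eq_conj_mul_self, ← Complex.ofReal_mul, Complex.ofReal_re, mul_comm]
  have h3 : (Uᴴ * moment R * U).trace.re = -∑ k, ∑ i, α i * ‖U i k‖ ^ 2 := by
    rw [h2, Matrix.mul_neg, Matrix.neg_mul, Matrix.trace_neg, Complex.neg_re, Matrix.trace,
      Complex.re_sum]
    congr 1
    refine Finset.sum_congr rfl fun k _ => ?_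
    rw [Matrix.diag_apply, Matrix.mul_apply, Complex.re_sum]
    refine Finset.sum_congr rfl fun i _ => ?_
    rw [Matrix.mul_diagonal, Matrix.conjTranspose_apply, hsq]
  have h4 : ∀ k, ∑ i, ‖U i k‖ ^ 2 = 1 := fun k => by
    have h := congrArg Complex.re (congrFun (congrFun hU k) k)
    rw [Matrix.mul_apply, Matrix.one_apply_eq, Complex.one_re, Complex.re_sum] at h
    rw [← h]
    refine Finset.sum_congr rfl fun i _ => ?_
    rw [Matrix.conjTranspose_apply, ← starRingEnd_apply, ← Complex.normSq_eq_conj_mul_self,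
      Complex.ofReal_re, Complex.normSq_eq_norm_sq]
  have h5 : ∑ k, β k ≤ ∑ k, ∑ i, α i * ‖U i k‖ ^ 2 := by
    refine Finset.sum_le_sum fun k _ => ?_
    rw [← mul_one (β k), ← h4 k, Finset.mul_sum]
    refine Finset.sum_le_sum fun i _ => ?_
    by_cases h : U i k = 0
    · simp [h]
    · exact mul_le_mul_of_nonneg_right (hβ i k h) (sq_nonneg _)
  linarith

omit [DecidableEq ι] in
theorem frob_le_two_mul (X Y : Matrix ι ι ℂ) : frob X ≤ 2 * frob (X + Y) + 2 * frob Y := by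
  simp only [frob, Finset.mul_sum, ← Finset.sum_add_distrib]
  refine Finset.sum_le_sum fun i _ => Finset.sum_le_sum fun j _ => ?_
  have h : ‖X i j‖ ≤ ‖(X + Y) i j‖ + ‖Y i j‖ := by
    have := norm_sub_le ((X + Y) i j) (Y i j)
    rwa [Matrix.add_apply, add_sub_cancel_right] at this
  have h1 := norm_nonneg (X i j)
  nlinarith [sq_nonneg (‖(X + Y) i j‖ - ‖Y i j‖)]

theorem frob_diagonal (m : ι → ℝ) : frob (Matrix.diagonal fun i => (m i : ℂ)) = ∑ i, m i ^ 2 := by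
  refine Finset.sum_congr rfl fun i _ => ?_
  rw [Finset.sum_eq_single i]
  · simp
  · intro j _ hj
    simp [Matrix.diagonal_apply_ne _ hj.symm]
  · simp

/-- A minimizer has zero residual if the residuals of nearby targets are small enough. -/
theorem residual_eq_zero_of_perturbation {v : ι → V} {s t : A → V} {R : A → Matrix ι ι ℂ}
    {α w : ι → ℝ} (C : ℝ)
    (hmin : ∀ R', IsRep v s t R' → frob (momentResidual α R) ≤ frob (momentResidual α R'))
    (h : ∀ ε : ℝ, 0 < ε → ε ≤ 1 → ∃ R', IsRep v s t R' ∧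
      frob (momentResidual (fun i => α i + ε * w i) R') ≤ ε ^ 2 * C) :
    momentResidual α R = 0 := by
  refine eq_zero_of_frob_eq_zero (le_antisymm ?_ (frob_nonneg _))
  set D := 2 * C + 2 * ∑ i, w i ^ 2 with hD
  have key : ∀ ε : ℝ, 0 < ε → ε ≤ 1 → frob (momentResidual α R) ≤ ε * |D| := fun ε h0 h1 => by
    obtain ⟨R', hR', hle⟩ := h ε h0 h1
    have e : momentResidual (fun i => α i + ε * w i) R' = momentResidual α R' +
        Matrix.diagonal fun i => ((ε * w i : ℝ) : ℂ) := by
      rw [momentResidual, momentResidual, add_assoc, Matrix.diagonal_add]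
      simp
    have e2 : ∑ i, (ε * w i) ^ 2 = ε ^ 2 * ∑ i, w i ^ 2 := by
      rw [Finset.mul_sum]
      exact Finset.sum_congr rfl fun i _ => mul_pow _ _ _
    have h2 := frob_le_two_mul (momentResidual α R') (Matrix.diagonal fun i => ((ε * w i : ℝ) : ℂ))
    rw [← e, frob_diagonal, e2] at h2
    have h3 := hmin R' hR'
    calc frob (momentResidual α R) ≤ ε ^ 2 * D := by rw [hD]; linarith
      _ ≤ ε ^ 2 * |D| := mul_le_mul_of_nonneg_left (le_abs_self D) (sq_nonneg ε)
      _ ≤ ε * |D| := mul_le_mul_of_nonneg_right (by nlinarith) (abs_nonneg D)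
  by_contra! hpos
  have hD1 : 0 < |D| + frob (momentResidual α R) := by positivity
  have := key (frob (momentResidual α R) / (2 * (|D| + frob (momentResidual α R))))
    (by positivity) (by rw [div_le_one (by positivity)]; linarith [abs_nonneg D])
  rw [div_mul_eq_mul_div, le_div_iff₀ (by positivity)] at this
  nlinarith [abs_nonneg D]

theorem frob_residual_le {R : A → Matrix ι ι ℂ} {α m : ι → ℝ} {c : ℝ}
    (hM : momentResidual α R = Matrix.diagonal fun i => (m i : ℂ))
    (hRm : ∀ a i j, R a i j ≠ 0 → m i = m j)
    (h1 : |∑ i, α i| ≤ c) (h2 : ∑ i with 0 < m i, α i ≤ c) :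
    frob (momentResidual α R) ≤ (3 * c) ^ 2 := by
  have e1 : ∑ i, α i = ∑ i, m i := by
    simpa using sum_mul_eq_of_residual (f := fun _ => 1) hM fun _ _ _ _ => rfl
  have e2 : ∑ i with 0 < m i, α i = ∑ i with 0 < m i, m i := by
    have := sum_mul_eq_of_residual (f := fun i => if 0 < m i then 1 else 0) hM
      fun a i j h => by simp only [hRm a i j h]
    simpa [Finset.sum_filter] using this
  have e3 : ∑ i, |m i| = 2 * ∑ i with 0 < m i, m i - ∑ i, m i := by
    rw [Finset.sum_filter, Finset.mul_sum, ← Finset.sum_sub_distrib]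
    refine Finset.sum_congr rfl fun i _ => ?_
    split_ifs with h
    · rw [abs_of_pos h]; ring
    · rw [abs_of_nonpos (not_lt.1 h)]; ring
  have h3 : ∑ i, |m i| ≤ 3 * c := by
    rw [e3, ← e2, ← e1]
    linarith [neg_abs_le (∑ i, α i)]
  rw [hM, frob_diagonal]
  refine le_trans ?_ (pow_le_pow_left₀ (Finset.sum_nonneg fun i _ => abs_nonneg (m i)) h3 2)
  simp only [← sq_abs (m _)]
  exact Finset.sum_sq_le_sq_sum_of_nonneg fun i _ => abs_nonneg _

/-- The vertices over a source of the quiver inject into those over its only neighbour. -/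
theorem card_le_of_source {v : ι → V} {s t : A → V} {R : A → Matrix ι ι ℂ} {α m : ι → ℝ}
    [DecidableEq V] (P : ι → Prop) [DecidablePred P]
    (hR : IsRep v s t R) (hM : momentResidual α R = Matrix.diagonal fun i => (m i : ℂ))
    (hP : ∀ a i j, R a i j ≠ 0 → (P i ↔ P j)) {x : V} {b : A} (hb : ∀ a, s a = x → a = b)
    (hx : ∀ a, t a ≠ x) (hne : ∀ j, v j = x → P j → α j ≠ m j) :
    Fintype.card {j // v j = x ∧ P j} ≤ Fintype.card {i // v i = t b ∧ P i} := by
  let B : Matrix {i // v i = t b ∧ P i} {j // v j = x ∧ P j} ℂ := (R b).submatrix (↑) (↑)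
  have hB : Bᴴ * B = Matrix.diagonal fun j : {j // v j = x ∧ P j} => ((α j - m j : ℝ) : ℂ) := by
    ext j k
    have e1 : moment R j k = - ((R b)ᴴ * R b) j k := by
      rw [moment, Matrix.sum_apply, Finset.sum_eq_single b]
      · rw [Matrix.sub_apply, Matrix.mul_apply, Finset.sum_eq_zero, zero_sub]
        intro l _
        by_cases h : R b j l = 0
        · simp [h]
        · exact absurd ((hR b j l h).1.symm.trans j.2.1) (hx b)
      · intro a _ ha
        rw [Matrix.sub_apply, Matrix.mul_apply, Matrix.mul_apply, Finset.sum_eq_zero,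
          Finset.sum_eq_zero, sub_zero]
        · intro l _
          by_cases h : R a l k = 0
          · simp [h]
          · exact absurd (hb a ((hR a l k h).2.symm.trans k.2.1)) ha
        · intro l _
          by_cases h : R a j l = 0
          · simp [h]
          · exact absurd ((hR a j l h).1.symm.trans j.2.1) (hx a)
      · simp
    have e2 : ((R b)ᴴ * R b) j k = (Bᴴ * B) j k := by
      rw [Matrix.mul_apply, Matrix.mul_apply]
      refine (Finset.sum_filter_of_ne (p := fun i => v i = t b ∧ P i) fun i _ h => ?_).symm.trans
        (Finset.sum_subtype _ (by simp) _)
      have h1 := right_ne_zero_of_mul h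
      exact ⟨(hR b i k h1).1, (hP b i k h1).2 k.2.2⟩
    rw [← e2, ← neg_neg (((R b)ᴴ * R b) j k), ← e1]
    have e3 := congrFun (congrFun hM j) k
    rw [momentResidual, Matrix.add_apply] at e3
    rw [eq_sub_of_add_eq e3]
    by_cases hjk : j = k
    · subst hjk
      simp
    · rw [Matrix.diagonal_apply_ne _ hjk, Matrix.diagonal_apply_ne, Matrix.diagonal_apply_ne,
        sub_zero, neg_zero]
      all_goals exact fun h => hjk (Subtype.ext h)
  have h1 : IsUnit (Bᴴ * B) := by
    rw [hB, Matrix.isUnit_diagonal, Pi.isUnit_iff]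
    intro j
    rw [isUnit_iff_ne_zero, Complex.ofReal_ne_zero, sub_ne_zero]
    exact hne j j.2.1 j.2.2
  rw [← Matrix.rank_of_isUnit _ h1]
  exact (Matrix.rank_mul_le_right _ _).trans B.rank_le_card_height

theorem card_le_of_sink {v : ι → V} {s t : A → V} {R : A → Matrix ι ι ℂ} {α m : ι → ℝ}
    [DecidableEq V] (P : ι → Prop) [DecidablePred P]
    (hR : IsRep v s t R) (hM : momentResidual α R = Matrix.diagonal fun i => (m i : ℂ))
    (hP : ∀ a i j, R a i j ≠ 0 → (P i ↔ P j)) {x : V} {b : A} (hb : ∀ a, t a = x → a = b)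
    (hx : ∀ a, s a ≠ x) (hne : ∀ j, v j = x → P j → α j ≠ m j) :
    Fintype.card {j // v j = x ∧ P j} ≤ Fintype.card {i // v i = s b ∧ P i} := by
  have hstar : ∀ a i j, (R a)ᴴ i j ≠ 0 → R a j i ≠ 0 := fun a i j h h0 => h (by simp [h0])
  refine card_le_of_source (v := v) (s := t) (t := s) (R := fun a => (R a)ᴴ) (α := fun i => -α i)
    (m := fun i => -m i) P (fun a i j h => (hR a j i (hstar a i j h)).symm) ?_
    (fun a i j h => (hP a j i (hstar a i j h)).symm) hb hx
    fun j h1 h2 h3 => hne j h1 h2 (neg_injective h3)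
  have e : moment (fun a => (R a)ᴴ) = -moment R := by
    simp [moment]
  have e2 : ∀ f : ι → ℝ, (Matrix.diagonal fun i => ((-f i : ℝ) : ℂ)) =
      -Matrix.diagonal fun i => (f i : ℂ) := fun f => by
    rw [Matrix.diagonal_neg]
    simp
  rw [momentResidual, e, e2, e2, ← hM, momentResidual, neg_add]

end Estimates

section Sigma

variable {V A : Type} [DecidableEq V] {src tgt : A → V} {n k : V → ℕ}

/-- A block matrix with a single possibly nonzero block. -/
def blockSingle (x y : V) (X : Matrix (Fin (n x)) (Fin (k y)) ℂ) :
    Matrix (Σ z, Fin (n z)) (Σ z, Fin (k z)) ℂ :=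
  Matrix.of fun i j => if h : x = i.1 ∧ y = j.1 then
    X (finCongr (congrArg n h.1.symm) i.2) (finCongr (congrArg k h.2.symm) j.2) else 0

theorem blockSingle_apply (x y : V) (X : Matrix (Fin (n x)) (Fin (k y)) ℂ) (i : Fin (n x))
    (j : Fin (k y)) : blockSingle x y X ⟨x, i⟩ ⟨y, j⟩ = X i j :=
  dif_pos ⟨rfl, rfl⟩

theorem blockSingle_ne {x y : V} {X : Matrix (Fin (n x)) (Fin (k y)) ℂ} {i : Σ z, Fin (n z)}
    {j : Σ z, Fin (k z)} (h : blockSingle x y X i j ≠ 0) : i.1 = x ∧ j.1 = y := by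
  by_contra h2
  exact h (dif_neg fun h3 => h2 ⟨h3.1.symm, h3.2.symm⟩)

theorem eq_blockSingle {x y : V} {Y : Matrix (Σ z, Fin (n z)) (Σ z, Fin (k z)) ℂ}
    (h : ∀ i j, Y i j ≠ 0 → i.1 = x ∧ j.1 = y) :
    Y = blockSingle x y (Matrix.of fun i j => Y ⟨x, i⟩ ⟨y, j⟩) := by
  ext i j
  by_cases h1 : i.1 = x ∧ j.1 = y
  · obtain ⟨i1, i⟩ := i
    obtain ⟨j1, j⟩ := j
    obtain ⟨rfl, rfl⟩ := h1
    rw [blockSingle_apply, Matrix.of_apply]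
  · rw [not_imp_comm.1 (h i j) h1, not_imp_comm.1 blockSingle_ne h1]

omit [DecidableEq V] in
theorem sum_sigma_single [Fintype V] {f : (Σ z, Fin (n z)) → ℂ} (x : V)
    (hf : ∀ i, i.1 ≠ x → f i = 0) : ∑ i, f i = ∑ i, f ⟨x, i⟩ := by
  rw [Fintype.sum_sigma]
  exact Finset.sum_eq_single x (fun y _ hy => Finset.sum_eq_zero fun i _ => hf ⟨y, i⟩ hy) (by simp)

theorem blockDiagonal_mul_blockSingle [Fintype V] {l : V → ℕ}
    (T : ∀ x, Matrix (Fin (l x)) (Fin (n x)) ℂ) (x y : V) (X : Matrix (Fin (n x)) (Fin (k y)) ℂ) :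
    Matrix.blockDiagonal' T * blockSingle x y X = blockSingle x y (T x * X) := by
  ext ⟨x', i⟩ ⟨y', j⟩
  rw [Matrix.mul_apply, sum_sigma_single x fun l hl => by
    rw [not_imp_comm.1 blockSingle_ne fun h => hl h.1, mul_zero]]
  by_cases h : x' = x ∧ y' = y
  · obtain ⟨rfl, rfl⟩ := h
    simp [blockSingle_apply, Matrix.blockDiagonal'_apply_eq, Matrix.mul_apply]
  · rw [not_imp_comm.1 (blockSingle_ne (X := T x * X)) h]
    refine Finset.sum_eq_zero fun l _ => ?_
    by_cases hx : x' = x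
    · rw [not_imp_comm.1 (blockSingle_ne (X := X)) fun h' => h ⟨hx, h'.2⟩, mul_zero]
    · rw [Matrix.blockDiagonal'_apply_ne _ _ _ hx, zero_mul]

theorem blockSingle_mul_blockDiagonal [Fintype V] {l : V → ℕ}
    (T : ∀ x, Matrix (Fin (k x)) (Fin (l x)) ℂ) (x y : V) (X : Matrix (Fin (n x)) (Fin (k y)) ℂ) :
    blockSingle x y X * Matrix.blockDiagonal' T = blockSingle x y (X * T y) := by
  ext ⟨x', i⟩ ⟨y', j⟩
  rw [Matrix.mul_apply, sum_sigma_single y fun l hl => by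
    rw [not_imp_comm.1 blockSingle_ne fun h => hl h.2, zero_mul]]
  by_cases h : x' = x ∧ y' = y
  · obtain ⟨rfl, rfl⟩ := h
    simp [blockSingle_apply, Matrix.blockDiagonal'_apply_eq, Matrix.mul_apply]
  · rw [not_imp_comm.1 (blockSingle_ne (X := X * T y)) h]
    refine Finset.sum_eq_zero fun l _ => ?_
    by_cases hy : y = y'
    · rw [not_imp_comm.1 (blockSingle_ne (X := X)) fun h' => h ⟨h'.1, hy.symm⟩, zero_mul]
    · rw [Matrix.blockDiagonal'_apply_ne _ _ _ hy, mul_zero]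

/-- The family of blocks of a representation. -/
def blocks (src tgt : A → V) (R : A → Matrix (Σ z, Fin (n z)) (Σ z, Fin (n z)) ℂ) (a : A) :
    Matrix (Fin (n (tgt a))) (Fin (n (src a))) ℂ :=
  Matrix.of fun i j => R a ⟨tgt a, i⟩ ⟨src a, j⟩

/-- The block matrices of a family of maps. -/
def unblocks (r : ∀ a : A, Matrix (Fin (n (tgt a))) (Fin (n (src a))) ℂ) (a : A) :
    Matrix (Σ z, Fin (n z)) (Σ z, Fin (n z)) ℂ :=
  blockSingle (tgt a) (src a) (r a)

theorem isRep_unblocks (r : ∀ a : A, Matrix (Fin (n (tgt a))) (Fin (n (src a))) ℂ) :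
    IsRep Sigma.fst src tgt (unblocks r) := fun _ _ _ => blockSingle_ne

theorem unblocks_blocks {R : A → Matrix (Σ z, Fin (n z)) (Σ z, Fin (n z)) ℂ}
    (hR : IsRep Sigma.fst src tgt R) : unblocks (blocks src tgt R) = R :=
  funext fun a => (eq_blockSingle (hR a)).symm

theorem continuous_unblocks : Continuous
    (unblocks : (∀ a : A, Matrix (Fin (n (tgt a))) (Fin (n (src a))) ℂ) → _) := by
  refine continuous_pi fun a => continuous_matrix fun i j => ?_
  by_cases h : tgt a = i.1 ∧ src a = j.1
  · simp only [unblocks, blockSingle, Matrix.of_apply, dif_pos h]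
    exact (continuous_apply a).matrix_elem _ _
  · simp only [unblocks, blockSingle, Matrix.of_apply, dif_neg h]
    exact continuous_const

theorem momentMap_apply [Fintype V] [Fintype A]
    (r : ∀ a : A, Matrix (Fin (n (tgt a))) (Fin (n (src a))) ℂ) (x : V) (i j : Fin (n x)) :
    momentMap src tgt n r x i j = moment (unblocks r) ⟨x, i⟩ ⟨x, j⟩ := by
  have e1 : ∀ a, (unblocks r a * (unblocks r a)ᴴ) ⟨x, i⟩ ⟨x, j⟩ =
      (if h : tgt a = x then Matrix.reindex (finCongr (congrArg n h)) (finCongr (congrArg n h))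
        (r a * (r a)ᴴ) else 0) i j := fun a => by
    rw [Matrix.mul_apply]
    split_ifs with h
    · subst h
      rw [sum_sigma_single (src a)]
      · simp [unblocks, blockSingle_apply, Matrix.mul_apply]
      · intro l hl
        rw [show unblocks r a ⟨tgt a, i⟩ l = 0 from
          not_imp_comm.1 blockSingle_ne fun h => hl h.2, zero_mul]
    · refine Finset.sum_eq_zero fun l _ => ?_
      rw [show unblocks r a ⟨x, i⟩ l = 0 from
          not_imp_comm.1 blockSingle_ne fun h' => h h'.1.symm, zero_mul]
  have e2 : ∀ a, ((unblocks r a)ᴴ * unblocks r a) ⟨x, i⟩ ⟨x, j⟩ =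
      (if h : src a = x then Matrix.reindex (finCongr (congrArg n h)) (finCongr (congrArg n h))
        ((r a)ᴴ * r a) else 0) i j := fun a => by
    rw [Matrix.mul_apply]
    split_ifs with h
    · subst h
      rw [sum_sigma_single (tgt a)]
      · simp [unblocks, blockSingle_apply, Matrix.mul_apply]
      · intro l hl
        rw [show unblocks r a l ⟨src a, j⟩ = 0 from
          not_imp_comm.1 blockSingle_ne fun h => hl h.1, mul_zero]
    · refine Finset.sum_eq_zero fun l _ => ?_
      rw [show unblocks r a l ⟨x, j⟩ = 0 from
          not_imp_comm.1 blockSingle_ne fun h' => h h'.2.symm, mul_zero]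
  rw [momentMap, moment, Finset.sum_sub_distrib, Matrix.sub_apply, Matrix.sub_apply,
    Matrix.sum_apply, Matrix.sum_apply, Matrix.sum_apply, Matrix.sum_apply]
  simp only [e1, e2]

theorem momentMap_eq_neg_diagonal_iff [Fintype V] [Fintype A]
    (r : ∀ a : A, Matrix (Fin (n (tgt a))) (Fin (n (src a))) ℂ) (α : ∀ x, Fin (n x) → ℝ) :
    (∀ x, momentMap src tgt n r x = -Matrix.diagonal fun j => (α x j : ℂ)) ↔
      momentResidual (fun i => α i.1 i.2) (unblocks r) = 0 := by
  constructor
  · intro h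
    ext ⟨x, i⟩ ⟨y, j⟩
    by_cases hxy : x = y
    · subst hxy
      have h1 := congrFun (congrFun (h x) i) j
      rw [momentMap_apply] at h1
      rw [momentResidual, Matrix.add_apply, h1, Matrix.neg_apply, Matrix.zero_apply]
      by_cases hij : i = j
      · subst hij
        simp
      · rw [Matrix.diagonal_apply_ne _ hij, Matrix.diagonal_apply_ne, neg_zero, add_zero]
        exact fun h => hij (by simpa using h)
    · exact not_imp_comm.1 (momentResidual_block (isRep_unblocks r) _) hxy
  · intro h x
    ext i j
    have h1 := congrFun (congrFun h ⟨x, i⟩) ⟨x, j⟩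
    rw [momentResidual, Matrix.add_apply, Matrix.zero_apply] at h1
    rw [momentMap_apply, eq_neg_of_add_eq_zero_left h1, Matrix.neg_apply]
    by_cases hij : i = j
    · subst hij
      simp
    · rw [Matrix.diagonal_apply_ne _ hij, Matrix.diagonal_apply_ne]
      exact fun h => hij (by simpa using h)

theorem sum_nonpos_of_isQIntersecting [Fintype V] [Fintype A]
    {r : ∀ a : A, Matrix (Fin (n (tgt a))) (Fin (n (src a))) ℂ} {α : ∀ x, Fin (n x) → ℝ}
    (hα : ∀ x, Antitone (α x)) (h0 : momentResidual (fun i => α i.1 i.2) (unblocks r) = 0)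
    {K : ∀ x : V, Finset (Fin (n x))} (hK : IsQIntersecting src tgt n K) :
    ∑ x, ∑ j ∈ K x, α x j ≤ 0 := by
  obtain ⟨T, hT1, hT2, hT3⟩ := exists_orthonormal_frames (hK fun a => (r a).mulVecLin)
  have hu : ∀ a, unblocks r a * Matrix.blockDiagonal' T =
      blockSingle (tgt a) (src a) (r a * T (src a)) := fun a =>
    blockSingle_mul_blockDiagonal _ _ _ _
  have := sum_nonpos_of_frame (R := unblocks r) (α := fun i => α i.1 i.2)
    (U := Matrix.blockDiagonal' T) (β := fun k => α k.1 ((K k.1).orderIsoOfFin rfl k.2)) h0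
    ?_ ?_ ?_
  · rw [Fintype.sum_sigma] at this
    refine le_of_eq_of_le (Finset.sum_congr rfl fun x _ => ?_) this
    rw [← Finset.sum_coe_sort]
    exact (((K x).orderIsoOfFin rfl).toEquiv.sum_comp fun j : K x => α x j).symm
  · rw [Matrix.blockDiagonal'_conjTranspose, ← Matrix.blockDiagonal'_mul]
    simp only [hT1]
    exact Matrix.blockDiagonal'_one
  · intro a
    rw [hu, Matrix.blockDiagonal'_conjTranspose, blockDiagonal_mul_blockSingle,
      blockDiagonal_mul_blockSingle, ← hT3]
  · rintro ⟨x, i⟩ ⟨y, k⟩ h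
    by_cases hxy : x = y
    · subst hxy
      rw [Matrix.blockDiagonal'_apply_eq] at h
      exact hα x (not_lt.1 fun h1 => h (hT2 x i k h1))
    · exact absurd (Matrix.blockDiagonal'_apply_ne _ _ _ hxy) h

/-- The coordinates on which the residual of a minimizer is positive form an intersecting
family. -/
theorem isQIntersecting_of_isMin [Fintype V] [Fintype A]
    {R : A → Matrix (Σ z, Fin (n z)) (Σ z, Fin (n z)) ℂ} {α m : (Σ z, Fin (n z)) → ℝ}
    (hR : IsRep Sigma.fst src tgt R)
    (hM : momentResidual α R = Matrix.diagonal fun i => (m i : ℂ))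
    (hmin : ∀ R', IsRep Sigma.fst src tgt R' →
      frob (momentResidual α R) ≤ frob (momentResidual α R'))
    (hα : ∀ x, StrictAnti fun i => α ⟨x, i⟩) (hRm : ∀ a i j, R a i j ≠ 0 → m i = m j) :
    IsQIntersecting src tgt n fun x => Finset.univ.filter fun i => 0 < m ⟨x, i⟩ := by
  set K : ∀ x, Finset (Fin (n x)) := fun x => Finset.univ.filter fun i => 0 < m ⟨x, i⟩ with hK
  have hinj : ∀ i j : Σ z, Fin (n z), i.1 = j.1 → α i = α j → i = j := by
    rintro ⟨x, i⟩ ⟨y, j⟩ rfl h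
    rw [(hα x).injective h]
  refine isQIntersecting_of_forall_hasFrame (hasFrame_of_eventually (R₀ := blocks src tgt R) ?_)
  have hev := eventually_exists_conj_block hR hM hmin hinj hRm
  rw [← unblocks_blocks hR] at hev
  filter_upwards [continuous_unblocks.continuousAt.eventually hev] with r hr
  obtain ⟨ξ, hξ, hN⟩ := hr (isRep_unblocks r)
  have hKm : ∀ x (j : Fin (K x).card), 0 < m ⟨x, ((K x).orderIsoOfFin rfl j : Fin (n x))⟩ :=
    fun x j => (Finset.mem_filter.1 ((K x).orderIsoOfFin rfl j).2).2
  have hξ2 : ξ * ξ = 0 := by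
    ext i j
    refine Finset.sum_eq_zero fun l _ => ?_
    by_contra h
    exact (hξ i l (left_ne_zero_of_mul h)).2.2.2.not_ge (hξ l j (right_ne_zero_of_mul h)).2.2.1
  have h12 : (1 - ξ) * (1 + ξ) = 1 := by
    rw [sub_mul, mul_add, mul_add, hξ2]
    simp
  have h21 : (1 + ξ) * (1 - ξ) = 1 := mul_eq_one_comm.1 h12
  have hb1 : ∀ i j : Σ z, Fin (n z), (1 + ξ) i j ≠ 0 → i.1 = j.1 := fun i j h => by
    have := block_one_add_smul (v := Sigma.fst) (fun i j h => (hξ i j h).1) 1 (i := i) (j := j)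
    rw [one_smul] at this
    exact this h
  have hb2 : ∀ i j : Σ z, Fin (n z), (1 - ξ) i j ≠ 0 → i.1 = j.1 := fun i j h => by
    have := block_one_add_smul (v := Sigma.fst) (fun i j h => (hξ i j h).1) (-1) (i := i) (j := j)
    rw [neg_one_smul, ← sub_eq_add_neg] at this
    exact this h
  let e : ∀ x, Fin (K x).card → Σ z, Fin (n z) := fun x j =>
    ⟨x, ((K x).orderIsoOfFin rfl j : Fin (n x))⟩
  have hRT : ∀ a i j, (r a * Matrix.of fun i j => (1 + ξ) ⟨src a, i⟩ (e (src a) j)) i j =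
      (unblocks r a * (1 + ξ)) ⟨tgt a, i⟩ (e (src a) j) := fun a i j => by
    rw [Matrix.mul_apply, Matrix.mul_apply, sum_sigma_single (src a) fun l hl => by
      rw [show unblocks r a _ l = 0 from not_imp_comm.1 blockSingle_ne fun h => hl h.2, zero_mul]]
    simp [unblocks, blockSingle_apply]
  have hWRT : ∀ a l j, ((Matrix.of fun j i => (1 - ξ) (e (tgt a) j) ⟨tgt a, i⟩) *
      (r a * Matrix.of fun i j => (1 + ξ) ⟨src a, i⟩ (e (src a) j))) l j =
      ((1 - ξ) * unblocks r a * (1 + ξ)) (e (tgt a) l) (e (src a) j) := fun a l j => by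
    rw [Matrix.mul_apply, Matrix.mul_assoc, Matrix.mul_apply,
      sum_sigma_single (tgt a) fun i hi => by
        rw [not_imp_comm.1 (hb2 (e (tgt a) l) i) (Ne.symm hi), zero_mul]]
    simp only [hRT, Matrix.of_apply]
  refine ⟨fun x => Matrix.of fun i j => (1 + ξ) ⟨x, i⟩ (e x j),
    fun x => Matrix.of fun j i => (1 - ξ) (e x j) ⟨x, i⟩, fun x => ?_, fun x i j hij => ?_,
    fun a => ?_⟩
  · ext j k
    have h := congrFun (congrFun h12 (e x j)) (e x k)
    rw [Matrix.mul_apply, sum_sigma_single x fun i hi => by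
      rw [not_imp_comm.1 (hb2 (e x j) i) (Ne.symm hi), zero_mul]] at h
    rw [Matrix.mul_apply]
    refine h.trans ?_
    by_cases hjk : j = k
    · rw [hjk, Matrix.one_apply_eq, Matrix.one_apply_eq]
    · rw [Matrix.one_apply_ne hjk, Matrix.one_apply_ne]
      intro h
      refine hjk (((K x).orderIsoOfFin rfl).injective (Subtype.ext ?_))
      simpa [e] using h
  · have hne : (⟨x, i⟩ : Σ z, Fin (n z)) ≠ e x j := by
      intro h
      have h' : i = ((K x).orderIsoOfFin rfl j : Fin (n x)) := by simpa [e] using h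
      exact hij.ne h'.symm
    change (1 + ξ) _ _ = 0
    rw [Matrix.add_apply, Matrix.one_apply_ne hne, zero_add]
    by_contra h
    exact (hξ _ _ h).2.1.not_gt (hα x hij)
  · ext i j
    rw [hRT]
    set N := (1 - ξ) * unblocks r a * (1 + ξ) with hNdef
    have e1 : unblocks r a * (1 + ξ) = (1 + ξ) * N := by
      rw [hNdef, ← Matrix.mul_assoc, ← Matrix.mul_assoc, h21, Matrix.one_mul]
    rw [e1, Matrix.mul_apply, sum_sigma_single (tgt a) fun l hl => by
      rw [not_imp_comm.1 (hb1 ⟨tgt a, i⟩ l) (Ne.symm hl), zero_mul]]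
    rw [Matrix.mul_apply]
    simp only [hWRT]
    rw [← Finset.sum_subset (Finset.subset_univ (K (tgt a))) fun l _ hl => ?_]
    · rw [← Finset.sum_coe_sort]
      exact (((K (tgt a)).orderIsoOfFin rfl).toEquiv.sum_comp fun l : K (tgt a) =>
        (1 + ξ) ⟨tgt a, i⟩ ⟨tgt a, l⟩ * N ⟨tgt a, l⟩ (e (src a) j)).symm
    · exact mul_eq_zero_of_right _
        (hN a _ _ (not_lt.1 fun h => hl (Finset.mem_filter.2 ⟨Finset.mem_univ _, h⟩)) (hKm _ j))

omit [DecidableEq V] in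
theorem IsQIntersecting.card_le {K : ∀ x : V, Finset (Fin (n x))}
    (hK : IsQIntersecting src tgt n K) (a : A) (ha : n (src a) = n (tgt a)) :
    (K (src a)).card ≤ (K (tgt a)).card := by
  obtain ⟨S, hS, -, hr⟩ := hK fun b => LinearMap.pi fun i =>
    if h : (i : ℕ) < n (src b) then LinearMap.proj ⟨i, h⟩ else 0
  rw [← hS, ← hS]
  refine le_of_eq_of_le (LinearEquiv.finrank_eq (Submodule.equivMapOfInjective _ ?_ _))
    (Submodule.finrank_mono (hr a))
  intro f g h
  ext i
  simpa using congrFun h (Fin.cast ha i)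

end Sigma

section Cone

theorem card_fiber {V : Type} [Fintype V] [DecidableEq V] {n : V → ℕ}
    (P : (Σ z, Fin (n z)) → Prop) [DecidablePred P] (x : V) :
    Fintype.card {j : Σ z, Fin (n z) // j.1 = x ∧ P j} =
      (Finset.univ.filter fun i : Fin (n x) => P ⟨x, i⟩).card := by
  rw [← Fintype.card_subtype]
  refine Fintype.card_congr (Equiv.symm ⟨fun i => ⟨⟨x, i.1⟩, rfl, i.2⟩,
    fun j => ⟨finCongr (congrArg n j.2.1) j.1.2, ?_⟩, fun i => rfl, ?_⟩)
  · obtain ⟨⟨y, i⟩, rfl, hi⟩ := j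
    exact hi
  · rintro ⟨⟨y, i⟩, rfl, hi⟩
    rfl

theorem card_eq_of_isMin {p q : ℕ}
    {R : Fin 5 → Matrix (Σ z, Fin (n33 p q z)) (Σ z, Fin (n33 p q z)) ℂ}
    {α m : (Σ z, Fin (n33 p q z)) → ℝ} (hR : IsRep Sigma.fst q33src q33tgt R)
    (hM : momentResidual α R = Matrix.diagonal fun i => (m i : ℂ))
    (hRm : ∀ a i j, R a i j ≠ 0 → m i = m j)
    (hpos : ∀ i, i.1 = 0 ∨ i.1 = 1 → 0 < α i) (hneg : ∀ i, i.1 = 4 ∨ i.1 = 5 → α i < 0)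
    {K : ∀ x, Finset (Fin (n33 p q x))}
    (hK : K = fun x => Finset.univ.filter fun i => 0 < m ⟨x, i⟩)
    (hQ : IsQIntersecting q33src q33tgt (n33 p q) K) :
    (K 0).card = (K 1).card ∧ (K 1).card = (K 2).card ∧
      (K 3).card = (K 4).card ∧ (K 4).card = (K 5).card := by
  have hcompl : ∀ x, (K x).card + Fintype.card {j : Σ z, Fin (n33 p q z) // j.1 = x ∧ m j ≤ 0} =
      n33 p q x := fun x => by
    rw [card_fiber, hK]
    simp only [← not_lt]
    rw [Finset.card_filter_add_card_filter_not, Finset.card_univ, Fintype.card_fin]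
  have hfib : ∀ x, Fintype.card {j : Σ z, Fin (n33 p q z) // j.1 = x ∧ 0 < m j} = (K x).card :=
    fun x => by rw [card_fiber, hK]
  have h02 : (K 0).card ≤ (K 2).card := hQ.card_le 0 rfl
  have h12 : (K 1).card ≤ (K 2).card := hQ.card_le 1 rfl
  have h34 : (K 3).card ≤ (K 4).card := hQ.card_le 3 rfl
  have h35 : (K 3).card ≤ (K 5).card := hQ.card_le 4 rfl
  have s0 := card_le_of_source (fun i => m i ≤ 0) hR hM (fun a i j h => by rw [hRm a i j h])
    (x := 0) (b := 0) (by decide) (by decide)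
    fun j h1 h2 => (h2.trans_lt (hpos j (Or.inl h1))).ne'
  have s1 := card_le_of_source (fun i => m i ≤ 0) hR hM (fun a i j h => by rw [hRm a i j h])
    (x := 1) (b := 1) (by decide) (by decide)
    fun j h1 h2 => (h2.trans_lt (hpos j (Or.inr h1))).ne'
  have s4 := card_le_of_sink (fun i => 0 < m i) hR hM (fun a i j h => by rw [hRm a i j h])
    (x := 4) (b := 3) (by decide) (by decide)
    fun j h1 h2 => ((hneg j (Or.inl h1)).trans h2).ne
  have s5 := card_le_of_sink (fun i => 0 < m i) hR hM (fun a i j h => by rw [hRm a i j h])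
    (x := 5) (b := 4) (by decide) (by decide)
    fun j h1 h2 => ((hneg j (Or.inr h1)).trans h2).ne
  rw [hfib, hfib] at s4 s5
  have s4' : (K 4).card ≤ (K 3).card := s4
  have s5' : (K 5).card ≤ (K 3).card := s5
  have c0 : _ + _ = p := hcompl 0
  have c1 : _ + _ = p := hcompl 1
  have c2 : _ + _ = p := hcompl 2
  have s0' : _ ≤ Fintype.card {j : Σ z, Fin (n33 p q z) // j.1 = 2 ∧ m j ≤ 0} := s0
  have s1' : _ ≤ Fintype.card {j : Σ z, Fin (n33 p q z) // j.1 = 2 ∧ m j ≤ 0} := s1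
  omega

theorem exists_residual_eq_zero {p q : ℕ} {a : ∀ x : Fin 6, Fin (n33 p q x) → ℝ}
    (ha : ∀ x : Fin 6, Antitone (a x)) (hsum : ∑ x, ∑ j, a x j = 0)
    (hpos : ∀ x, x = 0 ∨ x = 1 → ∀ i, 0 ≤ a x i) (hneg : ∀ x, x = 4 ∨ x = 5 → ∀ i, a x i ≤ 0)
    (hK : ∀ K, IsQIntersecting q33src q33tgt (n33 p q) K →
      (K 0).card = (K 1).card → (K 1).card = (K 2).card →
      (K 3).card = (K 4).card → (K 4).card = (K 5).card → ∑ x, ∑ j ∈ K x, a x j ≤ 0) :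
    ∃ R : Fin 5 → Matrix (Σ z, Fin (n33 p q z)) (Σ z, Fin (n33 p q z)) ℂ,
      IsRep Sigma.fst q33src q33tgt R ∧ momentResidual (fun i => a i.1 i.2) R = 0 := by
  have hd : ∀ b : Fin 5, (![0, 0, 1, 0, 1, 1] : Fin 6 → ℝ) (q33tgt b) =
      (![0, 0, 1, 0, 1, 1] : Fin 6 → ℝ) (q33src b) + 1 := fun b => by
    fin_cases b <;> simp [q33src, q33tgt]
  obtain ⟨R, hR, hmin⟩ := exists_isMin (Sigma.fst : (Σ z, Fin (n33 p q z)) → Fin 6) q33src q33tgt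
    (fun i => a i.1 i.2) _ hd
  let c : Fin 6 → ℝ := ![p, p, 0, 0, -1, -1]
  let w : (Σ z, Fin (n33 p q z)) → ℝ := fun i => c i.1 - (i.2 : ℕ)
  refine ⟨R, hR, residual_eq_zero_of_perturbation (w := w) ((3 * ∑ i, |w i|) ^ 2) hmin
    fun ε h0 h1 => ?_⟩
  obtain ⟨R', hR', hmin'⟩ := exists_isMin (Sigma.fst : (Σ z, Fin (n33 p q z)) → Fin 6)
    q33src q33tgt (fun i => a i.1 i.2 + ε * w i) _ hd
  have hα : ∀ x, StrictAnti fun i : Fin (n33 p q x) => a x i + ε * w ⟨x, i⟩ := fun x =>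
    (ha x).add_strictAnti fun i j hij => mul_lt_mul_of_pos_left
      (sub_lt_sub_left (Nat.cast_lt.2 hij) _) h0
  have hinj : ∀ i j : Σ z, Fin (n33 p q z), i.1 = j.1 →
      a i.1 i.2 + ε * w i = a j.1 j.2 + ε * w j → i = j := by
    rintro ⟨x, i⟩ ⟨y, j⟩ rfl h
    exact congrArg (Sigma.mk x) ((hα x).injective h)
  obtain ⟨m, hM, hRm⟩ := momentResidual_eq_diagonal hR' hmin' hinj
  have hQ := isQIntersecting_of_isMin hR' hM hmin' hα hRm
  have hposα : ∀ i : Σ z, Fin (n33 p q z), i.1 = 0 ∨ i.1 = 1 → 0 < a i.1 i.2 + ε * w i := by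
    rintro ⟨x, i⟩ hx
    refine add_pos_of_nonneg_of_pos (hpos x hx i) (mul_pos h0 (sub_pos.2 ?_))
    obtain rfl | rfl : x = 0 ∨ x = 1 := hx
    all_goals exact Nat.cast_lt.2 i.2
  have hnegα : ∀ i : Σ z, Fin (n33 p q z), i.1 = 4 ∨ i.1 = 5 → a i.1 i.2 + ε * w i < 0 := by
    rintro ⟨x, i⟩ hx
    refine add_neg_of_nonpos_of_neg (hneg x hx i) (mul_neg_of_pos_of_neg h0 (sub_neg.2 ?_))
    have hc : c x = -1 := by
      obtain rfl | rfl : x = 4 ∨ x = 5 := hx <;> rfl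
    exact hc.trans_lt ((neg_one_lt_zero).trans_le (Nat.cast_nonneg _))
  obtain ⟨e1, e2, e3, e4⟩ := card_eq_of_isMin hR' hM hRm hposα hnegα rfl hQ
  have hle := hK _ hQ e1 e2 e3 e4
  refine ⟨R', hR', ?_⟩
  rw [← mul_pow, mul_left_comm]
  refine frob_residual_le hM hRm ?_ ?_
  · rw [Finset.sum_add_distrib, Fintype.sum_sigma, hsum, zero_add, ← Finset.mul_sum, abs_mul,
      abs_of_pos h0]
    exact mul_le_mul_of_nonneg_left (Finset.abs_sum_le_sum_abs _ _) h0.le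
  · rw [Finset.sum_add_distrib, ← Finset.mul_sum]
    have h2 : ∑ i with 0 < m i, a i.1 i.2 ≤ 0 := by
      rw [Finset.sum_filter, Fintype.sum_sigma]
      simpa only [Finset.sum_filter] using hle
    have h3 : ∑ i with 0 < m i, w i ≤ ∑ i, |w i| :=
      (Finset.sum_le_sum fun i _ => le_abs_self (w i)).trans
        (Finset.sum_le_univ_sum_of_nonneg fun i => abs_nonneg (w i))
    linarith [mul_le_mul_of_nonneg_left h3 h0.le]

theorem fam6_apply {p q : ℕ} (K : ∀ x, Finset (Fin (n33 p q x))) :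
    fam6 p q ![K 0, K 1, K 2] ![K 3, K 4, K 5] = K := by
  funext x
  fin_cases x <;> rfl

end Cone

/-- the moment cone of `Q_{3,3}` with dimension vector `[p,p,p,q,q,q]`.
`−a` lies in the image of the moment map iff the center equation holds,
`a_1(p) ≥ 0`, `a_2(p) ≥ 0`, `a_5(1) ≤ 0`, `a_6(1) ≤ 0`, and `Σ_x Σ_{j∈K_x} a_x(j) ≤ 0`
for every family `K` in `Int(𝒜,p,q)`. -/
theorem coneQ33_description (p q : ℕ) (hp : 1 ≤ p) (hq : 1 ≤ q)
    (a : ∀ x : Fin 6, Fin (n33 p q x) → ℝ) (ha : ∀ x : Fin 6, Antitone (a x)) :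
    (∃ r : ∀ ar : Fin 5, Matrix (Fin (n33 p q (q33tgt ar))) (Fin (n33 p q (q33src ar))) ℂ,
        ∀ x : Fin 6, momentMap q33src q33tgt (n33 p q) r x =
          -(Matrix.diagonal fun j : Fin (n33 p q x) => ((a x j : ℝ) : ℂ))) ↔
      ((∑ x : Fin 6, ∑ j : Fin (n33 p q x), a x j) = 0 ∧
       0 ≤ a ⟨0, by omega⟩ ⟨p - 1, by show p - 1 < p; omega⟩ ∧
       0 ≤ a ⟨1, by omega⟩ ⟨p - 1, by show p - 1 < p; omega⟩ ∧
       a ⟨4, by omega⟩ ⟨0, by show 0 < q; omega⟩ ≤ 0 ∧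
       a ⟨5, by omega⟩ ⟨0, by show 0 < q; omega⟩ ≤ 0 ∧
       (∀ (K : Fin 3 → Finset (Fin p)) (L : Fin 3 → Finset (Fin q)),
          IsQIntersecting q33src q33tgt (n33 p q) (fam6 p q K L) →
          (K 0).card = (K 1).card → (K 1).card = (K 2).card →
          (L 0).card = (L 1).card → (L 1).card = (L 2).card →
          (∑ x : Fin 6, ∑ j ∈ fam6 p q K L x, a x j) ≤ 0)) := by
  simp only [momentMap_eq_neg_diagonal_iff]
  constructor
  · rintro ⟨r, hr⟩
    have hrep := isRep_unblocks r
    refine ⟨?_, ?_, ?_, ?_, ?_, fun K L hK _ _ _ _ => sum_nonpos_of_isQIntersecting ha hr hK⟩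
    · have := sum_mul_eq_of_residual (m := fun _ => 0) (f := fun _ => 1)
        (hr.trans (by simp)) fun _ _ _ _ => rfl
      simpa [Fintype.sum_sigma] using this
    · exact nonneg_of_source hrep hr (i := ⟨⟨0, _⟩, ⟨p - 1, _⟩⟩)
        (by change ∀ b, q33tgt b ≠ 0; decide)
    · exact nonneg_of_source hrep hr (i := ⟨⟨1, _⟩, ⟨p - 1, _⟩⟩)
        (by change ∀ b, q33tgt b ≠ 1; decide)
    · exact nonpos_of_sink hrep hr (i := ⟨⟨4, _⟩, ⟨0, _⟩⟩)
        (by change ∀ b, q33src b ≠ 4; decide)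
    · exact nonpos_of_sink hrep hr (i := ⟨⟨5, _⟩, ⟨0, _⟩⟩)
        (by change ∀ b, q33src b ≠ 5; decide)
  · rintro ⟨hsum, h0, h1, h4, h5, hK⟩
    have hpos : ∀ x, x = 0 ∨ x = 1 → ∀ i, 0 ≤ a x i := by
      rintro x (rfl | rfl) i
      · exact h0.trans (ha _ (Nat.le_sub_one_of_lt i.2))
      · exact h1.trans (ha _ (Nat.le_sub_one_of_lt i.2))
    have hneg : ∀ x, x = 4 ∨ x = 5 → ∀ i, a x i ≤ 0 := by
      rintro x (rfl | rfl) i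
      · exact (ha _ (Nat.zero_le _)).trans h4
      · exact (ha _ (Nat.zero_le _)).trans h5
    obtain ⟨R, hR, hz⟩ := exists_residual_eq_zero ha hsum hpos hneg fun K hQ e1 e2 e3 e4 => by
      have := hK ![K 0, K 1, K 2] ![K 3, K 4, K 5]
      rw [fam6_apply] at this
      exact this hQ e1 e2 e3 e4
    exact ⟨blocks q33src q33tgt R, by rwa [unblocks_blocks hR]⟩
end

section
/- Let p, q ≥ 1. If K = [K_1, K_2, K_3, K_4, K_5, K_6] belongs to Int(𝒜,p,q), then for any permutations σ of {1,2,3} and τ of {4,5,6}, the family [K_{σ(1)}, K_{σ(2)}, K_{σ(3)}, K_{τ(4)}, K_{τ(5)}, K_{τ(6)}] also belongs to Int(𝒜,p,q); the same holds for Int_0(𝒜,p,q). -/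
open Matrix

section LimitsOfSubspaces

open Filter Topology

variable {ι : Type*}

/-- The subspaces `S t` tend to `S'` along `l`, witnessed by a convergent family of projections. -/
def SubspaceTendsto {n : ℕ} (S : ι → Submodule ℂ (Fin n → ℂ)) (l : Filter ι)
    (S' : Submodule ℂ (Fin n → ℂ)) : Prop :=
  ∃ (P : ι → (Fin n → ℂ) →L[ℂ] (Fin n → ℂ)) (P' : (Fin n → ℂ) →L[ℂ] (Fin n → ℂ)),
    (∀ t, LinearMap.IsProj (S t) (P t)) ∧ LinearMap.IsProj S' P' ∧ Tendsto P l (𝓝 P')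

theorem exists_isProj_norm_le (n : ℕ) :
    ∃ C : ℝ, ∀ S : Submodule ℂ (Fin n → ℂ),
      ∃ P : (Fin n → ℂ) →L[ℂ] (Fin n → ℂ), LinearMap.IsProj S P ∧ ‖P‖ ≤ C := by
  let e : EuclideanSpace ℂ (Fin n) ≃L[ℂ] (Fin n → ℂ) := EuclideanSpace.equiv (Fin n) ℂ
  refine ⟨‖(e : EuclideanSpace ℂ (Fin n) →L[ℂ] (Fin n → ℂ))‖ *
    (1 * ‖(e.symm : (Fin n → ℂ) →L[ℂ] EuclideanSpace ℂ (Fin n))‖), fun S => ?_⟩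
  let S₁ : Submodule ℂ (EuclideanSpace ℂ (Fin n)) := S.comap e.toLinearEquiv.toLinearMap
  refine ⟨(e : EuclideanSpace ℂ (Fin n) →L[ℂ] (Fin n → ℂ)) ∘L S₁.starProjection ∘L
    (e.symm : (Fin n → ℂ) →L[ℂ] EuclideanSpace ℂ (Fin n)), ⟨fun x => ?_, fun x hx => ?_⟩, ?_⟩
  · exact S₁.starProjection_apply_mem (e.symm x)
  · have h : e.symm x ∈ S₁ := by
      change e (e.symm x) ∈ S
      simpa using hx
    have h' := Submodule.starProjection_eq_self_iff.2 h
    simp [h']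
  · refine (ContinuousLinearMap.opNorm_comp_le _ _).trans ?_
    gcongr
    refine (ContinuousLinearMap.opNorm_comp_le _ _).trans ?_
    gcongr
    exact S₁.starProjection_norm_le

theorem SubspaceTendsto.const {n : ℕ} (S : Submodule ℂ (Fin n → ℂ)) (l : Filter ι) :
    SubspaceTendsto (fun _ => S) l S := by
  obtain ⟨_, hC⟩ := exists_isProj_norm_le n
  obtain ⟨P, hP, -⟩ := hC S
  exact ⟨fun _ => P, P, fun _ => hP, hP, tendsto_const_nhds⟩

theorem Filter.Tendsto.apply_continuousLinearMap {E F : Type*} [NormedAddCommGroup E]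
    [NormedSpace ℂ E] [NormedAddCommGroup F] [NormedSpace ℂ F] {l : Filter ι} {r : ι → E →L[ℂ] F}
    {r' : E →L[ℂ] F} {v : ι → E} {v' : E} (hr : Tendsto r l (𝓝 r')) (hv : Tendsto v l (𝓝 v')) :
    Tendsto (fun t => r t (v t)) l (𝓝 (r' v')) :=
  (isBoundedBilinearMap_apply.continuous.tendsto (r', v')).comp (hr.prodMk_nhds hv)

theorem exists_subspaceTendsto {n : ℕ} (S : ι → Submodule ℂ (Fin n → ℂ)) (U : Ultrafilter ι) :
    ∃ S', SubspaceTendsto S U S' := by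
  obtain ⟨C, hC⟩ := exists_isProj_norm_le n
  choose P hP hPC using fun t => hC (S t)
  have hcomp := isCompact_closedBall (0 : (Fin n → ℂ) →L[ℂ] (Fin n → ℂ)) C
  have hmem : Metric.closedBall (0 : (Fin n → ℂ) →L[ℂ] (Fin n → ℂ)) C ∈ U.map P :=
    Filter.mem_map.2 (Filter.univ_mem' fun t => by simpa using hPC t)
  obtain ⟨P', -, hlim⟩ := hcomp.ultrafilter_le_nhds' _ hmem
  have hlim : Tendsto P U (𝓝 P') := hlim
  have hidem (x : Fin n → ℂ) : P' (P' x) = P' x := by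
    have h₁ : Tendsto (fun t => P t x) U (𝓝 (P' x)) := hlim.apply_continuousLinearMap tendsto_const_nhds
    have h₂ : Tendsto (fun t => P t (P t x)) U (𝓝 (P' (P' x))) := hlim.apply_continuousLinearMap h₁
    refine tendsto_nhds_unique h₂ (h₁.congr fun t => ?_)
    exact ((hP t).map_id _ ((hP t).map_mem x)).symm
  refine ⟨LinearMap.range P'.toLinearMap, P, P', hP, ⟨fun x => ⟨x, rfl⟩, ?_⟩, hlim⟩
  rintro _ ⟨x, rfl⟩
  exact hidem x

theorem SubspaceTendsto.map_mem {m n : ℕ} {l : Filter ι} [l.NeBot]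
    {S : ι → Submodule ℂ (Fin m → ℂ)} {S' : Submodule ℂ (Fin m → ℂ)}
    {T : ι → Submodule ℂ (Fin n → ℂ)} {T' : Submodule ℂ (Fin n → ℂ)}
    (hS : SubspaceTendsto S l S') (hT : SubspaceTendsto T l T')
    {r : ι → (Fin m → ℂ) →L[ℂ] (Fin n → ℂ)} {r' : (Fin m → ℂ) →L[ℂ] (Fin n → ℂ)}
    (hr : Tendsto r l (𝓝 r')) (h : ∀ᶠ t in l, ∀ x ∈ S t, r t x ∈ T t) :
    ∀ x ∈ S', r' x ∈ T' := by
  obtain ⟨P, P', hP, hP', hlimP⟩ := hS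
  obtain ⟨Q, Q', hQ, hQ', hlimQ⟩ := hT
  intro x hx
  have h₁ : Tendsto (fun t => r t (P t x)) l (𝓝 (r' (P' x))) :=
    hr.apply_continuousLinearMap (hlimP.apply_continuousLinearMap tendsto_const_nhds)
  have h₂ := hlimQ.apply_continuousLinearMap h₁
  have h₃ : Q' (r' (P' x)) = r' (P' x) := by
    refine tendsto_nhds_unique h₂ (h₁.congr' ?_)
    filter_upwards [h] with t ht
    exact ((hQ t).map_id _ (ht _ ((hP t).map_mem x))).symm
  rw [hP'.map_id x hx] at h₃
  exact h₃ ▸ hQ'.map_mem _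

theorem SubspaceTendsto.le {n : ℕ} {l : Filter ι} [l.NeBot]
    {S T : ι → Submodule ℂ (Fin n → ℂ)} {S' T' : Submodule ℂ (Fin n → ℂ)}
    (hS : SubspaceTendsto S l S') (hT : SubspaceTendsto T l T')
    (h : ∀ᶠ t in l, S t ≤ T t) : S' ≤ T' :=
  hS.map_mem hT (r := fun _ => ContinuousLinearMap.id ℂ _) tendsto_const_nhds h

theorem SubspaceTendsto.tendsto_finrank {n : ℕ} {l : Filter ι}
    {S : ι → Submodule ℂ (Fin n → ℂ)} {S' : Submodule ℂ (Fin n → ℂ)}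
    (hS : SubspaceTendsto S l S') :
    Tendsto (fun t => (Module.finrank ℂ (S t) : ℝ)) l (𝓝 (Module.finrank ℂ S' : ℝ)) := by
  obtain ⟨P, P', hP, hP', hlim⟩ := hS
  have htr (T : Submodule ℂ (Fin n → ℂ)) (Q : (Fin n → ℂ) →L[ℂ] (Fin n → ℂ))
      (hQ : LinearMap.IsProj T Q) :
      (LinearMap.trace ℂ (Fin n → ℂ) Q.toLinearMap).re = Module.finrank ℂ T := by
    have : LinearMap.IsProj T Q.toLinearMap := ⟨hQ.map_mem, hQ.map_id⟩
    rw [this.trace]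
    simp
  have hcont : Continuous fun Q : (Fin n → ℂ) →L[ℂ] (Fin n → ℂ) =>
      (LinearMap.trace ℂ (Fin n → ℂ) Q.toLinearMap).re :=
    Complex.continuous_re.comp (LinearMap.continuous_of_finiteDimensional
      ((LinearMap.trace ℂ (Fin n → ℂ)) ∘ₗ ContinuousLinearMap.coeLM ℂ))
  have := (hcont.tendsto P').comp hlim
  rw [htr S' P' hP'] at this
  exact this.congr fun t => htr _ _ (hP t)

theorem eventually_exists_linearEquiv_add_smul {E : Type*} [AddCommGroup E] [Module ℂ E]
    [FiniteDimensional ℂ E] (a : E →ₗ[ℂ] E) :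
    ∀ᶠ t in 𝓝[≠] (0 : ℂ), ∃ A : E ≃ₗ[ℂ] E, ∀ x, A x = a x + t • x := by
  have hfin := Module.End.finite_spectrum (-a)
  filter_upwards [nhdsNE_le_cofinite 0 hfin.compl_mem_cofinite] with t ht
  have hu : IsUnit (algebraMap ℂ (Module.End ℂ E) t - (-a)) := by
    simpa [spectrum.mem_iff] using ht
  refine ⟨LinearEquiv.ofBijective _ ((Module.End.isUnit_iff _).1 hu), fun x => ?_⟩
  simp [Module.algebraMap_end_apply, add_comm]

end LimitsOfSubspaces

section Schubert

open Filter Topology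

/-- Membership in the Schubert variety of `K` with respect to the standard flag. -/
def InSchubert {n : ℕ} (K : Finset (Fin n)) (S : Submodule ℂ (Fin n → ℂ)) : Prop :=
  Module.finrank ℂ S = K.card ∧
    ∀ j : Fin K.card, (j : ℕ) + 1 ≤ Module.finrank ℂ
      ((S ⊓ stdFlag n (((K.orderIsoOfFin rfl j : Fin n) : ℕ) + 1) : Submodule ℂ (Fin n → ℂ)))

theorem SubspaceTendsto.inSchubert {ι : Type*} {n : ℕ} {K : Finset (Fin n)} {U : Ultrafilter ι}
    {S : ι → Submodule ℂ (Fin n → ℂ)} {S' : Submodule ℂ (Fin n → ℂ)}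
    (hS : SubspaceTendsto S U S') (h : ∀ᶠ t in (U : Filter ι), InSchubert K (S t)) :
    InSchubert K S' := by
  refine ⟨?_, fun j => ?_⟩
  · have : (Module.finrank ℂ S' : ℝ) = K.card :=
      tendsto_nhds_unique_of_eventuallyEq hS.tendsto_finrank tendsto_const_nhds
        (h.mono fun t ht => congrArg Nat.cast ht.1)
    exact_mod_cast this
  · set F := stdFlag n (((K.orderIsoOfFin rfl j : Fin n) : ℕ) + 1) with hF
    obtain ⟨R', hR⟩ := exists_subspaceTendsto (fun t => S t ⊓ F) U
    have h₁ : R' ≤ S' ⊓ F :=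
      le_inf (hR.le hS (Eventually.of_forall fun _ => inf_le_left))
        (hR.le (.const F _) (Eventually.of_forall fun _ => inf_le_right))
    have h₂ : (((j : ℕ) + 1 : ℕ) : ℝ) ≤ Module.finrank ℂ R' :=
      ge_of_tendsto hR.tendsto_finrank (h.mono fun t ht => by exact_mod_cast ht.2 j)
    exact (Nat.cast_le.1 h₂).trans (Submodule.finrank_mono h₁)

theorem InSchubert.map_eq {m : ℕ} {K K' : Finset (Fin m)} (hc : K.card = K'.card)
    {S S' : Submodule ℂ (Fin m → ℂ)} (hS : InSchubert K S) (hS' : InSchubert K' S')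
    (A : (Fin m → ℂ) ≃ₗ[ℂ] (Fin m → ℂ)) (h : S.map A.toLinearMap ≤ S') :
    S.map A.toLinearMap = S' := by
  apply Submodule.eq_of_le_of_finrank_eq h
  rw [hS'.1, ← hc, ← hS.1]
  exact LinearEquiv.finrank_map_eq A S

theorem isQIntersecting_q33_iff {p q : ℕ} (K : Fin 3 → Finset (Fin p))
    (L : Fin 3 → Finset (Fin q)) :
    IsQIntersecting q33src q33tgt (n33 p q) (fam6 p q K L) ↔
      ∀ (a b : (Fin p → ℂ) →ₗ[ℂ] (Fin p → ℂ)) (c : (Fin q → ℂ) →ₗ[ℂ] (Fin p → ℂ))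
        (d e : (Fin q → ℂ) →ₗ[ℂ] (Fin q → ℂ)),
        ∃ (S : Fin 3 → Submodule ℂ (Fin p → ℂ)) (T : Fin 3 → Submodule ℂ (Fin q → ℂ)),
          (∀ i, InSchubert (K i) (S i)) ∧ (∀ i, InSchubert (L i) (T i)) ∧
          (S 0).map a ≤ S 2 ∧ (S 1).map b ≤ S 2 ∧ (T 0).map c ≤ S 2 ∧
          (T 0).map d ≤ T 1 ∧ (T 0).map e ≤ T 2 := by
  constructor
  · intro h a b c d e
    obtain ⟨S, h₁, h₂, h₃⟩ := h (fun i => match i with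
      | ⟨0, _⟩ => a | ⟨1, _⟩ => b | ⟨2, _⟩ => c | ⟨3, _⟩ => d | ⟨4, _⟩ => e)
    refine ⟨fun i => match i with
      | ⟨0, _⟩ => S 0 | ⟨1, _⟩ => S 1 | ⟨2, _⟩ => S 2, fun i => match i with
      | ⟨0, _⟩ => S 3 | ⟨1, _⟩ => S 4 | ⟨2, _⟩ => S 5, ?_, ?_,
      h₃ 0, h₃ 1, h₃ 2, h₃ 3, h₃ 4⟩
    · intro i
      match i with
      | ⟨0, _⟩ => exact ⟨h₁ 0, h₂ 0⟩
      | ⟨1, _⟩ => exact ⟨h₁ 1, h₂ 1⟩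
      | ⟨2, _⟩ => exact ⟨h₁ 2, h₂ 2⟩
    · intro i
      match i with
      | ⟨0, _⟩ => exact ⟨h₁ 3, h₂ 3⟩
      | ⟨1, _⟩ => exact ⟨h₁ 4, h₂ 4⟩
      | ⟨2, _⟩ => exact ⟨h₁ 5, h₂ 5⟩
  · intro h r
    obtain ⟨S, T, hS, hT, h₀, h₁, h₂, h₃, h₄⟩ := h (r 0) (r 1) (r 2) (r 3) (r 4)
    refine ⟨fun i => match i with
      | ⟨0, _⟩ => S 0 | ⟨1, _⟩ => S 1 | ⟨2, _⟩ => S 2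
      | ⟨3, _⟩ => T 0 | ⟨4, _⟩ => T 1 | ⟨5, _⟩ => T 2, ?_, ?_, ?_⟩
    · intro i
      match i with
      | ⟨0, _⟩ => exact (hS 0).1
      | ⟨1, _⟩ => exact (hS 1).1
      | ⟨2, _⟩ => exact (hS 2).1
      | ⟨3, _⟩ => exact (hT 0).1
      | ⟨4, _⟩ => exact (hT 1).1
      | ⟨5, _⟩ => exact (hT 2).1
    · intro i
      match i with
      | ⟨0, _⟩ => exact (hS 0).2
      | ⟨1, _⟩ => exact (hS 1).2
      | ⟨2, _⟩ => exact (hS 2).2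
      | ⟨3, _⟩ => exact (hT 0).2
      | ⟨4, _⟩ => exact (hT 1).2
      | ⟨5, _⟩ => exact (hT 2).2
    · intro i
      match i with
      | ⟨0, _⟩ => exact h₀
      | ⟨1, _⟩ => exact h₁
      | ⟨2, _⟩ => exact h₂
      | ⟨3, _⟩ => exact h₃
      | ⟨4, _⟩ => exact h₄

/-- Every linear map sends some subspace, in Schubert position `L i` with respect to three
arbitrary flags, into a subspace in Schubert position `K i` with respect to three arbitrary
flags. -/
def IsFlagIntersecting {p q : ℕ} (K : Fin 3 → Finset (Fin p)) (L : Fin 3 → Finset (Fin q)) :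
    Prop :=
  ∀ (A : Fin 3 → (Fin p → ℂ) ≃ₗ[ℂ] (Fin p → ℂ)) (B : Fin 3 → (Fin q → ℂ) ≃ₗ[ℂ] (Fin q → ℂ))
    (f : (Fin q → ℂ) →ₗ[ℂ] (Fin p → ℂ)),
    ∃ (S : Submodule ℂ (Fin p → ℂ)) (T : Submodule ℂ (Fin q → ℂ)),
      (∀ i, InSchubert (K i) (S.map (A i).toLinearMap)) ∧
      (∀ i, InSchubert (L i) (T.map (B i).toLinearMap)) ∧ T.map f ≤ S

theorem IsFlagIntersecting.comp {p q : ℕ} {K : Fin 3 → Finset (Fin p)}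
    {L : Fin 3 → Finset (Fin q)} (h : IsFlagIntersecting K L) (σ τ : Equiv.Perm (Fin 3)) :
    IsFlagIntersecting (K ∘ σ) (L ∘ τ) := by
  intro A B f
  obtain ⟨S, T, hS, hT, hST⟩ := h (A ∘ σ.symm) (B ∘ τ.symm) f
  exact ⟨S, T, fun i => by simpa using hS (σ i), fun i => by simpa using hT (τ i), hST⟩

theorem IsQIntersecting.isFlagIntersecting {p q : ℕ} {K : Fin 3 → Finset (Fin p)}
    {L : Fin 3 → Finset (Fin q)}
    (h : IsQIntersecting q33src q33tgt (n33 p q) (fam6 p q K L))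
    (hK : ∀ i j, (K i).card = (K j).card) (hL : ∀ i j, (L i).card = (L j).card) :
    IsFlagIntersecting K L := by
  rw [isQIntersecting_q33_iff] at h
  intro A B f
  obtain ⟨S, T, hS, hT, h₀, h₁, h₂, h₃, h₄⟩ := h
    ((A 0).symm.trans (A 2)).toLinearMap ((A 1).symm.trans (A 2)).toLinearMap
    ((A 2).toLinearMap ∘ₗ f ∘ₗ (B 0).symm.toLinearMap)
    ((B 0).symm.trans (B 1)).toLinearMap ((B 0).symm.trans (B 2)).toLinearMap
  have e₀ := (hS 0).map_eq (hK 0 2) (hS 2) _ h₀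
  have e₁ := (hS 1).map_eq (hK 1 2) (hS 2) _ h₁
  have e₃ := (hT 0).map_eq (hL 0 1) (hT 1) _ h₃
  have e₄ := (hT 0).map_eq (hL 0 2) (hT 2) _ h₄
  refine ⟨(S 2).map (A 2).symm.toLinearMap, (T 0).map (B 0).symm.toLinearMap, ?_, ?_, ?_⟩
  · have key (i : Fin 3)
        (e : (S i).map ((A i).symm.trans (A 2)).toLinearMap = S 2) :
        InSchubert (K i) (((S 2).map (A 2).symm.toLinearMap).map (A i).toLinearMap) := by
      convert hS i
      ext x
      simp [← e]
    intro i
    match i with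
    | 0 => exact key 0 e₀
    | 1 => exact key 1 e₁
    | 2 => exact key 2 (by ext x; simp)
  · have key (i : Fin 3)
        (e : (T 0).map ((B 0).symm.trans (B i)).toLinearMap = T i) :
        InSchubert (L i) (((T 0).map (B 0).symm.toLinearMap).map (B i).toLinearMap) := by
      convert hT i
      ext x
      simp [← e]
    intro i
    match i with
    | 0 => exact key 0 (by ext x; simp)
    | 1 => exact key 1 e₃
    | 2 => exact key 2 e₄
  · rintro _ ⟨_, ⟨x, hx, rfl⟩, rfl⟩
    exact ⟨_, h₂ ⟨x, hx, rfl⟩, by simp⟩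

theorem IsFlagIntersecting.isQIntersecting {p q : ℕ} {K : Fin 3 → Finset (Fin p)}
    {L : Fin 3 → Finset (Fin q)} (h : IsFlagIntersecting K L) :
    IsQIntersecting q33src q33tgt (n33 p q) (fam6 p q K L) := by
  rw [isQIntersecting_q33_iff]
  intro a b c d e
  let U : Ultrafilter ℂ := Ultrafilter.of (𝓝[≠] (0 : ℂ))
  have hU : (U : Filter ℂ) ≤ 𝓝[≠] 0 := Ultrafilter.of_le _
  have hev : ∀ᶠ t in (U : Filter ℂ),
      ∃ ST : (Fin 3 → Submodule ℂ (Fin p → ℂ)) × (Fin 3 → Submodule ℂ (Fin q → ℂ)),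
        (∀ i, InSchubert (K i) (ST.1 i)) ∧ (∀ i, InSchubert (L i) (ST.2 i)) ∧
        (∀ x ∈ ST.1 0, a x + t • x ∈ ST.1 2) ∧ (∀ x ∈ ST.1 1, b x + t • x ∈ ST.1 2) ∧
        (∀ x ∈ ST.2 0, c x ∈ ST.1 2) ∧
        (∀ x ∈ ST.2 0, d x + t • x ∈ ST.2 1) ∧ (∀ x ∈ ST.2 0, e x + t • x ∈ ST.2 2) := by
    filter_upwards [hU (eventually_exists_linearEquiv_add_smul a),
      hU (eventually_exists_linearEquiv_add_smul b),
      hU (eventually_exists_linearEquiv_add_smul d),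
      hU (eventually_exists_linearEquiv_add_smul e)]
    rintro t ⟨A₀, hA₀⟩ ⟨A₁, hA₁⟩ ⟨B₁, hB₁⟩ ⟨B₂, hB₂⟩
    obtain ⟨A, hA⟩ : ∃ A : Fin 3 → (Fin p → ℂ) ≃ₗ[ℂ] (Fin p → ℂ),
        A 0 = A₀.symm ∧ A 1 = A₁.symm ∧ A 2 = .refl ℂ _ :=
      ⟨![A₀.symm, A₁.symm, .refl ℂ _], rfl, rfl, rfl⟩
    obtain ⟨B, hB⟩ : ∃ B : Fin 3 → (Fin q → ℂ) ≃ₗ[ℂ] (Fin q → ℂ),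
        B 0 = .refl ℂ _ ∧ B 1 = B₁ ∧ B 2 = B₂ :=
      ⟨![.refl ℂ _, B₁, B₂], rfl, rfl, rfl⟩
    obtain ⟨S, T, hS, hT, hST⟩ := h A B c
    refine ⟨⟨fun i => S.map (A i).toLinearMap, fun i => T.map (B i).toLinearMap⟩,
      hS, hT, ?_, ?_, ?_, ?_, ?_⟩
    · rintro _ ⟨x, hx, rfl⟩
      exact ⟨x, hx, by simp [hA, ← hA₀]⟩
    · rintro _ ⟨x, hx, rfl⟩
      exact ⟨x, hx, by simp [hA, ← hA₁]⟩
    · rintro _ ⟨x, hx, rfl⟩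
      exact ⟨c x, hST ⟨x, hx, rfl⟩, by simp [hA, hB]⟩
    · rintro _ ⟨x, hx, rfl⟩
      exact ⟨x, hx, by simp [hB, ← hB₁]⟩
    · rintro _ ⟨x, hx, rfl⟩
      exact ⟨x, hx, by simp [hB, ← hB₂]⟩
  obtain ⟨ST, hev⟩ := hev.choice
  choose S hS using fun i => exists_subspaceTendsto (fun t => (ST t).1 i) U
  choose T hT using fun i => exists_subspaceTendsto (fun t => (ST t).2 i) U
  have hlim {n : ℕ} (a : (Fin n → ℂ) →ₗ[ℂ] (Fin n → ℂ)) :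
      Tendsto (fun t : ℂ => a.toContinuousLinearMap + t • ContinuousLinearMap.id ℂ (Fin n → ℂ))
        U (𝓝 a.toContinuousLinearMap) := by
    have : Continuous fun t : ℂ =>
        a.toContinuousLinearMap + t • ContinuousLinearMap.id ℂ (Fin n → ℂ) := by fun_prop
    have h₀ := (this.tendsto 0).mono_left (hU.trans nhdsWithin_le_nhds)
    have h₁ : a.toContinuousLinearMap + (0 : ℂ) • ContinuousLinearMap.id ℂ (Fin n → ℂ) =
        a.toContinuousLinearMap := by
      ext1 x
      change a x + (0 : ℂ) • x = a x
      simp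
    rwa [h₁] at h₀
  refine ⟨S, T, fun i => (hS i).inSchubert (hev.mono fun t ht => ht.1 i),
    fun i => (hT i).inSchubert (hev.mono fun t ht => ht.2.1 i), ?_, ?_, ?_, ?_, ?_⟩
  · exact Submodule.map_le_iff_le_comap.2
      ((hS 0).map_mem (hS 2) (hlim a) (hev.mono fun t ht => ht.2.2.1))
  · exact Submodule.map_le_iff_le_comap.2
      ((hS 1).map_mem (hS 2) (hlim b) (hev.mono fun t ht => ht.2.2.2.1))
  · exact Submodule.map_le_iff_le_comap.2
      ((hT 0).map_mem (hS 2) (r := fun _ => c.toContinuousLinearMap) tendsto_const_nhds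
        (hev.mono fun t ht => ht.2.2.2.2.1))
  · exact Submodule.map_le_iff_le_comap.2
      ((hT 0).map_mem (hT 1) (hlim d) (hev.mono fun t ht => ht.2.2.2.2.2.1))
  · exact Submodule.map_le_iff_le_comap.2
      ((hT 0).map_mem (hT 2) (hlim e) (hev.mono fun t ht => ht.2.2.2.2.2.2))

/-- The dimension of the Schubert variety of `K`. -/
def schubertDim {n : ℕ} (K : Finset (Fin n)) : ℤ :=
  ∑ j : Fin K.card, ((((K.orderIsoOfFin rfl j : Fin n) : ℕ) : ℤ) - ((j : ℕ) : ℤ))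

theorem edimQB_q33 {p q : ℕ} (K : Fin 3 → Finset (Fin p)) (L : Fin 3 → Finset (Fin q)) :
    edimQB q33src q33tgt (n33 p q) (fam6 p q K L) =
      ∑ i, schubertDim (K i) + ∑ i, schubertDim (L i) -
      (((K 0).card : ℤ) * (p - (K 2).card) + (K 1).card * (p - (K 2).card) +
        (L 0).card * (p - (K 2).card) + (L 0).card * (q - (L 1).card) +
        (L 0).card * (q - (L 2).card)) := by
  rw [edimQB, Fin.sum_univ_six, Fin.sum_univ_five, Fin.sum_univ_three, Fin.sum_univ_three]
  change schubertDim (K 0) + schubertDim (K 1) + schubertDim (K 2) + schubertDim (L 0) +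
    schubertDim (L 1) + schubertDim (L 2) - (((K 0).card : ℤ) * (p - (K 2).card) +
      (K 1).card * (p - (K 2).card) + (L 0).card * (p - (K 2).card) +
      (L 0).card * (q - (L 1).card) + (L 0).card * (q - (L 2).card)) = _
  ring

theorem edimQB_q33_comp {p q : ℕ} {K : Fin 3 → Finset (Fin p)} {L : Fin 3 → Finset (Fin q)}
    (hK : ∀ i j, (K i).card = (K j).card) (hL : ∀ i j, (L i).card = (L j).card)
    (σ τ : Equiv.Perm (Fin 3)) :
    edimQB q33src q33tgt (n33 p q) (fam6 p q (K ∘ σ) (L ∘ τ)) =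
      edimQB q33src q33tgt (n33 p q) (fam6 p q K L) := by
  rw [edimQB_q33, edimQB_q33]
  simp only [Function.comp_apply, Equiv.sum_comp σ fun i => schubertDim (K i),
    Equiv.sum_comp τ fun i => schubertDim (L i)]
  rw [hK (σ 0) 0, hK (σ 1) 1, hK (σ 2) 2, hL (τ 0) 0, hL (τ 1) 1, hL (τ 2) 2]

end Schubert

/-- `Σ₃ × Σ₃`-symmetry of `Int(𝒜,p,q)` and `Int₀(𝒜,p,q)`.
If `[K₁,…,K₆]` belongs to `Int(𝒜,p,q)` then so does the family obtained by permuting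
`K₁,K₂,K₃` and `K₄,K₅,K₆`; the same holds for `Int₀(𝒜,p,q)`. -/
theorem int_Apq_symmetry (p q : ℕ) (hp : 1 ≤ p) (hq : 1 ≤ q)
    (K : Fin 3 → Finset (Fin p)) (L : Fin 3 → Finset (Fin q))
    (σ τ : Equiv.Perm (Fin 3)) :
    ((IsQIntersecting q33src q33tgt (n33 p q) (fam6 p q K L) ∧
        (K 0).card = (K 1).card ∧ (K 1).card = (K 2).card ∧
        (L 0).card = (L 1).card ∧ (L 1).card = (L 2).card) →
      (IsQIntersecting q33src q33tgt (n33 p q) (fam6 p q (K ∘ σ) (L ∘ τ)) ∧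
        (K (σ 0)).card = (K (σ 1)).card ∧ (K (σ 1)).card = (K (σ 2)).card ∧
        (L (τ 0)).card = (L (τ 1)).card ∧ (L (τ 1)).card = (L (τ 2)).card)) ∧
    ((IsQIntersecting q33src q33tgt (n33 p q) (fam6 p q K L) ∧
        (K 0).card = (K 1).card ∧ (K 1).card = (K 2).card ∧
        (L 0).card = (L 1).card ∧ (L 1).card = (L 2).card ∧
        edimQB q33src q33tgt (n33 p q) (fam6 p q K L) = 0) →
      (IsQIntersecting q33src q33tgt (n33 p q) (fam6 p q (K ∘ σ) (L ∘ τ)) ∧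
        (K (σ 0)).card = (K (σ 1)).card ∧ (K (σ 1)).card = (K (σ 2)).card ∧
        (L (τ 0)).card = (L (τ 1)).card ∧ (L (τ 1)).card = (L (τ 2)).card ∧
        edimQB q33src q33tgt (n33 p q) (fam6 p q (K ∘ σ) (L ∘ τ)) = 0)) := by
  have hcard {n : ℕ} {M : Fin 3 → Finset (Fin n)} (h₀ : (M 0).card = (M 1).card)
      (h₁ : (M 1).card = (M 2).card) (i j : Fin 3) : (M i).card = (M j).card := by
    fin_cases i <;> fin_cases j <;> simp [h₀, h₁]
  have hint (hQ : IsQIntersecting q33src q33tgt (n33 p q) (fam6 p q K L))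
      (hK : ∀ i j, (K i).card = (K j).card) (hL : ∀ i j, (L i).card = (L j).card) :
      IsQIntersecting q33src q33tgt (n33 p q) (fam6 p q (K ∘ σ) (L ∘ τ)) :=
    ((hQ.isFlagIntersecting hK hL).comp σ τ).isQIntersecting
  constructor
  · rintro ⟨hQ, hK₀, hK₁, hL₀, hL₁⟩
    have hK := hcard hK₀ hK₁
    have hL := hcard hL₀ hL₁
    exact ⟨hint hQ hK hL, hK _ _, hK _ _, hL _ _, hL _ _⟩
  · rintro ⟨hQ, hK₀, hK₁, hL₀, hL₁, hE⟩
    have hK := hcard hK₀ hK₁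
    have hL := hcard hL₀ hL₁
    exact ⟨hint hQ hK hL, hK _ _, hK _ _, hL _ _, hL _ _,
      (edimQB_q33_comp hK hL σ τ).trans hE⟩
end

section
/- Let p, q ≥ 1, n = p+q, Z = diag(q,…,q,−p,…,−p) (q repeated p times, −p repeated q times). Let λ = (λ(1) ≥ … ≥ λ(n)) be a weakly decreasing real sequence and D_λ = diag(λ(1),…,λ(n)). Then for every g ∈ U(p,q), the trace tr(g D_λ g^{-1} Z) is real and satisfies tr(g D_λ g^{-1} Z) ≥ tr(D_λ Z) ≥ 0. -/
open Matrix

/-- The diagonal entries of `etaMat`, as real numbers. -/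
def etaSign (p : ℕ) {n : ℕ} (i : Fin n) : ℝ := if (i : ℕ) < p then 1 else -1

/-- The diagonal entries of `Zmat`, as real numbers. -/
def zEntry (p q : ℕ) {n : ℕ} (i : Fin n) : ℝ := if (i : ℕ) < p then q else -p

lemma etaSign_mul_self (p : ℕ) {n : ℕ} (i : Fin n) : etaSign p i * etaSign p i = 1 := by
  unfold etaSign; split_ifs <;> norm_num

lemma etaSign_mul_zEntry_nonneg (p q : ℕ) {n : ℕ} (i : Fin n) :
    0 ≤ etaSign p i * zEntry p q i := by
  unfold etaSign zEntry; split_ifs <;> simp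

lemma etaMat_eq (p q : ℕ) :
    etaMat p q = Matrix.diagonal fun i => (etaSign p i : ℂ) := by
  unfold etaMat etaSign
  congr 1; ext i; split_ifs <;> simp

lemma Zmat_eq (p q : ℕ) :
    Zmat p q = Matrix.diagonal fun i => (zEntry p q i : ℂ) := by
  unfold Zmat zEntry
  congr 1; ext i; split_ifs <;> simp

lemma etaMat_mul_self (p q : ℕ) : etaMat p q * etaMat p q = 1 := by
  rw [etaMat_eq, Matrix.diagonal_mul_diagonal, ← Matrix.diagonal_one]
  congr 1; ext i
  exact_mod_cast etaSign_mul_self p i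

lemma sum_zEntry (p q : ℕ) : ∑ i : Fin (p + q), zEntry p q i = 0 := by
  simp [Fin.sum_univ_add, zEntry, mul_comm]

/-- A vector of total weight zero, nonnegative on the first `p` coordinates and nonpositive on
the others, pairs nonnegatively with any weakly decreasing sequence. -/
lemma sum_antitone_mul_nonneg {p n : ℕ} (hp : 1 ≤ p) (hpn : p ≤ n)
    {lam : Fin n → ℝ} (hlam : Antitone lam) {x : Fin n → ℝ}
    (hx : ∀ i, 0 ≤ etaSign p i * x i) (hsum : ∑ i, x i = 0) :
    0 ≤ ∑ i, lam i * x i := by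
  have key : ∀ i, 0 ≤ (lam i - lam ⟨p - 1, by omega⟩) * x i := by
    intro i
    have h := hx i
    unfold etaSign at h
    split_ifs at h with hi
    · refine mul_nonneg (sub_nonneg.2 (hlam ?_)) (by linarith)
      rw [Fin.le_def]; dsimp only; omega
    · refine mul_nonneg_of_nonpos_of_nonpos (sub_nonpos.2 (hlam ?_)) (by linarith)
      rw [Fin.le_def]; dsimp only; omega
  have h := Finset.sum_nonneg fun i (_ : i ∈ Finset.univ) => key i
  simpa [sub_mul, Finset.sum_sub_distrib, ← Finset.mul_sum, hsum] using h

namespace InUpq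

variable {p q : ℕ} {g : Matrix (Fin (p + q)) (Fin (p + q)) ℂ}

lemma inv_mul (hg : InUpq p q g) : etaMat p q * gᴴ * etaMat p q * g = 1 := by
  have h : gᴴ * etaMat p q * g = etaMat p q := hg
  rw [Matrix.mul_assoc, Matrix.mul_assoc, ← Matrix.mul_assoc gᴴ, h, etaMat_mul_self]

lemma inv_eq (hg : InUpq p q g) : g⁻¹ = etaMat p q * gᴴ * etaMat p q :=
  Matrix.inv_eq_left_inv hg.inv_mul

lemma mul_etaMat_mul_conjTranspose (hg : InUpq p q g) :
    g * etaMat p q * gᴴ = etaMat p q := by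
  have h := mul_eq_one_comm.1 hg.inv_mul
  calc g * etaMat p q * gᴴ
      = g * (etaMat p q * gᴴ * etaMat p q) * etaMat p q := by
        simp only [Matrix.mul_assoc, etaMat_mul_self, Matrix.mul_one]
    _ = etaMat p q := by rw [h, Matrix.one_mul]

lemma sum_col (hg : InUpq p q g) (j : Fin (p + q)) :
    ∑ i, etaSign p i * Complex.normSq (g i j) = etaSign p j := by
  have h : gᴴ * etaMat p q * g = etaMat p q := hg
  have hj := congrFun (congrFun h j) j
  rw [etaMat_eq, Matrix.mul_apply, Matrix.diagonal_apply_eq] at hj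
  simp only [Matrix.mul_diagonal, Matrix.conjTranspose_apply] at hj
  rw [← Complex.ofReal_inj, ← hj]
  push_cast
  refine Finset.sum_congr rfl fun i _ => ?_
  rw [Complex.normSq_eq_conj_mul_self, starRingEnd_apply]
  ring

lemma sum_row (hg : InUpq p q g) (i : Fin (p + q)) :
    ∑ j, etaSign p j * Complex.normSq (g i j) = etaSign p i := by
  have hi := congrFun (congrFun hg.mul_etaMat_mul_conjTranspose i) i
  rw [etaMat_eq, Matrix.mul_apply, Matrix.diagonal_apply_eq] at hi
  simp only [Matrix.mul_diagonal, Matrix.conjTranspose_apply] at hi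
  rw [← Complex.ofReal_inj, ← hi]
  push_cast
  refine Finset.sum_congr rfl fun j _ => ?_
  rw [Complex.normSq_eq_conj_mul_self, starRingEnd_apply]
  ring

lemma trace_conj_mul_Zmat (hg : InUpq p q g) (lam : Fin (p + q) → ℝ) :
    Matrix.trace (g * Dmat lam * g⁻¹ * Zmat p q) =
      ((∑ j, lam j * (etaSign p j *
        ∑ i, etaSign p i * zEntry p q i * Complex.normSq (g i j)) : ℝ) : ℂ) := by
  rw [hg.inv_eq, Zmat_eq, etaMat_eq, Dmat, Matrix.trace]
  simp only [Matrix.diag_apply, Matrix.mul_diagonal, Matrix.mul_apply (M := g * _),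
    Matrix.diagonal_mul, Matrix.conjTranspose_apply, Finset.sum_mul, Finset.mul_sum]
  rw [Finset.sum_comm]
  push_cast
  refine Finset.sum_congr rfl fun j _ => Finset.sum_congr rfl fun i _ => ?_
  rw [Complex.normSq_eq_conj_mul_self, starRingEnd_apply]
  ring

lemma etaSign_mul_zEntry_le (hg : InUpq p q g) (j : Fin (p + q)) :
    etaSign p j * zEntry p q j ≤
      ∑ i, etaSign p i * zEntry p q i * Complex.normSq (g i j) := by
  calc etaSign p j * zEntry p q j
      = ∑ i, zEntry p q j * (etaSign p i * Complex.normSq (g i j)) := by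
        rw [← Finset.mul_sum, hg.sum_col, mul_comm]
    _ ≤ _ := by
        refine Finset.sum_le_sum fun i _ => ?_
        rw [← mul_assoc]
        refine mul_le_mul_of_nonneg_right ?_ (Complex.normSq_nonneg _)
        have h₁ : (0 : ℝ) ≤ p := Nat.cast_nonneg p
        have h₂ : (0 : ℝ) ≤ q := Nat.cast_nonneg q
        unfold etaSign zEntry
        split_ifs <;> linarith

lemma sum_etaSign_mul_sum (hg : InUpq p q g) :
    ∑ j, etaSign p j * ∑ i, etaSign p i * zEntry p q i * Complex.normSq (g i j) = 0 := by
  simp only [Finset.mul_sum]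
  rw [Finset.sum_comm, ← sum_zEntry p q]
  refine Finset.sum_congr rfl fun i _ => ?_
  calc ∑ j, etaSign p j * (etaSign p i * zEntry p q i * Complex.normSq (g i j))
      = etaSign p i * zEntry p q i * ∑ j, etaSign p j * Complex.normSq (g i j) := by
        rw [Finset.mul_sum]
        exact Finset.sum_congr rfl fun j _ => by ring
    _ = zEntry p q i := by
        rw [hg.sum_row]
        linear_combination zEntry p q i * etaSign_mul_self p i

end InUpq

lemma trace_Dmat_mul_Zmat (p q : ℕ) (lam : Fin (p + q) → ℝ) :
    Matrix.trace (Dmat lam * Zmat p q) = ((∑ j, lam j * zEntry p q j : ℝ) : ℂ) := by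
  rw [Zmat_eq, Dmat, Matrix.diagonal_mul_diagonal, Matrix.trace_diagonal]
  push_cast
  rfl

/-- For `λ` weakly decreasing and `g ∈ U(p,q)`, the trace
`tr(g D_λ g⁻¹ Z)` is real and satisfies `tr(g D_λ g⁻¹ Z) ≥ tr(D_λ Z) ≥ 0`. -/
theorem trace_Z_lower_bound (p q : ℕ) (hp : 1 ≤ p) (hq : 1 ≤ q)
    (lam : Fin (p + q) → ℝ) (hlam : Antitone lam)
    (g : Matrix (Fin (p + q)) (Fin (p + q)) ℂ) (hg : InUpq p q g) :
    (Matrix.trace (g * Dmat lam * g⁻¹ * Zmat p q)).im = 0 ∧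
    (Matrix.trace (Dmat lam * Zmat p q)).re ≤
      (Matrix.trace (g * Dmat lam * g⁻¹ * Zmat p q)).re ∧
    0 ≤ (Matrix.trace (Dmat lam * Zmat p q)).re := by
  have hpn : p ≤ p + q := Nat.le_add_right p q
  rw [hg.trace_conj_mul_Zmat, trace_Dmat_mul_Zmat, Complex.ofReal_re, Complex.ofReal_re]
  refine ⟨Complex.ofReal_im _, ?_, sum_antitone_mul_nonneg hp hpn hlam
    (etaSign_mul_zEntry_nonneg p q) (sum_zEntry p q)⟩
  rw [← sub_nonneg, ← Finset.sum_sub_distrib]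
  simp only [← mul_sub]
  refine sum_antitone_mul_nonneg hp hpn hlam (fun j => ?_) ?_
  · rw [mul_sub, ← mul_assoc, etaSign_mul_self, one_mul, sub_nonneg]
    exact hg.etaSign_mul_zEntry_le j
  · rw [Finset.sum_sub_distrib, hg.sum_etaSign_mul_sum, sum_zEntry, sub_zero]
end
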